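/- arXiv:math/0611547 — 4 statements merged into one kernel-verified Lean document; each statement's English description precedes it below -/
import Mathlib

section
/- If χ is an irreducible complex character of G with χ(1) = q+1 (a principal series character), then Γ(χ) = m + N, where N := #{ℓ ∈ {2,3,7} : ℓ · dim χ^{H_ℓ} = q−1}. -/
open scoped BigOperators Classical

noncomputable section

/-- The projective special linear group `PSL(2, F) = SL(2, F)/{±I}` (for `F` a finite
field of odd characteristic the center of `SL(2,F)` is exactly `{±I}`). -/
abbrev PSL2 (F : Type) [Field F] : Type :=
  Matrix.SpecialLinearGroup (Fin 2) F ⧸ Subgroup.center (Matrix.SpecialLinearGroup (Fin 2) F)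

/-- `χ` is the character of some finite-dimensional complex representation of `G`. -/
def IsCharacter (G : Type) [Group G] (χ : G → ℂ) : Prop :=
  ∃ V : FDRep ℂ G, V.character = χ

/-- `χ` is an irreducible complex character of `G`. -/
def IsIrrCharacter (G : Type) [Group G] (χ : G → ℂ) : Prop :=
  ∃ V : FDRep ℂ G, CategoryTheory.Simple V ∧ V.character = χ

/-- `⟨χ|_H, θ⟩ = (1/|H|) ∑_{h ∈ H} χ(h) θ(h)⁻¹`, the multiplicity of the linear
character `θ` of `H` in the restriction `χ|_H`. -/
def restMult {G : Type} [Group G] [Finite G] (H : Subgroup G) (θ : H →* ℂˣ) (χ : G → ℂ) : ℂ :=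
  letI : Fintype H := Fintype.ofFinite H
  (Nat.card H : ℂ)⁻¹ * ∑ h : H, χ h * ((θ h : ℂ))⁻¹

/-- `dim χ^H = (1/|H|) ∑_{h ∈ H} χ(h)`, the dimension of the `H`-fixed subspace. -/
def dimFixed {G : Type} [Group G] [Finite G] (H : Subgroup G) (χ : G → ℂ) : ℂ :=
  letI : Fintype H := Fintype.ofFinite H
  (Nat.card H : ℂ)⁻¹ * ∑ h : H, χ h

/-- The ramification multiplicity
`Γ(χ) = (1/2)⟨χ|_{H₂},θ₂⟩ + (1/3)(⟨χ|_{H₃},θ₃⟩ + 2⟨χ|_{H₃},θ₃²⟩)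
  + (1/7)∑_{k=1}^{6} k ⟨χ|_{H₇},θ₇^k⟩`. -/
def ramMult {G : Type} [Group G] [Finite G] (H2 H3 H7 : Subgroup G)
    (θ2 : H2 →* ℂˣ) (θ3 : H3 →* ℂˣ) (θ7 : H7 →* ℂˣ) (χ : G → ℂ) : ℂ :=
  (1/2) * restMult H2 θ2 χ
    + (1/3) * (restMult H3 θ3 χ + 2 * restMult H3 (θ3 ^ 2) χ)
    + (1/7) * ∑ k ∈ Finset.Icc (1:ℕ) 6, (k : ℂ) * restMult H7 (θ7 ^ k) χ

/-- The base multiplicity `m = (q−ε₂)/4 + (q−ε₃)/3 + 3(q−ε₇)/7`, where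
`ε_ℓ = 1` if `q ≡ 1 (mod ℓ')` and `ε_ℓ = −1` otherwise. -/
def baseMult (q : ℕ) : ℤ :=
  ((q : ℤ) - (if q % 4 = 1 then 1 else -1)) / 4
    + ((q : ℤ) - (if q % 3 = 1 then 1 else -1)) / 3
    + 3 * (((q : ℤ) - (if q % 7 = 1 then 1 else -1)) / 7)

end

open CategoryTheory in
theorem FDRep.eq_top_of_simple {k G : Type} [Field k] [Group G] (V : FDRep k G) [Simple V]
    (W : Submodule k V) (hW : ∀ g, ∀ v ∈ W, V.ρ g v ∈ W) (hne : W ≠ ⊥) : W = ⊤ := by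
  let ρW : Representation k G W :=
    { toFun := fun g => (V.ρ g).restrict (hW g)
      map_one' := by ext; simp
      map_mul' := fun a b => by ext; simp }
  let f : FDRep.of ρW ⟶ V := ⟨InducedCategory.homMk (ModuleCat.ofHom W.subtype), fun g => by
    ext x; rfl⟩
  have hf : ∀ x : W, f x = (x : V) := fun x => rfl
  have hmono : Mono f := ConcreteCategory.mono_of_injective f (fun x y h => Subtype.ext h)
  have hne0 : f ≠ 0 := by
    intro h
    apply hne
    rw [eq_bot_iff]
    intro x hx
    have := hf ⟨x, hx⟩
    rw [h] at this
    exact this.symm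
  have hiso : IsIso f := isIso_of_mono_of_nonzero hne0
  rw [eq_top_iff]
  intro v _
  have := (FDRep.isoToLinearEquiv (asIso f)).surjective v
  obtain ⟨x, hx⟩ := this
  rw [← hx]
  exact x.2

theorem isIntegral_trace_of_pow_eq_one {V : Type} [AddCommGroup V] [Module ℂ V]
    [FiniteDimensional ℂ V] (f : Module.End ℂ V) {n : ℕ} (hn : 0 < n) (hf : f ^ n = 1) :
    IsIntegral ℤ (LinearMap.trace ℂ V f) := by
  rw [Module.End.trace_eq_sum_roots_charpoly_of_splits (IsAlgClosed.splits _)]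
  apply IsIntegral.multiset_sum
  intro x hx
  have hx' : f.HasEigenvalue x := by
    rw [Module.End.hasEigenvalue_iff_isRoot_charpoly]
    exact Polynomial.isRoot_of_mem_roots hx
  obtain ⟨v, hv⟩ := hx'.exists_hasEigenvector
  have h := hv.pow_apply n
  rw [hf] at h
  have hx1 : x ^ n = 1 := by
    by_contra hne
    have : (x ^ n - 1) • v = 0 := by rw [sub_smul, ← h]; simp
    rcases smul_eq_zero.1 this with h' | h'
    · exact hne (sub_eq_zero.1 h')
    · exact hv.2 h'
  exact IsIntegral.of_pow hn (hx1 ▸ isIntegral_one)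

namespace Matrix.SpecialLinearGroup

variable {F : Type} [Field F]

/-- The upper unitriangular matrix with upper right entry `x`. -/
def upperUnip (x : F) : SpecialLinearGroup (Fin 2) F :=
  ⟨!![1, x; 0, 1], by simp [Matrix.det_fin_two]⟩

/-- The diagonal matrix with entries `c` and `c⁻¹`. -/
def diagUnit (c : Fˣ) : SpecialLinearGroup (Fin 2) F :=
  ⟨!![(c : F), 0; 0, ((c⁻¹ : Fˣ) : F)], by simp [Matrix.det_fin_two]⟩

theorem upperUnip_zero : upperUnip (0 : F) = 1 := by
  ext i j; fin_cases i <;> fin_cases j <;> simp [upperUnip]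

theorem upperUnip_mul (x y : F) : upperUnip x * upperUnip y = upperUnip (x + y) := by
  ext i j
  rw [coe_mul, Matrix.mul_apply, Fin.sum_univ_two]
  fin_cases i <;> fin_cases j <;> simp [upperUnip, add_comm]

theorem upperUnip_pow (x : F) (n : ℕ) : upperUnip x ^ n = upperUnip (n * x) := by
  induction n with
  | zero => simp [upperUnip_zero]
  | succ n ih => rw [pow_succ, ih, upperUnip_mul]; push_cast; ring_nf

theorem upperUnip_injective : Function.Injective (upperUnip : F → _) := fun x y h => by
  simpa [upperUnip] using congrArg (fun A : SpecialLinearGroup (Fin 2) F => A 0 1) h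

theorem diagUnit_one : diagUnit (1 : Fˣ) = 1 := by
  ext i j; fin_cases i <;> fin_cases j <;> simp [diagUnit]

theorem diagUnit_neg_one : diagUnit (-1 : Fˣ) = -1 := by
  ext i j; fin_cases i <;> fin_cases j <;> simp [diagUnit]

theorem diagUnit_mul (a b : Fˣ) : diagUnit a * diagUnit b = diagUnit (a * b) := by
  ext i j
  rw [coe_mul, Matrix.mul_apply, Fin.sum_univ_two]
  fin_cases i <;> fin_cases j <;> simp [diagUnit, mul_comm]

theorem diagUnit_pow (c : Fˣ) (n : ℕ) : diagUnit c ^ n = diagUnit (c ^ n) := by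
  induction n with
  | zero => simp [diagUnit_one]
  | succ n ih => rw [pow_succ, ih, diagUnit_mul, pow_succ]

theorem diagUnit_injective : Function.Injective (diagUnit : Fˣ → _) := fun x y h => by
  have := congrArg (fun A : SpecialLinearGroup (Fin 2) F => A 0 0) h
  exact Units.ext (by simpa [diagUnit] using this)

theorem diagUnit_inv (c : Fˣ) : (diagUnit c)⁻¹ = diagUnit c⁻¹ :=
  inv_eq_of_mul_eq_one_right (by rw [diagUnit_mul, mul_inv_cancel, diagUnit_one])

theorem diagUnit_mul_upperUnip (c : Fˣ) (x : F) :
    diagUnit c * upperUnip x = upperUnip ((c : F) ^ 2 * x) * diagUnit c := by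
  ext i j
  rw [coe_mul, coe_mul, Matrix.mul_apply, Matrix.mul_apply, Fin.sum_univ_two, Fin.sum_univ_two]
  fin_cases i <;> fin_cases j <;> simp [diagUnit, upperUnip]
  field_simp

/-- A matrix whose first column is `(c, 0)` is upper triangular. -/
theorem eq_diagUnit_mul_upperUnip (A : SpecialLinearGroup (Fin 2) F) (c : Fˣ)
    (h0 : A 0 0 = c) (h1 : A 1 0 = 0) :
    A = diagUnit c * upperUnip (((c⁻¹ : Fˣ) : F) * A 0 1) := by
  have hd := A.det_coe
  rw [Matrix.det_fin_two, h0, h1, mul_zero, sub_zero] at hd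
  have : A 1 1 = ((c⁻¹ : Fˣ) : F) := by
    rw [Units.val_inv_eq_inv_val]; exact eq_inv_of_mul_eq_one_right hd
  ext i j
  rw [coe_mul, Matrix.mul_apply, Fin.sum_univ_two]
  fin_cases i <;> fin_cases j <;> simp [diagUnit, upperUnip, h0, h1, this]

theorem exists_mulVec_eq {x : Fin 2 → F} (hx : x ≠ 0) :
    ∃ g : SpecialLinearGroup (Fin 2) F, (g : Matrix (Fin 2) (Fin 2) F) *ᵥ ![1, 0] = x := by
  by_cases h : x 0 = 0
  · have h1 : x 1 ≠ 0 := fun h1 => hx (by ext i; fin_cases i <;> simp [h, h1])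
    refine ⟨⟨!![0, -(x 1)⁻¹; x 1, 0], by simp [Matrix.det_fin_two, h1]⟩, ?_⟩
    ext i; fin_cases i <;> simp [h]
  · refine ⟨⟨!![x 0, 0; x 1, (x 0)⁻¹], by simp [Matrix.det_fin_two, h]⟩, ?_⟩
    ext i; fin_cases i <;> simp

theorem mulVec_ne_zero (A : SpecialLinearGroup (Fin 2) F) {x : Fin 2 → F} (hx : x ≠ 0) :
    (A : Matrix (Fin 2) (Fin 2) F) *ᵥ x ≠ 0 := by
  intro h
  apply hx
  have := congrArg (fun y => ((A⁻¹ : SpecialLinearGroup (Fin 2) F) :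
    Matrix (Fin 2) (Fin 2) F) *ᵥ y) h
  simpa only [Matrix.mulVec_mulVec, ← coe_mul, inv_mul_cancel, coe_one, Matrix.one_mulVec,
    Matrix.mulVec_zero] using this

/-- If `g` and `h` send the first basis vector to proportional vectors, they differ by an
upper triangular matrix. -/
theorem eq_mul_of_mulVec_eq_smul {g h : SpecialLinearGroup (Fin 2) F} (c : Fˣ)
    (hgh : (g : Matrix (Fin 2) (Fin 2) F) *ᵥ ![1, 0] =
      (c : F) • ((h : Matrix (Fin 2) (Fin 2) F) *ᵥ ![1, 0])) :
    ∃ y, g = h * (diagUnit c * upperUnip y) := by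
  have key : ((h⁻¹ * g : SpecialLinearGroup (Fin 2) F) : Matrix (Fin 2) (Fin 2) F) *ᵥ ![1, 0]
      = ![(c : F), 0] := by
    rw [coe_mul, ← Matrix.mulVec_mulVec, hgh, Matrix.mulVec_smul, Matrix.mulVec_mulVec,
      ← coe_mul, inv_mul_cancel, coe_one, Matrix.one_mulVec]
    simp
  have k0 := congrFun key 0
  have k1 := congrFun key 1
  simp only [Matrix.mulVec, dotProduct, Fin.sum_univ_two] at k0 k1
  refine ⟨((c⁻¹ : Fˣ) : F) * (h⁻¹ * g) 0 1, ?_⟩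
  rw [← eq_diagUnit_mul_upperUnip (h⁻¹ * g) c (by simpa using k0) (by simpa using k1),
    mul_inv_cancel_left]

/-- A matrix of finite order prime to the characteristic, different from `±1`, and having an
eigenvector is diagonalizable with distinct eigenvalues. -/
theorem exists_eq_conj_diagUnit {A : SpecialLinearGroup (Fin 2) F} {n : ℕ}
    (hn : ((2 * n : ℕ) : F) ≠ 0) (hA : A ^ (2 * n) = 1) (h1 : A ≠ 1) (hm1 : A ≠ -1)
    {x : Fin 2 → F} (hx : x ≠ 0) {d : F} (hd : (A : Matrix (Fin 2) (Fin 2) F) *ᵥ x = d • x) :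
    ∃ c : Fˣ, ∃ k, A = k * diagUnit c * k⁻¹ ∧ c ^ 2 ≠ 1 := by
  have hd0 : d ≠ 0 := by
    rintro rfl
    exact mulVec_ne_zero A hx (by rw [hd, zero_smul])
  obtain ⟨k, rfl⟩ := exists_mulVec_eq hx
  obtain ⟨y, hy⟩ := eq_mul_of_mulVec_eq_smul (g := A * k) (h := k) (Units.mk0 d hd0)
    (by rw [coe_mul, ← Matrix.mulVec_mulVec, hd]; rfl)
  set c := Units.mk0 d hd0
  have hAk : A = k * (diagUnit c * upperUnip y) * k⁻¹ := by rw [← hy, mul_inv_cancel_right]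
  have h2n : (diagUnit c * upperUnip y) ^ (2 * n) = 1 := by
    rw [hAk, conj_pow, mul_inv_eq_one] at hA
    exact mul_eq_left.1 hA
  have hc : c ^ 2 ≠ 1 := by
    intro hc
    have hc' : (c : F) ^ 2 = 1 := by rw [← Units.val_pow_eq_pow_val, hc, Units.val_one]
    have h2 : (diagUnit c * upperUnip y) ^ 2 = upperUnip (2 * y) := by
      rw [pow_two, mul_assoc, ← mul_assoc (upperUnip y), ← one_mul y, ← hc',
        ← diagUnit_mul_upperUnip, hc', one_mul, mul_assoc, upperUnip_mul, ← mul_assoc,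
        diagUnit_mul, ← pow_two, hc, diagUnit_one, one_mul, two_mul]
    rw [pow_mul, h2, upperUnip_pow, ← upperUnip_zero] at h2n
    have hy0 : y = 0 := by
      have := upperUnip_injective h2n
      push_cast at hn
      rw [← mul_assoc, mul_comm (n : F)] at this
      exact (mul_eq_zero.1 this).resolve_left hn
    rw [hy0, upperUnip_zero, mul_one] at hAk
    rcases mul_self_eq_one_iff.1 ((pow_two _).symm.trans hc') with h | h
    · exact h1 (by rw [hAk, Units.ext (h.trans Units.val_one.symm), diagUnit_one]; group)
    · refine hm1 ?_
      rw [hAk, show c = -1 from Units.ext (h.trans (by simp)), diagUnit_neg_one]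
      simp
  have hcc : (c : F) - ((c⁻¹ : Fˣ) : F) ≠ 0 := by
    intro h
    apply hc
    rw [pow_two]
    nth_rewrite 2 [Units.ext (sub_eq_zero.1 h)]
    exact mul_inv_cancel c
  refine ⟨c, k * upperUnip (-((c : F) * y / ((c : F) - ((c⁻¹ : Fˣ) : F)))), ?_, hc⟩
  set z := -((c : F) * y / ((c : F) - ((c⁻¹ : Fˣ) : F))) with hz
  have hb : (diagUnit c * upperUnip y) * upperUnip z = upperUnip z * diagUnit c := by
    rw [mul_assoc, upperUnip_mul, diagUnit_mul_upperUnip]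
    congr 2
    rw [hz]
    simp only [Units.val_inv_eq_inv_val] at *
    have hc0 : (c : F) ≠ 0 := c.ne_zero
    generalize hs : (c : F) - (c : F)⁻¹ = s at *
    field_simp
    rw [← hs]
    field_simp
    ring
  rw [mul_assoc k, ← hb, hAk]
  group

theorem exists_mulVec_eq_smul_of_pow_eq_one [Fintype F] {A : SpecialLinearGroup (Fin 2) F} {n : ℕ}
    (hA : A ^ n = 1) (hn : n ∣ Fintype.card F - 1) :
    ∃ x : Fin 2 → F, x ≠ 0 ∧ ∃ d : F, (A : Matrix (Fin 2) (Fin 2) F) *ᵥ x = d • x := by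
  have hq : A ^ Fintype.card F = A := by
    obtain ⟨m, hm⟩ := hn
    have : Fintype.card F = n * m + 1 := by have := Fintype.card_pos (α := F); omega
    rw [this, pow_succ, pow_mul, hA, one_pow, one_mul]
  have hprod : (∏ a : F, (Polynomial.X - Polynomial.C a)) =
      Polynomial.X ^ Fintype.card F - Polynomial.X := by
    have h := Polynomial.prod_multiset_X_sub_C_of_monic_of_roots_card_eq
      (p := (Polynomial.X ^ Fintype.card F - Polynomial.X : Polynomial F))
      (Polynomial.monic_X_pow_sub (by simpa using Fintype.one_lt_card))
      (by rw [FiniteField.roots_X_pow_card_sub_X,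
        FiniteField.X_pow_card_sub_X_natDegree_eq F Fintype.one_lt_card]; rfl)
    rwa [FiniteField.roots_X_pow_card_sub_X] at h
  have h0 := congrArg (fun p => (Polynomial.aeval (A : Matrix (Fin 2) (Fin 2) F) p).det) hprod
  simp only [map_sub, map_pow, Polynomial.aeval_X] at h0
  rw [← coe_pow, hq, sub_self, Matrix.det_zero] at h0
  have h1 : ∃ a : F, ((A : Matrix (Fin 2) (Fin 2) F) - algebraMap F _ a).det = 0 := by
    have hm := map_prod (Matrix.detMonoidHom.comp
      (Polynomial.aeval (R := F) (A : Matrix (Fin 2) (Fin 2) F)).toRingHom.toMonoidHom)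
      (fun a : F => Polynomial.X - Polynomial.C a) Finset.univ
    obtain ⟨a, -, ha⟩ := Finset.prod_eq_zero_iff.1 (hm.symm.trans h0)
    exact ⟨a, by simpa using ha⟩
  obtain ⟨a, ha⟩ := h1
  obtain ⟨x, hx, hxa⟩ := Matrix.exists_mulVec_eq_zero_iff.2 ha
  refine ⟨x, hx, a, ?_⟩
  rw [Matrix.sub_mulVec, sub_eq_zero] at hxa
  rw [hxa, Matrix.algebraMap_eq_diagonal]
  ext i
  simp [Matrix.mulVec_diagonal]

end Matrix.SpecialLinearGroup

theorem Finset.two_mul_sum_eq_of_sq_invariant {F : Type} [Field F] [Fintype F]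
    (f : F → ℂ) (hf : ∀ (c : Fˣ) x, f ((c : F) ^ 2 * x) = f x) :
    ∃ g : F, 2 * ∑ x : Fˣ, f x = (Fintype.card F - 1 : ℂ) * (f 1 + f g) := by
  have hcard : (Fintype.card Fˣ : ℂ) = (Fintype.card F : ℂ) - 1 := by
    rw [Fintype.card_units, Nat.cast_sub Fintype.card_pos, Nat.cast_one]
  obtain ⟨g, hg⟩ := IsCyclic.exists_generator (α := Fˣ)
  refine ⟨g, ?_⟩
  have hfx : ∀ x : Fˣ, f x + f ((g * x : Fˣ) : F) = f 1 + f g := by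
    intro x
    obtain ⟨n, rfl⟩ := Subgroup.mem_zpowers_iff.1 (hg x)
    rcases Int.even_or_odd' n with ⟨m, rfl | rfl⟩
    · have e1 : ((g ^ (2 * m) : Fˣ) : F) = ((g ^ m : Fˣ) : F) ^ 2 * 1 := by
        rw [mul_one, ← Units.val_pow_eq_pow_val, ← zpow_natCast, ← zpow_mul, mul_comm]; rfl
      have e2 : ((g * g ^ (2 * m) : Fˣ) : F) = ((g ^ m : Fˣ) : F) ^ 2 * g := by
        rw [Units.val_mul, e1]; ring
      rw [e1, e2, hf, hf]
    · have e1 : ((g ^ (2 * m + 1) : Fˣ) : F) = ((g ^ m : Fˣ) : F) ^ 2 * g := by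
        rw [← Units.val_pow_eq_pow_val, ← Units.val_mul, ← zpow_natCast, ← zpow_mul, ← zpow_add_one,
          mul_comm m]; rfl
      have e2 : ((g * g ^ (2 * m + 1) : Fˣ) : F) = ((g ^ (m + 1) : Fˣ) : F) ^ 2 * 1 := by
        rw [mul_one, ← Units.val_pow_eq_pow_val, ← zpow_natCast, ← zpow_mul, ← zpow_one_add]
        congr 2; push_cast; ring
      rw [e1, e2, hf, hf, add_comm]
  have hs : ∑ x : Fˣ, f ((g * x : Fˣ) : F) = ∑ x : Fˣ, f x :=
    Fintype.sum_equiv (Equiv.mulLeft g) _ _ (fun x => rfl)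
  rw [two_mul]
  nth_rewrite 2 [← hs]
  rw [← Finset.sum_add_distrib, Finset.sum_congr rfl (fun x _ => hfx x), Finset.sum_const,
    nsmul_eq_mul, Finset.card_univ, hcard]

section SpecialLinear

open Matrix Matrix.SpecialLinearGroup

variable {F : Type} [Field F] [Fintype F] {V : Type} [AddCommGroup V] [Module ℂ V]
  [FiniteDimensional ℂ V]

theorem Representation.exists_unip_invariant
    (ρ : Representation ℂ (SpecialLinearGroup (Fin 2) F) V)
    (hcard : 5 < Fintype.card F)
    (hdim : Module.finrank ℂ V = Fintype.card F + 1) :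
    ∃ v : V, v ≠ 0 ∧ ∀ x, ρ (upperUnip x) v = v := by
  set q := Fintype.card F with hq
  let P : Module.End ℂ V := ∑ x : F, ρ (upperUnip x)
  have hPinv : ∀ x v, ρ (upperUnip x) (P v) = P v := by
    intro x v
    simp only [P, LinearMap.sum_apply, map_sum]
    refine Fintype.sum_equiv (Equiv.addLeft x) _ _ (fun y => ?_)
    rw [← Module.End.mul_apply, ← map_mul, upperUnip_mul]
    rfl
  by_cases hP : P = 0
  · exfalso
    let f : F → ℂ := fun x => LinearMap.trace ℂ V (ρ (upperUnip x))
    have hf : ∀ (c : Fˣ) x, f ((c : F) ^ 2 * x) = f x := by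
      intro c x
      have : upperUnip ((c : F) ^ 2 * x) = diagUnit c * upperUnip x * (diagUnit c)⁻¹ := by
        rw [diagUnit_mul_upperUnip, mul_inv_cancel_right]
      simp only [f]
      rw [this]
      exact Representation.char_conj ρ _ _
    obtain ⟨g, hg⟩ := Finset.two_mul_sum_eq_of_sq_invariant f hf
    have hf0 : f 0 = (q : ℂ) + 1 := by
      simp only [f, upperUnip_zero, map_one, LinearMap.trace_one, hdim]
      push_cast; rfl
    have hsum : ∑ x : F, f x = 0 := by
      have := congrArg (LinearMap.trace ℂ V) hP
      simpa only [P, map_sum, map_zero] using this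
    have hsum' : ∑ x : F, f x = f 0 + ∑ x : Fˣ, f x := by
      rw [← Finset.add_sum_erase _ _ (Finset.mem_univ 0),
        Finset.sum_subtype (p := fun x : F => x ≠ 0) _ (by simp)]
      congr 1
      exact (Fintype.sum_equiv unitsEquivNeZero _ _ (fun _ => rfl)).symm
    have hintegral : ∀ x, IsIntegral ℤ (f x) := by
      intro x
      refine isIntegral_trace_of_pow_eq_one _ (n := q) Fintype.card_pos ?_
      rw [← map_pow, upperUnip_pow, hq, FiniteField.cast_card_eq_zero, zero_mul, upperUnip_zero, map_one]
    have hs := (hintegral 1).add (hintegral g)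
    have hrel : ((q : ℂ) - 1) * (f 1 + f g) = -2 * (q + 1) := by
      rw [← hg]; linear_combination 2 * hsum - 2 * hsum' - 2 * hf0
    have hq1 : (q : ℂ) - 1 ≠ 0 := by
      rw [sub_ne_zero]; exact_mod_cast (by omega : q ≠ 1)
    have hrat : f 1 + f g = ((-2 * (q + 1) / (q - 1) : ℚ) : ℂ) := by
      push_cast
      rw [eq_div_iff hq1, mul_comm, hrel]
    rw [hrat] at hs
    have hs' : IsIntegral ℤ (-2 * (q + 1) / (q - 1) : ℚ) :=
      (isIntegral_algebraMap_iff (B := ℂ) (algebraMap ℚ ℂ).injective).1 hs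
    obtain ⟨z, hz⟩ := IsIntegrallyClosed.isIntegral_iff.1 hs'
    have hq1' : (q : ℚ) - 1 ≠ 0 := by
      rw [sub_ne_zero]; exact_mod_cast (by omega : q ≠ 1)
    rw [eq_div_iff hq1', eq_intCast] at hz
    have hz' : z * ((q : ℤ) - 1) = -2 * (q + 1) := by exact_mod_cast hz
    have hdvd : ((q : ℤ) - 1) ∣ 4 := ⟨-z - 2, by linear_combination hz'⟩
    have := Int.le_of_dvd (by norm_num) hdvd
    omega
  · obtain ⟨v, hv⟩ : ∃ v, P v ≠ 0 := by
      by_contra! h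
      exact hP (LinearMap.ext h)
    exact ⟨P v, hv, fun x => hPinv x v⟩

theorem Representation.exists_borel_eigenvector
    (ρ : Representation ℂ (SpecialLinearGroup (Fin 2) F) V)
    (hcard : 5 < Fintype.card F)
    (hdim : Module.finrank ℂ V = Fintype.card F + 1) :
    ∃ v : V, v ≠ 0 ∧ (∀ x, ρ (upperUnip x) v = v) ∧
      ∃ α : Fˣ →* ℂ, ∀ c, ρ (diagUnit c) v = α c • v := by
  obtain ⟨v₀, hv₀, hv₀inv⟩ := Representation.exists_unip_invariant ρ hcard hdim
  let W : Submodule ℂ V :=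
    { carrier := {v | ∀ x, ρ (upperUnip x) v = v}
      add_mem' := fun ha hb x => by rw [map_add, ha x, hb x]
      zero_mem' := fun x => map_zero _
      smul_mem' := fun r v hv x => by rw [map_smul, hv x] }
  have hW : ∀ c : Fˣ, ∀ v ∈ W, ρ (diagUnit c) v ∈ W := by
    intro c v hv x
    have e : upperUnip x * diagUnit c =
        diagUnit c * upperUnip (((c⁻¹ : Fˣ) : F) ^ 2 * x) := by
      rw [diagUnit_mul_upperUnip, ← mul_assoc, ← mul_pow, Units.mul_inv, one_pow, one_mul]
    rw [← Module.End.mul_apply, ← map_mul, e, map_mul, Module.End.mul_apply, hv]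
  have : Nontrivial W := ⟨⟨v₀, hv₀inv⟩, 0, fun h => hv₀ (congrArg Subtype.val h)⟩
  obtain ⟨g, hg⟩ := IsCyclic.exists_generator (α := Fˣ)
  obtain ⟨μ, hμ⟩ := Module.End.exists_eigenvalue ((ρ (diagUnit g)).restrict (hW g))
  obtain ⟨w, hw⟩ := hμ.exists_hasEigenvector
  have hw0 : (w : V) ≠ 0 := fun h => hw.2 (Subtype.ext h)
  have hgw : ρ (diagUnit g) (w : V) = μ • (w : V) := congrArg Subtype.val hw.apply_eq_smul
  have hex : ∀ c : Fˣ, ∃ a : ℂ, ρ (diagUnit c) (w : V) = a • (w : V) := by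
    intro c
    obtain ⟨n, rfl⟩ := (mem_powers_iff_mem_zpowers.2 (hg c))
    refine ⟨μ ^ n, ?_⟩
    simp only
    rw [← diagUnit_pow]
    induction n with
    | zero => simp
    | succ n ih => rw [pow_succ', map_mul, Module.End.mul_apply, ih, map_smul, hgw, smul_smul,
        ← pow_succ]
  choose a ha using hex
  refine ⟨w, hw0, w.2, ⟨⟨a, ?_⟩, ?_⟩, ha⟩
  · refine smul_left_injective ℂ hw0 ?_
    simp only
    rw [← ha, diagUnit_one, map_one, one_smul]; rfl
  · intro x y
    refine smul_left_injective ℂ hw0 ?_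
    simp only
    rw [← ha, ← diagUnit_mul, map_mul, Module.End.mul_apply, ha, map_smul, ha, smul_smul, mul_comm]

theorem Representation.exists_principal_series_trace
    (ρ : Representation ℂ (SpecialLinearGroup (Fin 2) F) V)
    (hirr : ∀ W : Submodule ℂ V, (∀ g, ∀ v ∈ W, ρ g v ∈ W) → W ≠ ⊥ → W = ⊤)
    (hcard : 5 < Fintype.card F)
    (hdim : Module.finrank ℂ V = Fintype.card F + 1) (hneg : ρ (-1) = 1) :
    ∃ α : Fˣ →* ℂ, α (-1) = 1 ∧
      (∀ A : SpecialLinearGroup (Fin 2) F, (∀ x : Fin 2 → F, x ≠ 0 → ∀ d : F,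
        (A : Matrix (Fin 2) (Fin 2) F) *ᵥ x ≠ d • x) → LinearMap.trace ℂ V (ρ A) = 0) ∧
      ∀ c : Fˣ, c ^ 2 ≠ 1 → LinearMap.trace ℂ V (ρ (diagUnit c)) = α c + α c⁻¹ := by
  obtain ⟨v, hv0, hvU, α, hα⟩ := Representation.exists_borel_eigenvector ρ hcard hdim
  have hkey : ∀ (g h : SpecialLinearGroup (Fin 2) F) (c : Fˣ),
      (g : Matrix (Fin 2) (Fin 2) F) *ᵥ ![1, 0] =
        (c : F) • ((h : Matrix (Fin 2) (Fin 2) F) *ᵥ ![1, 0]) → ρ g v = α c • ρ h v := by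
    intro g h c hgh
    obtain ⟨y, rfl⟩ := eq_mul_of_mulVec_eq_smul c hgh
    rw [map_mul, map_mul, Module.End.mul_apply, Module.End.mul_apply, hvU, hα, map_smul]
  let L := Projectivization F (Fin 2 → F)
  have hLcard : Nat.card L = Fintype.card F + 1 := by
    rw [← Nat.card_eq_fintype_card]
    exact Projectivization.card_of_finrank_two F _ (by simp)
  have : Finite L := Nat.finite_of_card_ne_zero (by omega)
  let _ : Fintype L := Fintype.ofFinite L
  choose γ hγ using fun p : L => exists_mulVec_eq p.rep_nonzero
  let w : L → V := fun p => ρ (γ p) v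
  have hw : ∀ (g : SpecialLinearGroup (Fin 2) F) (p p' : L) (c : Fˣ),
      (g : Matrix (Fin 2) (Fin 2) F) *ᵥ p.rep = (c : F) • p'.rep → ρ g (w p) = α c • w p' := by
    intro g p p' c h
    rw [← Module.End.mul_apply, ← map_mul]
    apply hkey
    rw [coe_mul, ← Matrix.mulVec_mulVec, hγ, hγ, h]
  have hex : ∀ (g : SpecialLinearGroup (Fin 2) F) (p : L), ∃ (p' : L) (c : Fˣ),
      (g : Matrix (Fin 2) (Fin 2) F) *ᵥ p.rep = (c : F) • p'.rep := by
    intro g p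
    have h0 := mulVec_ne_zero g p.rep_nonzero
    obtain ⟨a, ha⟩ := Projectivization.exists_smul_eq_mk_rep F _ h0
    refine ⟨Projectivization.mk F _ h0, a⁻¹, ?_⟩
    rw [← ha, Units.smul_def, smul_smul, Units.inv_mul, one_smul]
  have hspan : Submodule.span ℂ (Set.range w) = ⊤ := by
    apply hirr
    · intro g x hx
      have hle : Submodule.span ℂ (Set.range w) ≤
          (Submodule.span ℂ (Set.range w)).comap (ρ g) := by
        rw [Submodule.span_le]
        rintro _ ⟨p, rfl⟩
        obtain ⟨p', c, h⟩ := hex g p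
        change ρ g (w p) ∈ Submodule.span ℂ (Set.range w)
        rw [hw g p p' c h]
        exact Submodule.smul_mem _ _ (Submodule.subset_span ⟨p', rfl⟩)
      exact hle hx
    · have : Nonempty L := Nat.card_pos_iff.1 (by omega) |>.1
      obtain ⟨p⟩ := this
      intro h
      have hp : w p ∈ Submodule.span ℂ (Set.range w) := Submodule.subset_span ⟨p, rfl⟩
      rw [h, Submodule.mem_bot] at hp
      apply hv0
      have := congrArg (ρ (γ p)⁻¹) hp
      simpa [w, ← Module.End.mul_apply, ← map_mul] using this
  let b : Module.Basis L ℂ V := basisOfTopLeSpanOfCardEqFinrank w hspan.ge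
    (by rw [← Nat.card_eq_fintype_card, hLcard, hdim])
  have hb : ∀ p, b p = w p := fun p => by simp [b]
  have htr : ∀ g, LinearMap.trace ℂ V (ρ g) = ∑ p, b.repr (ρ g (w p)) p := by
    intro g
    rw [LinearMap.trace_eq_matrix_trace ℂ b, Matrix.trace]
    simp [LinearMap.toMatrix_apply, hb]
  have hentry : ∀ (g : SpecialLinearGroup (Fin 2) F) p p' c,
      (g : Matrix (Fin 2) (Fin 2) F) *ᵥ p.rep = ((c : Fˣ) : F) • p'.rep →
      b.repr (ρ g (w p)) p = if p' = p then α c else 0 := by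
    intro g p p' c h
    rw [hw g p p' c h, ← hb, map_smul, Module.Basis.repr_self, Finsupp.smul_apply,
      Finsupp.single_apply]
    split_ifs <;> simp
  refine ⟨α, ?_, ?_, ?_⟩
  · refine smul_left_injective ℂ hv0 ?_
    simp only
    rw [← hα, diagUnit_neg_one, hneg, one_smul]; rfl
  · intro A hA
    rw [htr]
    refine Finset.sum_eq_zero (fun p _ => ?_)
    obtain ⟨p', c, h⟩ := hex A p
    rw [hentry A p p' c h, if_neg]
    rintro rfl
    exact hA _ p'.rep_nonzero _ h
  · intro c hc
    have hx : (![1, 0] : Fin 2 → F) ≠ 0 := fun h => by simpa using congrFun h 0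
    have hy : (![0, 1] : Fin 2 → F) ≠ 0 := fun h => by simpa using congrFun h 1
    have hcomp : ∀ x : Fin 2 → F, ((diagUnit c : SpecialLinearGroup (Fin 2) F) :
        Matrix (Fin 2) (Fin 2) F) *ᵥ x = ![(c : F) * x 0, ((c⁻¹ : Fˣ) : F) * x 1] := by
      intro x
      ext i; fin_cases i <;> simp [diagUnit, Matrix.mulVec, dotProduct, Fin.sum_univ_two]
    let X : L := Projectivization.mk F _ hx
    let Y : L := Projectivization.mk F _ hy
    have hXe : ∀ p : L, p.rep 1 = 0 → p = X := by
      intro p hp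
      rw [← p.mk_rep, Projectivization.mk_eq_mk_iff']
      exact ⟨p.rep 0, by ext i; fin_cases i <;> simp [hp]⟩
    have hYe : ∀ p : L, p.rep 0 = 0 → p = Y := by
      intro p hp
      rw [← p.mk_rep, Projectivization.mk_eq_mk_iff']
      exact ⟨p.rep 1, by ext i; fin_cases i <;> simp [hp]⟩
    have hX : X.rep 1 = 0 := by
      obtain ⟨a, ha⟩ := Projectivization.exists_smul_eq_mk_rep F _ hx
      rw [← ha]; simp
    have hY : Y.rep 0 = 0 := by
      obtain ⟨a, ha⟩ := Projectivization.exists_smul_eq_mk_rep F _ hy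
      rw [← ha]; simp
    have hXY : X ≠ Y := by
      intro h
      apply X.rep_nonzero
      ext i; fin_cases i
      · rw [h]; exact hY
      · exact hX
    rw [htr, Finset.sum_eq_add X Y hXY]
    · rw [hentry _ X X c, hentry _ Y Y c⁻¹, if_pos rfl, if_pos rfl]
      · rw [hcomp]; ext i; fin_cases i <;> simp [hY]
      · rw [hcomp]; ext i; fin_cases i <;> simp [hX]
    · rintro p - ⟨hpX, hpY⟩
      obtain ⟨p', d, h⟩ := hex (diagUnit c) p
      rw [hentry _ p p' d h, if_neg]
      rintro rfl
      rw [hcomp] at h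
      have h0 := congrFun h 0
      have h1 := congrFun h 1
      simp only [Matrix.cons_val_zero, Matrix.cons_val_one, Pi.smul_apply, smul_eq_mul] at h0 h1
      have e0 : (c : F) = d := mul_right_cancel₀ (fun h => hpY (hYe _ h)) h0
      have e1 : ((c⁻¹ : Fˣ) : F) = d := mul_right_cancel₀ (fun h => hpX (hXe _ h)) h1
      apply hc
      rw [pow_two]
      nth_rewrite 2 [Units.ext (e0.trans e1.symm)]
      exact mul_inv_cancel c
    · simp
    · simp

end SpecialLinear

section Multiplicities

variable {G : Type} [Group G] [Finite G] {H : Subgroup G} {θ : H →* ℂˣ} {f : G → ℂ} {n : ℕ}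

theorem restMult_pow_zero : restMult H (θ ^ 0) f = dimFixed H f := by
  simp [restMult, dimFixed]

theorem restMult_pow_one : restMult H (θ ^ 1) f = restMult H θ f := by
  simp [restMult]

theorem restMult_pow_sub (hf : ∀ h ∈ H, f h⁻¹ = f h) (hH : Nat.card H = n) {k : ℕ} (hk : k ≤ n) :
    restMult H (θ ^ (n - k)) f = restMult H (θ ^ k) f := by
  have hθ : θ ^ n = 1 := by
    ext h
    rw [MonoidHom.pow_apply, ← map_pow, ← hH, pow_card_eq_one', map_one]; rfl
  let _ : Fintype H := Fintype.ofFinite H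
  simp only [restMult]
  congr 1
  refine Fintype.sum_equiv (Equiv.inv H) _ _ (fun h => ?_)
  have e : (θ ^ (n - k)) h * (θ ^ k) h = 1 := by
    rw [MonoidHom.pow_apply, MonoidHom.pow_apply, ← pow_add, Nat.sub_add_cancel hk,
      ← MonoidHom.pow_apply, hθ, MonoidHom.one_apply]
  have e' : (θ ^ k) h⁻¹ = (θ ^ (n - k)) h := by
    rw [map_inv, inv_eq_iff_mul_eq_one, mul_comm]
    exact e
  rw [Equiv.inv_apply, Subgroup.coe_inv, hf h h.2, e']

theorem sum_range_restMult_pow (hH : Nat.card H = n) (hθ : Function.Injective θ) :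
    ∑ k ∈ Finset.range n, restMult H (θ ^ k) f = f 1 := by
  have hn : (n : ℂ) ≠ 0 := by rw [← hH]; exact_mod_cast Nat.card_pos.ne'
  let _ : Fintype H := Fintype.ofFinite H
  simp only [restMult, hH]
  rw [← Finset.mul_sum, Finset.sum_comm, inv_mul_eq_iff_eq_mul₀ hn, Fintype.sum_eq_single 1]
  · simp
  · intro h hh
    rw [← Finset.mul_sum]
    have hθh : ((θ h : ℂ))⁻¹ ≠ 1 := by
      rw [ne_eq, inv_eq_one, Units.val_eq_one]
      exact fun e => hh (hθ (e.trans (map_one θ).symm))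
    have hpow : ((θ h : ℂ))⁻¹ ^ n = 1 := by
      rw [inv_pow, ← Units.val_pow_eq_pow_val, ← map_pow, ← hH, pow_card_eq_one', map_one]
      simp
    have : ∑ k ∈ Finset.range n, (((θ ^ k) h : ℂˣ) : ℂ)⁻¹ = 0 := by
      have e : ∀ k, (((θ ^ k) h : ℂˣ) : ℂ)⁻¹ = ((θ h : ℂ))⁻¹ ^ k := fun k => by
        rw [MonoidHom.pow_apply, Units.val_pow_eq_pow_val, inv_pow]
      simp only [e]
      rw [geom_sum_eq hθh, hpow, sub_self, zero_div]
    rw [this, mul_zero]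

theorem card_mul_dimFixed (hH : Nat.card H = n) [Fintype H] :
    (n : ℂ) * dimFixed H f = ∑ h : H, f h := by
  have hn : (n : ℂ) ≠ 0 := by rw [← hH]; exact_mod_cast Nat.card_pos.ne'
  simp only [dimFixed, hH]
  rw [mul_inv_cancel_left₀ hn]
  congr!

theorem card_mul_dimFixed_eq_sum_range (hH : Nat.card H = n) {g : G} (hg : g ∈ H)
    (hord : orderOf g = n) : (n : ℂ) * dimFixed H f = ∑ k ∈ Finset.range n, f (g ^ k) := by
  let _ : Fintype H := Fintype.ofFinite H
  rw [card_mul_dimFixed hH]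
  have hord' : orderOf (⟨g, hg⟩ : H) = n := by rw [← hord, Subgroup.orderOf_mk]
  refine (Finset.sum_bij (fun k _ => (⟨g, hg⟩ : H) ^ k) (fun _ _ => Finset.mem_univ _) ?_ ?_ ?_).symm
  · intro i hi j hj hij
    rw [Finset.mem_range, ← hord'] at hi hj
    exact pow_injOn_Iio_orderOf hi hj hij
  · intro h _
    have hz : h ∈ Subgroup.zpowers (⟨g, hg⟩ : H) := by
      rw [Subgroup.eq_top_of_card_eq (Subgroup.zpowers (⟨g, hg⟩ : H))
        (by rw [Nat.card_zpowers, hord', hH])]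
      trivial
    obtain ⟨k, hk⟩ := mem_powers_iff_mem_zpowers.2 hz
    refine ⟨k % n, Finset.mem_range.2 (Nat.mod_lt _ (hH ▸ Nat.card_pos)), ?_⟩
    rw [← hord', pow_mod_orderOf]
    exact hk
  · intro k _
    rfl

theorem ramMult_eq {H2 H3 H7 : Subgroup G} {θ2 : H2 →* ℂˣ} {θ3 : H3 →* ℂˣ} {θ7 : H7 →* ℂˣ}
    (hH2 : Nat.card H2 = 2) (hH3 : Nat.card H3 = 3) (hH7 : Nat.card H7 = 7)
    (hθ2 : Function.Injective θ2) (hθ3 : Function.Injective θ3) (hθ7 : Function.Injective θ7)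
    (hf3 : ∀ h ∈ H3, f h⁻¹ = f h) (hf7 : ∀ h ∈ H7, f h⁻¹ = f h) :
    ramMult H2 H3 H7 θ2 θ3 θ7 f =
      (f 1 - dimFixed H2 f) / 2 + (f 1 - dimFixed H3 f) / 2 + (f 1 - dimFixed H7 f) / 2 := by
  have s2 := sum_range_restMult_pow (f := f) hH2 hθ2
  have s3 := sum_range_restMult_pow (f := f) hH3 hθ3
  have s7 := sum_range_restMult_pow (f := f) hH7 hθ7
  have r3 := restMult_pow_sub (θ := θ3) hf3 hH3 (k := 1) (by norm_num)
  have r71 := restMult_pow_sub (θ := θ7) hf7 hH7 (k := 1) (by norm_num)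
  have r72 := restMult_pow_sub (θ := θ7) hf7 hH7 (k := 2) (by norm_num)
  have r73 := restMult_pow_sub (θ := θ7) hf7 hH7 (k := 3) (by norm_num)
  simp only [Finset.sum_range_succ, Finset.sum_range_zero, restMult_pow_zero, zero_add] at s2 s3 s7
  simp only [Nat.reduceSub] at r3 r71 r72 r73
  have hIcc : Finset.Icc (1 : ℕ) 6 = {1, 2, 3, 4, 5, 6} := rfl
  simp only [restMult_pow_one] at s2 s3 s7 r3 r71
  rw [ramMult, hIcc]
  simp only [Finset.sum_insert, Finset.mem_insert, Finset.mem_singleton, Finset.sum_singleton,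
    Nat.reduceEqDiff, or_self, not_false_eq_true, OfNat.one_ne_ofNat, restMult_pow_one]
  push_cast
  linear_combination (1 / 2) * s2 + (1 / 2) * s3 + (1 / 2) * s7 + (1 / 6) * r3 +
    (5 / 14) * r71 + (3 / 14) * r72 + (1 / 14) * r73

end Multiplicities

section PrincipalSeries

open Matrix Matrix.SpecialLinearGroup

variable {F : Type} [Field F]

theorem PSL2.exists_lift {g : PSL2 F} {n : ℕ} (hg : g ≠ 1) (hn : g ^ n = 1) :
    ∃ A : SpecialLinearGroup (Fin 2) F,
      (QuotientGroup.mk A : PSL2 F) = g ∧ A ^ (2 * n) = 1 ∧ A ≠ 1 ∧ A ≠ -1 := by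
  obtain ⟨A, rfl⟩ := QuotientGroup.mk_surjective g
  have hc : A ^ n ∈ Subgroup.center (SpecialLinearGroup (Fin 2) F) := by
    rw [← QuotientGroup.eq_one_iff]; exact hn
  have hA : A ∉ Subgroup.center (SpecialLinearGroup (Fin 2) F) := fun h =>
    hg ((QuotientGroup.eq_one_iff A).2 h)
  refine ⟨A, rfl, ?_, ?_, ?_⟩
  · obtain ⟨r, hr, hrA⟩ := mem_center_iff.1 hc
    rw [Fintype.card_fin] at hr
    apply Subtype.ext
    rw [mul_comm, pow_mul, coe_pow, ← hrA, ← map_pow, hr, map_one, coe_one]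
  · rintro rfl
    exact hA (one_mem _)
  · rintro rfl
    refine hA (mem_center_iff.2 ⟨-1, by simp, ?_⟩)
    rw [map_neg, map_one, coe_neg, coe_one]

variable [Fintype F]

theorem PSL2.exists_principal_series_character {χ : PSL2 F → ℂ}
    (hχ : IsIrrCharacter (PSL2 F) χ) (hcard : 5 < Fintype.card F)
    (hdeg : χ 1 = (Fintype.card F : ℂ) + 1) :
    ∃ α : Fˣ →* ℂ, α (-1) = 1 ∧
      (∀ A : SpecialLinearGroup (Fin 2) F, (∀ x : Fin 2 → F, x ≠ 0 → ∀ d : F,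
        (A : Matrix (Fin 2) (Fin 2) F) *ᵥ x ≠ d • x) → χ (QuotientGroup.mk A) = 0) ∧
      ∀ (c : Fˣ) (k : SpecialLinearGroup (Fin 2) F), c ^ 2 ≠ 1 →
        χ (QuotientGroup.mk (k * diagUnit c * k⁻¹)) = α c + α c⁻¹ := by
  obtain ⟨V, hV, rfl⟩ := hχ
  let ρ : Representation ℂ (SpecialLinearGroup (Fin 2) F) V :=
    V.ρ.comp (QuotientGroup.mk' (Subgroup.center (SpecialLinearGroup (Fin 2) F)))
  obtain ⟨α, h1, h2, h3⟩ := Representation.exists_principal_series_trace ρ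
    (fun W hW hne => FDRep.eq_top_of_simple V W (fun g v hv => by
      obtain ⟨A, rfl⟩ := QuotientGroup.mk_surjective g
      exact hW A v hv) hne) hcard
    (by rw [FDRep.char_one] at hdeg; exact_mod_cast hdeg)
    (by
      have : (QuotientGroup.mk' (Subgroup.center (SpecialLinearGroup (Fin 2) F))) (-1) = 1 := by
        refine (QuotientGroup.eq_one_iff _).2 (mem_center_iff.2 ⟨-1, by simp, ?_⟩)
        rw [map_neg, map_one, coe_neg, coe_one]
      simp only [ρ, MonoidHom.comp_apply, this, map_one])
  refine ⟨α, h1, h2, fun c k hc => ?_⟩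
  rw [← h3 c hc]
  exact Representation.char_conj ρ (diagUnit c) k

theorem not_exists_eigenvector_of_not_dvd {A : SpecialLinearGroup (Fin 2) F} {ℓ : ℕ}
    (hℓ : ℓ.Prime) (hℓF : ((2 * ℓ : ℕ) : F) ≠ 0) (hodd : 2 ∣ Fintype.card F - 1)
    (hA : A ^ (2 * ℓ) = 1) (h1 : A ≠ 1) (hm1 : A ≠ -1) (hdvd : ¬ 2 * ℓ ∣ Fintype.card F - 1)
    (x : Fin 2 → F) (hx : x ≠ 0) (d : F) : (A : Matrix (Fin 2) (Fin 2) F) *ᵥ x ≠ d • x := by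
  intro hd
  obtain ⟨c, k, rfl, hc⟩ := exists_eq_conj_diagUnit hℓF hA h1 hm1 hx hd
  rw [conj_pow, diagUnit_pow, conj_eq_one_iff, ← diagUnit_one] at hA
  have hc1 := orderOf_dvd_of_pow_eq_one (diagUnit_injective hA)
  have hc2 : orderOf c ∣ Fintype.card F - 1 := by
    rw [← Fintype.card_units]; exact orderOf_dvd_card
  obtain ⟨m, hm⟩ := hodd
  have hco : Nat.Coprime ℓ m := (Nat.Prime.coprime_iff_not_dvd hℓ).2 fun h =>
    hdvd (hm ▸ mul_dvd_mul_left 2 h)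
  have hgcd : orderOf c ∣ 2 := by
    have := Nat.dvd_gcd hc1 hc2
    rwa [hm, Nat.gcd_mul_left, hco, mul_one] at this
  exact hc (orderOf_dvd_iff_pow_eq_one.1 hgcd)

theorem PSL2.principal_series_restriction {χ : PSL2 F → ℂ}
    (hχ : IsIrrCharacter (PSL2 F) χ) (hcard : 5 < Fintype.card F)
    (hdeg : χ 1 = (Fintype.card F : ℂ) + 1) (hodd : 2 ∣ Fintype.card F - 1)
    {H : Subgroup (PSL2 F)} {ℓ : ℕ} (hℓ : ℓ.Prime) (hℓF : ((2 * ℓ : ℕ) : F) ≠ 0)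
    (hH : Nat.card H = ℓ) :
    (∀ h ∈ H, χ h⁻¹ = χ h) ∧
      (¬ 2 * ℓ ∣ Fintype.card F - 1 → (ℓ : ℂ) * dimFixed H χ = Fintype.card F + 1) ∧
      (2 * ℓ ∣ Fintype.card F - 1 → (ℓ : ℂ) * dimFixed H χ = Fintype.card F - 1 ∨
        (ℓ : ℂ) * dimFixed H χ = Fintype.card F - 1 + 2 * ℓ) := by
  obtain ⟨α, hα1, hns, hs⟩ := PSL2.exists_principal_series_character hχ hcard hdeg
  have hpow : ∀ h ∈ H, h ^ ℓ = 1 := fun h hh => by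
    have := pow_card_eq_one' (x := (⟨h, hh⟩ : H))
    rw [hH] at this
    exact congrArg Subtype.val this
  have hzero : ¬ 2 * ℓ ∣ Fintype.card F - 1 → ∀ h ∈ H, h ≠ 1 → χ h = 0 := by
    intro hdvd h hh hne
    obtain ⟨A, rfl, hA, h1, hm1⟩ := PSL2.exists_lift hne (hpow h hh)
    exact hns A (not_exists_eigenvector_of_not_dvd hℓ hℓF hodd hA h1 hm1 hdvd)
  have hsplit : 2 * ℓ ∣ Fintype.card F - 1 → ∀ h ∈ H, h ≠ 1 →
      ∃ (c : Fˣ) (k : SpecialLinearGroup (Fin 2) F),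
        (QuotientGroup.mk (k * diagUnit c * k⁻¹) : PSL2 F) = h ∧ c ^ (2 * ℓ) = 1 ∧ c ^ 2 ≠ 1 := by
    intro hdvd h hh hne
    obtain ⟨A, rfl, hA, h1, hm1⟩ := PSL2.exists_lift hne (hpow h hh)
    obtain ⟨x, hx, d, hd⟩ := exists_mulVec_eq_smul_of_pow_eq_one hA hdvd
    obtain ⟨c, k, rfl, hc⟩ := exists_eq_conj_diagUnit hℓF hA h1 hm1 hx hd
    rw [conj_pow, diagUnit_pow, conj_eq_one_iff, ← diagUnit_one] at hA
    exact ⟨c, k, rfl, diagUnit_injective hA, hc⟩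
  refine ⟨?_, ?_, ?_⟩
  · intro h hh
    by_cases hne : h = 1
    · rw [hne, inv_one]
    by_cases hdvd : 2 * ℓ ∣ Fintype.card F - 1
    · obtain ⟨c, k, rfl, -, hc⟩ := hsplit hdvd h hh hne
      have e : (QuotientGroup.mk (k * diagUnit c * k⁻¹) : PSL2 F)⁻¹ =
          QuotientGroup.mk (k * diagUnit c⁻¹ * k⁻¹) := by
        rw [← QuotientGroup.mk_inv, conj_inv, diagUnit_inv]
      rw [e, hs c k hc, hs c⁻¹ k (by rwa [inv_pow, ne_eq, inv_eq_one]), inv_inv, add_comm]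
    · rw [hzero hdvd h hh hne, hzero hdvd _ (inv_mem hh) (inv_ne_one.2 hne)]
  · intro hdvd
    let _ : Fintype H := Fintype.ofFinite H
    rw [card_mul_dimFixed hH, Fintype.sum_eq_single 1]
    · exact hdeg
    · intro h hh
      exact hzero hdvd h h.2 (fun e => hh (Subtype.ext e))
  · intro hdvd
    have hH1 : 1 < Nat.card H := hH ▸ hℓ.one_lt
    obtain ⟨⟨g, hgH⟩, hg⟩ := @exists_ne _ (Finite.one_lt_card_iff_nontrivial.1 hH1) (1 : H)
    have hg1 : g ≠ 1 := fun e => hg (Subtype.ext e)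
    have : Fact ℓ.Prime := ⟨hℓ⟩
    have hord : orderOf g = ℓ := orderOf_eq_prime (hpow g hgH) hg1
    rw [card_mul_dimFixed_eq_sum_range hH hgH hord]
    obtain ⟨c, k, rfl, hcℓ, hc⟩ := hsplit hdvd g hgH hg1
    set z := α c with hz
    have hc2 : orderOf (c ^ 2) = ℓ := orderOf_eq_prime (by rw [← pow_mul, hcℓ]) hc
    have hzℓ : z ^ ℓ = 1 := by
      have : ((c ^ ℓ : Fˣ) : F) * ((c ^ ℓ : Fˣ) : F) = 1 := by
        rw [← Units.val_mul, ← pow_add, ← two_mul, hcℓ, Units.val_one]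
      rw [hz, ← map_pow]
      rcases mul_self_eq_one_iff.1 this with h | h
      · rw [show c ^ ℓ = 1 from Units.ext h, map_one]
      · rw [show c ^ ℓ = -1 from Units.ext (h.trans (by simp)), hα1]
    have hz0 : z ≠ 0 := fun h => by simp [h, hℓ.ne_zero] at hzℓ
    have hzinv : α c⁻¹ = z⁻¹ := eq_inv_of_mul_eq_one_left (by
      rw [hz, ← map_mul, inv_mul_cancel, map_one])
    have hterm : ∀ j ∈ Finset.range ℓ,
        χ ((QuotientGroup.mk (k * diagUnit c * k⁻¹) : PSL2 F) ^ j) =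
          z ^ j + z⁻¹ ^ j + if j = 0 then (Fintype.card F : ℂ) - 1 else 0 := by
      intro j hj
      by_cases hj0 : j = 0
      · subst hj0
        simp only [pow_zero, hdeg, if_true]
        ring
      · rw [if_neg hj0, add_zero, ← QuotientGroup.mk_pow, conj_pow, diagUnit_pow, hs, map_pow,
          ← inv_pow, map_pow, hzinv]
        intro h
        rw [← pow_mul, mul_comm, pow_mul] at h
        have := orderOf_dvd_of_pow_eq_one h
        rw [hc2] at this
        exact hj0 (Nat.eq_zero_of_dvd_of_lt this (Finset.mem_range.1 hj))
    rw [Finset.sum_congr rfl hterm, Finset.sum_add_distrib, Finset.sum_add_distrib,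
      Finset.sum_ite_eq' , if_pos (Finset.mem_range.2 hℓ.pos)]
    by_cases hz1 : z = 1
    · right
      simp only [hz1, inv_one, one_pow, Finset.sum_const, Finset.card_range, nsmul_eq_mul]
      ring
    · left
      rw [geom_sum_eq hz1, geom_sum_eq (by rwa [ne_eq, inv_eq_one]), inv_pow, hzℓ]
      simp

end PrincipalSeries

section Arithmetic

variable {q : ℕ}

theorem sub_eq_two_mul_two_mul_ediv_four (hq : q % 2 = 1) :
    (q : ℤ) - (if q % 4 = 1 then 1 else -1) =
      (2 : ℕ) * (2 * (((q : ℤ) - (if q % 4 = 1 then 1 else -1)) / 4)) := by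
  split_ifs <;> push_cast <;> omega

theorem sub_eq_three_mul_ediv (hq : ¬ 3 ∣ q) :
    (q : ℤ) - (if q % 3 = 1 then 1 else -1) =
      (3 : ℕ) * (((q : ℤ) - (if q % 3 = 1 then 1 else -1)) / 3) := by
  split_ifs <;> push_cast <;> omega

theorem sub_eq_seven_mul_ediv (hq : q % 7 = 1 ∨ q % 7 = 6) :
    (q : ℤ) - (if q % 7 = 1 then 1 else -1) =
      (7 : ℕ) * (((q : ℤ) - (if q % 7 = 1 then 1 else -1)) / 7) := by
  split_ifs <;> push_cast <;> omega

end Arithmetic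

theorem ramification_module_principal_series
    (q : ℕ) (hq : IsPrimePow q) (hgcd : Nat.Coprime q 42)
    (hq7 : q % 7 = 1 ∨ q % 7 = 6)
    (F : Type) [Field F] [Fintype F] (hF : Fintype.card F = q)
    (H2 H3 H7 : Subgroup (PSL2 F))
    (hH2 : Nat.card H2 = 2) (hH3 : Nat.card H3 = 3) (hH7 : Nat.card H7 = 7)
    (θ2 : H2 →* ℂˣ) (θ3 : H3 →* ℂˣ) (θ7 : H7 →* ℂˣ)
    (hθ2 : Function.Injective θ2) (hθ3 : Function.Injective θ3)
    (hθ7 : Function.Injective θ7)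
    (χ : PSL2 F → ℂ) (hχ : IsIrrCharacter (PSL2 F) χ) (hdeg : χ 1 = (q : ℂ) + 1)
    :
    ramMult H2 H3 H7 θ2 θ3 θ7 χ = (baseMult q : ℂ) +
      ((if (2 : ℂ) * dimFixed H2 χ = (q : ℂ) - 1 then 1 else 0)
        + (if (3 : ℂ) * dimFixed H3 χ = (q : ℂ) - 1 then 1 else 0)
        + (if (7 : ℂ) * dimFixed H7 χ = (q : ℂ) - 1 then 1 else 0)) := by
  have hco2 : q % 2 = 1 := by
    have : Nat.Coprime q 2 := hgcd.coprime_dvd_right (by norm_num)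
    exact Nat.odd_iff.1 (Nat.coprime_two_right.1 this)
  have hco3 : ¬ 3 ∣ q := by
    have : Nat.Coprime 3 q := (hgcd.coprime_dvd_right (by norm_num)).symm
    exact (Nat.Prime.coprime_iff_not_dvd (by norm_num)).1 this
  have hcard : 5 < Fintype.card F := by
    have := hq.one_lt
    rw [hF]
    omega
  have hunit : ((42 : ℕ) : F) ≠ 0 := by
    intro h
    have hp := CharP.cast_eq_zero_iff F (ringChar F) 42 |>.1 h
    have hq0 := CharP.cast_eq_zero_iff F (ringChar F) _ |>.1 (FiniteField.cast_card_eq_zero F)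
    have := Nat.dvd_gcd (hF ▸ hq0) hp
    rw [hgcd, Nat.dvd_one] at this
    exact CharP.ringChar_ne_one this
  have hF0 : ∀ n : ℕ, n ∣ 42 → (n : F) ≠ 0 := by
    rintro n ⟨m, hm⟩ h
    exact hunit (by rw [hm, Nat.cast_mul, h, zero_mul])
  have hF4 : ((2 * 2 : ℕ) : F) ≠ 0 := by
    rw [Nat.cast_mul]
    exact mul_ne_zero (hF0 2 (by norm_num)) (hF0 2 (by norm_num))
  have hodd : 2 ∣ Fintype.card F - 1 := by omega
  have hdeg' : χ 1 = (Fintype.card F : ℂ) + 1 := by rw [hF, hdeg]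
  obtain ⟨-, n2, s2⟩ := PSL2.principal_series_restriction hχ hcard hdeg' hodd Nat.prime_two hF4 hH2
  obtain ⟨i3, n3, s3⟩ := PSL2.principal_series_restriction hχ hcard hdeg' hodd Nat.prime_three
    (hF0 _ (by norm_num)) hH3
  obtain ⟨i7, n7, s7⟩ := PSL2.principal_series_restriction hχ hcard hdeg' hodd
    (by norm_num : Nat.Prime 7) (hF0 _ (by norm_num)) hH7
  rw [hF] at n2 s2 n3 s3 n7 s7
  have hterm : ∀ (ℓ : ℕ) (r : ℤ) (d : ℂ) (P : Prop) [Decidable P], ℓ ≠ 0 →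
      (q : ℤ) - (if P then 1 else -1) = ℓ * r →
      (¬ P → (ℓ : ℂ) * d = q + 1) →
      (P → (ℓ : ℂ) * d = q - 1 ∨ (ℓ : ℂ) * d = q - 1 + 2 * ℓ) →
      ((q : ℂ) + 1 - d) / 2 = (ℓ - 1) * r / 2 + if (ℓ : ℂ) * d = (q : ℂ) - 1 then 1 else 0 := by
    intro ℓ r d P _ hℓ hr hn hs
    have hℓ' : (ℓ : ℂ) ≠ 0 := Nat.cast_ne_zero.2 hℓ
    apply mul_left_cancel₀ hℓ'
    by_cases hP : P
    · rw [if_pos hP] at hr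
      have hr' : (q : ℂ) - 1 = ℓ * r := by exact_mod_cast hr
      rcases hs hP with h | h
      · rw [if_pos h]
        linear_combination -h / 2 + (ℓ - 1) / 2 * hr'
      · rw [if_neg (by rw [h]; simpa using hℓ)]
        linear_combination -h / 2 + (ℓ - 1) / 2 * hr'
    · rw [if_neg hP, sub_neg_eq_add] at hr
      have hr' : (q : ℂ) + 1 = ℓ * r := by exact_mod_cast hr
      have h := hn hP
      rw [if_neg (by rw [h, ← sub_eq_zero]; ring_nf; norm_num)]
      linear_combination -h / 2 + (ℓ - 1) / 2 * hr'
  rw [ramMult_eq hH2 hH3 hH7 hθ2 hθ3 hθ7 i3 i7, hdeg, baseMult]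
  have t2 := hterm 2 _ (dimFixed H2 χ) (q % 4 = 1) two_ne_zero
    (sub_eq_two_mul_two_mul_ediv_four hco2) (fun h => n2 (by omega))
    (fun h => s2 (by omega))
  have t3 := hterm 3 _ (dimFixed H3 χ) (q % 3 = 1) three_ne_zero
    (sub_eq_three_mul_ediv hco3) (fun h => n3 (by omega))
    (fun h => s3 (by omega))
  have t7 := hterm 7 _ (dimFixed H7 χ) (q % 7 = 1) (by norm_num)
    (sub_eq_seven_mul_ediv hq7) (fun h => n7 (by omega))
    (fun h => s7 (by omega))
  rw [t2, t3, t7]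
  simp only [Int.cast_add, Int.cast_mul, Nat.cast_ofNat, Int.cast_ofNat]
  ring
end

section
/- If χ is an irreducible complex character of G with χ(1) = q−1 (a discrete series character), then Γ(χ) = m − N, where N := #{ℓ ∈ {2,3,7} : ℓ · dim χ^{H_ℓ} = q+1}. -/
open scoped BigOperators Classical

theorem exists_nat_sum_character_mul_inv {H V : Type*} [Group H] [Fintype H] [AddCommGroup V]
    [Module ℂ V] [FiniteDimensional ℂ V] (ρ : Representation ℂ H V) (θ : H →* ℂˣ) :
    ∃ n : ℕ, ∑ h, ρ.character h * ((θ h : ℂ))⁻¹ = Nat.card H * n := by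
  let σ : Representation ℂ H V :=
    { toFun := fun h => ((θ h : ℂ))⁻¹ • ρ h
      map_one' := by simp
      map_mul' := fun a b => by
        ext v
        simp [smul_smul, mul_comm] }
  have hc : (Nat.card H : ℂ) ≠ 0 := Nat.cast_ne_zero.2 Nat.card_pos.ne'
  have : Invertible (Nat.card H : ℂ) := invertibleOfNonzero hc
  refine ⟨Module.finrank ℂ σ.invariants, ?_⟩
  rw [← σ.card_inv_mul_sum_char_eq_finrank, mul_inv_cancel_left₀ hc]
  refine Finset.sum_congr rfl fun h _ => ?_
  simp [Representation.character, σ, mul_comm]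

theorem exists_nat_sum_character {H V : Type*} [Group H] [Fintype H] [AddCommGroup V]
    [Module ℂ V] [FiniteDimensional ℂ V] (ρ : Representation ℂ H V) :
    ∃ n : ℕ, ∑ h, ρ.character h = Nat.card H * n := by
  simpa using exists_nat_sum_character_mul_inv ρ 1

theorem sum_eq_zero_of_sum_character_eq_zero {H V : Type*} [Group H] [Fintype H] [AddCommGroup V]
    [Module ℂ V] [FiniteDimensional ℂ V] (ρ : Representation ℂ H V)
    (h0 : ∑ h, ρ.character h = 0) : ∑ h, ρ h = 0 := by
  have hc : (Nat.card H : ℂ) ≠ 0 := Nat.cast_ne_zero.2 Nat.card_pos.ne'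
  have : Invertible (Nat.card H : ℂ) := invertibleOfNonzero hc
  have h1 := ρ.card_inv_mul_sum_char_eq_finrank
  rw [h0, mul_zero, eq_comm, Nat.cast_eq_zero, Submodule.finrank_eq_zero] at h1
  ext v
  have : (∑ h, ρ h) v ∈ ρ.invariants := by
    intro g
    simp only [LinearMap.sum_apply, map_sum, ← Module.End.mul_apply, ← map_mul]
    exact Fintype.sum_equiv (Equiv.mulLeft g) _ _ fun _ => rfl
  rw [h1] at this
  simpa using this

/-- A representation of a finite abelian group decomposes, on the level of characters, as a sum of
linear characters with natural multiplicities. -/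
theorem exists_multiplicity {A V : Type*} [AddCommGroup A] [Fintype A] [AddCommGroup V]
    [Module ℂ V] [FiniteDimensional ℂ V] (ρ : Representation ℂ (Multiplicative A) V) :
    ∃ m : AddChar A ℂ → ℕ,
      (∀ ψ, ∑ a, ρ.character (Multiplicative.ofAdd a) * ψ (-a) = Fintype.card A * m ψ) ∧
      ∀ a, ρ.character (Multiplicative.ofAdd a) = ∑ ψ, (m ψ : ℂ) * ψ a := by
  have key : ∀ ψ : AddChar A ℂ, ∃ n : ℕ,
      ∑ a, ρ.character (Multiplicative.ofAdd a) * ψ (-a) = Fintype.card A * n := by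
    intro ψ
    obtain ⟨n, hn⟩ := exists_nat_sum_character_mul_inv ρ ψ.toMonoidHom.toHomUnits
    refine ⟨n, ?_⟩
    rw [Nat.card_eq_fintype_card, Fintype.card_multiplicative] at hn
    rw [← hn]
    refine Fintype.sum_equiv Multiplicative.ofAdd _ _ fun a => ?_
    rw [AddChar.map_neg_eq_inv]
    rfl
  choose m hm using key
  refine ⟨m, hm, fun a => ?_⟩
  have hc : (Fintype.card A : ℂ) ≠ 0 := Nat.cast_ne_zero.2 Fintype.card_ne_zero
  apply mul_left_cancel₀ hc
  rw [Finset.mul_sum]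
  simp_rw [← mul_assoc, ← hm, Finset.sum_mul, mul_assoc, ← AddChar.map_add_eq_mul]
  rw [Finset.sum_comm]
  simp_rw [← Finset.mul_sum, AddChar.sum_apply_eq_ite]
  simp only [neg_add_eq_zero, mul_ite, mul_zero]
  rw [Finset.sum_ite_eq' Finset.univ a]
  simp [mul_comm]

theorem sum_normSq_eq {A : Type*} [AddCommGroup A] [Fintype A] (m : AddChar A ℂ → ℕ)
    (f : A → ℂ) (hf : ∀ a, f a = ∑ ψ, (m ψ : ℂ) * ψ a) :
    ∑ a, ‖f a‖ ^ 2 = Fintype.card A * ∑ ψ, (m ψ : ℝ) ^ 2 := by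
  have h : ∑ a, f a * (starRingEnd ℂ) (f a) = Fintype.card A * ∑ ψ, (m ψ : ℂ) ^ 2 := by
    simp_rw [hf, map_sum, Finset.sum_mul_sum, map_mul, ← AddChar.map_neg_eq_conj, map_natCast]
    rw [Finset.sum_comm, Finset.mul_sum]
    refine Finset.sum_congr rfl fun ψ _ => ?_
    rw [Finset.sum_comm]
    have : ∀ φ : AddChar A ℂ, ∑ a, (m ψ : ℂ) * ψ a * (m φ * φ (-a)) =
        if ψ = φ then Fintype.card A * (m ψ : ℂ) ^ 2 else 0 := by
      intro φ
      have h1 : ∀ a, (m ψ : ℂ) * ψ a * (m φ * φ (-a)) = m ψ * m φ * (ψ - φ) a := by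
        intro a
        rw [AddChar.sub_apply']
        rw [AddChar.map_neg_eq_inv]; ring
      simp_rw [h1, ← Finset.mul_sum, AddChar.sum_eq_ite, sub_eq_zero]
      split_ifs with h
      · subst h; ring
      · simp
    simp_rw [this]
    simp
  have h2 : ((∑ a, ‖f a‖ ^ 2 : ℝ) : ℂ) = ((Fintype.card A * ∑ ψ, (m ψ : ℝ) ^ 2 : ℝ) : ℂ) := by
    push_cast
    rw [← h]
    exact Finset.sum_congr rfl fun a _ => (Complex.mul_conj' _).symm
  exact_mod_cast h2

theorem exists_multiplicity_additive {A V : Type*} [CommGroup A] [Fintype A] [AddCommGroup V]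
    [Module ℂ V] [FiniteDimensional ℂ V] (ρ : Representation ℂ A V) :
    ∃ m : AddChar (Additive A) ℂ → ℕ,
      (∀ ψ, ∑ a : A, ρ.character a * ψ (.ofMul a⁻¹) = Fintype.card A * m ψ) ∧
      ∀ a, ρ.character a = ∑ ψ, (m ψ : ℂ) * ψ (.ofMul a) := by
  let σ : Representation ℂ (Multiplicative (Additive A)) V :=
    ρ.comp (MulEquiv.multiplicativeAdditive A).toMonoidHom
  obtain ⟨m, hm, hm'⟩ := exists_multiplicity σ
  refine ⟨m, fun ψ => ?_, fun a => hm' (.ofMul a)⟩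
  rw [← Fintype.card_additive, ← hm ψ]
  exact Fintype.sum_equiv Additive.ofMul _ _ fun a => rfl

open scoped IsMulCommutative in
theorem character_inv_eq_conj {G V : Type*} [Group G] [Finite G] [AddCommGroup V]
    [Module ℂ V] [FiniteDimensional ℂ V] (ρ : Representation ℂ G V) (g : G) :
    ρ.character g⁻¹ = (starRingEnd ℂ) (ρ.character g) := by
  have : Fintype (Subgroup.zpowers g) := Fintype.ofFinite _
  let a : Subgroup.zpowers g := ⟨g, Subgroup.mem_zpowers g⟩
  obtain ⟨m, -, hm⟩ := exists_multiplicity_additive (A := Subgroup.zpowers g)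
    (ρ.comp (Subgroup.zpowers g).subtype)
  have h1 : ρ.character g = _ := hm a
  have h2 : ρ.character g⁻¹ = _ := hm a⁻¹
  rw [h1, h2]
  simp [map_sum, AddChar.map_neg_eq_conj]

open scoped IsMulCommutative in
/-- A real-valued character of a group of odd order has as many trivial constituents as its degree,
modulo two. -/
theorem exists_sum_character_eq_of_odd {H V : Type*} [Group H] [IsMulCommutative H] [Fintype H]
    [AddCommGroup V] [Module ℂ V] [FiniteDimensional ℂ V] (ρ : Representation ℂ H V)
    (hodd : Odd (Nat.card H)) (hinv : ∀ h, ρ.character h⁻¹ = ρ.character h) :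
    ∃ e k : ℕ, ∑ h, ρ.character h = Nat.card H * e ∧ Module.finrank ℂ V = e + 2 * k := by
  obtain ⟨m, hm, hm'⟩ := exists_multiplicity_additive ρ
  have hc : (Fintype.card H : ℂ) ≠ 0 := Nat.cast_ne_zero.2 Fintype.card_ne_zero
  have hneg : ∀ ψ, m (-ψ) = m ψ := by
    intro ψ
    have : (Fintype.card H : ℂ) * m (-ψ) = Fintype.card H * m ψ := by
      rw [← hm, ← hm]
      refine Fintype.sum_equiv (Equiv.inv H) _ _ fun h => ?_
      simp [hinv, AddChar.neg_apply]
    exact_mod_cast mul_left_cancel₀ hc this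
  have hfix : ∀ ψ : AddChar (Additive H) ℂ, -ψ = ψ → ψ = 0 := by
    intro ψ h
    have h2 : (2 : ℕ) • ψ = 0 := by rw [two_nsmul]; nth_rewrite 1 [← h]; simp
    have h3 : Fintype.card (AddChar (Additive H) ℂ) • ψ = 0 := card_nsmul_eq_zero
    rw [AddChar.card_eq, Fintype.card_additive, ← Nat.card_eq_fintype_card] at h3
    have h4 := Nat.dvd_gcd (addOrderOf_dvd_of_nsmul_eq_zero h2) (addOrderOf_dvd_of_nsmul_eq_zero h3)
    rw [Nat.Coprime.gcd_eq_one (Nat.coprime_two_left.2 hodd), Nat.dvd_one,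
      AddMonoid.addOrderOf_eq_one_iff] at h4
    exact h4
  have hsum : (Module.finrank ℂ V : ℂ) = ∑ ψ, (m ψ : ℂ) := by
    rw [← ρ.char_one, hm' 1]
    simp
  have hsum' : Module.finrank ℂ V = ∑ ψ, m ψ := by exact_mod_cast hsum
  have hz : ∑ ψ ∈ Finset.univ.erase (0 : AddChar (Additive H) ℂ), (m ψ : ZMod 2) = 0 := by
    refine Finset.sum_involution (fun ψ _ => -ψ) ?_ ?_ ?_ ?_
    · intro ψ _
      rw [hneg]
      exact CharTwo.add_self_eq_zero _
    · intro ψ hψ _ h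
      exact (Finset.mem_erase.1 hψ).1 (hfix ψ h)
    · intro ψ hψ
      simpa using hψ
    · simp
  have h2 : 2 ∣ ∑ ψ ∈ Finset.univ.erase (0 : AddChar (Additive H) ℂ), m ψ := by
    rw [← ZMod.natCast_eq_zero_iff]
    exact_mod_cast hz
  obtain ⟨k, hk⟩ := h2
  refine ⟨m 0, k, ?_, ?_⟩
  · have := hm 0
    rw [Nat.card_eq_fintype_card, ← this]
    simp
  · rw [hsum', ← hk, Finset.add_sum_erase _ _ (Finset.mem_univ _)]

/-- If an involution acts with determinant one, its `-1`-eigenspace has even dimension. -/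
theorem exists_trace_eq_of_sq_eq_one {V : Type*} [AddCommGroup V] [Module ℂ V]
    [FiniteDimensional ℂ V] (f : V →ₗ[ℂ] V) (hf : f * f = 1) (hdet : LinearMap.det f = 1) :
    ∃ k : ℕ, LinearMap.trace ℂ V f + 4 * k = Module.finrank ℂ V := by
  have hs : f.charpoly.Splits := IsAlgClosed.splits _
  have hroots : ∀ μ ∈ f.charpoly.roots, μ = 1 ∨ μ = -1 := by
    intro μ hμ
    have h1 := (Polynomial.mem_roots'.1 hμ).2
    rw [← Module.End.hasEigenvalue_iff_isRoot_charpoly] at h1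
    obtain ⟨v, hv⟩ := h1.exists_hasEigenvector
    have h2 : f v = μ • v := hv.apply_eq_smul
    have h3 : (f * f) v = v := by rw [hf]; rfl
    rw [Module.End.mul_apply, h2, map_smul, h2, smul_smul] at h3
    have h4 : (μ * μ - 1) • v = 0 := by rw [sub_smul, h3, one_smul, sub_self]
    have h5 := (smul_eq_zero.1 h4).resolve_right hv.2
    exact mul_self_eq_one_iff.1 (sub_eq_zero.1 h5)
  have key : ∀ s : Multiset ℂ, (∀ μ ∈ s, μ = 1 ∨ μ = -1) →
      ∃ k : ℕ, s.sum + 2 * k = s.card ∧ s.prod = (-1) ^ k := by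
    intro s
    induction s using Multiset.induction with
    | empty => intro _; exact ⟨0, by simp⟩
    | cons a s ih =>
      intro h
      obtain ⟨k, h1, h2⟩ := ih fun μ hμ => h μ (Multiset.mem_cons_of_mem hμ)
      rcases h a (Multiset.mem_cons_self a s) with rfl | rfl
      · refine ⟨k, ?_, by simp [h2]⟩
        simp only [Multiset.sum_cons, Multiset.card_cons, Nat.cast_add, Nat.cast_one, ← h1]
        ring
      · refine ⟨k + 1, ?_, by simp [h2, pow_succ]⟩
        simp only [Multiset.sum_cons, Multiset.card_cons, Nat.cast_add, Nat.cast_one, ← h1]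
        ring
  obtain ⟨k, h1, h2⟩ := key _ hroots
  rw [← Module.End.det_eq_prod_roots_charpoly_of_splits hs, hdet] at h2
  rw [← Module.End.trace_eq_sum_roots_charpoly_of_splits hs, ← hs.natDegree_eq_card_roots,
    LinearMap.charpoly_natDegree] at h1
  have hk : Even k := by
    by_contra hk
    rw [(Nat.not_even_iff_odd.1 hk).neg_one_pow] at h2
    norm_num at h2
  obtain ⟨r, rfl⟩ := hk
  refine ⟨r, ?_⟩
  rw [← h1]
  push_cast
  ring

open scoped IsMulCommutative in
/-- A character of degree `2n - 2` and small norm on an abelian group of order `n` is twice the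
regular character minus two linear characters. -/
theorem exists_sum_restrict_of_normSq_le {A V : Type*} [Group A] [IsMulCommutative A] [Fintype A]
    [AddCommGroup V] [Module ℂ V] [FiniteDimensional ℂ V] (ρ : Representation ℂ A V)
    (hdim : Module.finrank ℂ V + 2 = 2 * Fintype.card A)
    (hnorm : ∑ a, ‖ρ.character a‖ ^ 2 ≤ (Fintype.card A : ℝ) * (4 * Fintype.card A - 6))
    (H : Subgroup A) :
    ∃ j : ℕ, j ≤ 2 ∧ ∑ h : H, ρ.character h + Nat.card H * j = 2 * Fintype.card A := by
  obtain ⟨m, -, hm⟩ := exists_multiplicity_additive ρ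
  have hnpos : (0 : ℝ) < Fintype.card A := Nat.cast_pos.2 Fintype.card_pos
  have hcard : Fintype.card (AddChar (Additive A) ℂ) = Fintype.card A := by
    rw [AddChar.card_eq, Fintype.card_additive]
  have hsum : (Module.finrank ℂ V : ℂ) = ∑ ψ, (m ψ : ℂ) := by
    rw [← ρ.char_one, hm 1]
    simp
  have hsum' : (Module.finrank ℂ V : ℤ) = ∑ ψ, (m ψ : ℤ) := by exact_mod_cast hsum
  have hsq := sum_normSq_eq m (fun a : Additive A => ρ.character a.toMul) fun a => hm a.toMul
  rw [Fintype.card_additive] at hsq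
  have hsq' : ∑ ψ, (m ψ : ℝ) ^ 2 ≤ 4 * Fintype.card A - 6 := by
    refine le_of_mul_le_mul_left (hsq ▸ le_of_eq_of_le ?_ hnorm) hnpos
    exact Fintype.sum_equiv Additive.toMul _ _ fun a => rfl
  have hsqZ : ∑ ψ, (m ψ : ℤ) ^ 2 ≤ 4 * Fintype.card A - 6 := by exact_mod_cast hsq'
  have hnn : ∀ ψ, (0 : ℤ) ≤ (2 - m ψ) * (1 - m ψ) := by
    intro ψ
    rcases Nat.lt_or_ge (m ψ) 2 with h | h
    · interval_cases m ψ <;> norm_num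
    · have : (2 : ℤ) ≤ m ψ := by exact_mod_cast h
      nlinarith
  have hle : ∑ ψ, ((2 : ℤ) - m ψ) * (1 - m ψ) ≤ 0 := by
    have : ∑ ψ, ((2 : ℤ) - m ψ) * (1 - m ψ) =
        2 * Fintype.card A - 3 * ∑ ψ, (m ψ : ℤ) + ∑ ψ, (m ψ : ℤ) ^ 2 := by
      rw [← hcard, Finset.mul_sum, ← Finset.card_univ, Finset.cast_card, Finset.mul_sum,
        ← Finset.sum_sub_distrib, ← Finset.sum_add_distrib]
      exact Finset.sum_congr rfl fun ψ _ => by ring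
    rw [this, ← hsum']
    have : (Module.finrank ℂ V : ℤ) + 2 = 2 * Fintype.card A := by exact_mod_cast hdim
    linarith
  have hzero : ∀ ψ, ((2 : ℤ) - m ψ) * (1 - m ψ) = 0 := fun ψ =>
    (Finset.sum_eq_zero_iff_of_nonneg fun ψ _ => hnn ψ).1
      (le_antisymm hle (Finset.sum_nonneg fun ψ _ => hnn ψ)) ψ (Finset.mem_univ ψ)
  have hm2 : ∀ ψ, m ψ ≤ 2 := by
    intro ψ
    rcases mul_eq_zero.1 (hzero ψ) with h | h <;> omega
  have hd : ∑ ψ, (2 - m ψ) = 2 := by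
    have : ∑ ψ, (2 - m ψ) + ∑ ψ, m ψ = 2 * Fintype.card A := by
      rw [← Finset.sum_add_distrib, Finset.sum_congr rfl fun ψ _ => Nat.sub_add_cancel (hm2 ψ)]
      simp [hcard, mul_comm]
    have h2 : Module.finrank ℂ V = ∑ ψ, m ψ := by exact_mod_cast hsum
    omega
  let S : Finset (AddChar (Additive A) ℂ) :=
    Finset.univ.filter fun ψ => ∀ h : H, ψ (.ofMul (h : A)) = 1
  refine ⟨∑ ψ ∈ S, (2 - m ψ), ?_, ?_⟩
  · exact (Finset.sum_le_sum_of_subset (Finset.subset_univ S)).trans hd.le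
  have horth : ∀ ψ : AddChar (Additive A) ℂ,
      ∑ h : H, ψ (.ofMul (h : A)) = if ψ ∈ S then (Nat.card H : ℂ) else 0 := by
    intro ψ
    let φ : AddChar (Additive H) ℂ := ψ.compAddMonoidHom H.subtype.toAdditive
    have h1 : ∑ h : H, ψ (.ofMul (h : A)) = ∑ h : Additive H, φ h :=
      Fintype.sum_equiv Additive.ofMul _ _ fun h => rfl
    rw [h1, AddChar.sum_eq_ite, Nat.card_eq_fintype_card, Fintype.card_additive]
    refine if_congr ?_ rfl rfl
    simp only [S, Finset.mem_filter, Finset.mem_univ, true_and]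
    constructor
    · intro h0 h
      have : φ (.ofMul h) = 1 := by rw [h0]; simp
      exact this
    · intro h0
      ext h
      exact h0 h.toMul
  have hreg : ∑ h : H, ∑ ψ : AddChar (Additive A) ℂ, ψ (.ofMul (h : A)) = Fintype.card A := by
    simp_rw [AddChar.sum_apply_eq_ite, Fintype.card_additive]
    rw [Finset.sum_eq_single 1]
    · simp
    · intro h _ h1
      simpa using h1
    · simp
  have e1 : ∑ h : H, ρ.character h = ∑ ψ ∈ S, (Nat.card H : ℂ) * m ψ := by
    simp_rw [hm]
    rw [Finset.sum_comm]
    simp_rw [← Finset.mul_sum, horth, mul_ite, mul_zero]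
    rw [← Finset.sum_filter]
    simp [Finset.mul_sum, mul_comm]
  have e2 : ∑ ψ ∈ S, (Nat.card H : ℂ) = Fintype.card A := by
    rw [← hreg, Finset.sum_comm]
    simp_rw [horth]
    rw [← Finset.sum_filter]
    simp
  rw [e1, ← e2, Nat.cast_sum, Finset.mul_sum, Finset.mul_sum, ← Finset.sum_add_distrib]
  refine Finset.sum_congr rfl fun ψ _ => ?_
  rw [Nat.cast_sub (hm2 ψ)]
  push_cast
  ring

theorem sum_of_mul_sq_invariant {F : Type*} [Field F] [Fintype F] (hF : ringChar F ≠ 2)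
    (n : F) (hn : ¬IsSquare n) (g : F → ℤ) (hg : ∀ a y, a ≠ 0 → g (a ^ 2 * y) = g y) :
    2 * ∑ y, g y = 2 * g 0 + (Fintype.card F - 1) * (g 1 + g n) := by
  have hn0 : n ≠ 0 := by
    rintro rfl
    exact hn IsSquare.zero
  have key : ∀ y, 2 * g y = (if y = 0 then 2 * g 0 - g 1 - g n else 0) + (g 1 + g n) +
      (g 1 - g n) * quadraticChar F y := by
    intro y
    by_cases hy : y = 0
    · subst hy
      simp
    · rw [if_neg hy]
      by_cases hs : IsSquare y
      · rw [(quadraticChar_one_iff_isSquare hy).2 hs]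
        obtain ⟨a, rfl⟩ := hs
        have ha : a ≠ 0 := by
          rintro rfl
          simp at hy
        have := hg a 1 ha
        rw [mul_one, sq] at this
        rw [this]
        ring
      · have h1 : quadraticChar F (y * n⁻¹) = 1 := by
          rw [map_mul, quadraticChar_neg_one_iff_not_isSquare.2 hs,
            quadraticChar_neg_one_iff_not_isSquare.2 (by rwa [isSquare_inv])]
          norm_num
        rw [quadraticChar_neg_one_iff_not_isSquare.2 hs]
        obtain ⟨a, ha⟩ := (quadraticChar_one_iff_isSquare (mul_ne_zero hy (inv_ne_zero hn0))).1 h1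
        have ha0 : a ≠ 0 := by
          rintro rfl
          simp [hy, hn0] at ha
        have hy' : y = a ^ 2 * n := by
          rw [sq, ← ha, inv_mul_cancel_right₀ hn0]
        rw [hy', hg a n ha0]
        ring
  rw [Finset.mul_sum, Finset.sum_congr rfl fun y _ => key y, Finset.sum_add_distrib,
    Finset.sum_add_distrib, ← Finset.mul_sum, quadraticChar_sum_zero hF]
  simp
  ring

theorem multiplicities_of_quadratic_bound (a b c r M : ℕ) (hr : 6 ≤ r)
    (h1 : a + r * (b + c) = 2 * r) (h2 : M = a ^ 2 + r * (b ^ 2 + c ^ 2))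
    (h3 : (r + 1) * M ≤ r * (3 * r + 1)) : a = 0 ∧ b = 1 ∧ c = 1 := by
  have hbc : b + c ≤ 2 := by
    by_contra! h
    nlinarith
  have hb : b ≤ 2 := by omega
  have hc : c ≤ 2 := by omega
  interval_cases b <;> interval_cases c <;> first | omega | (exfalso; ring_nf at h1; nlinarith)

/-- A representation of the additive group of a finite field of degree `q - 1`, invariant under
multiplication by squares and of small norm, is the regular one without the trivial constituent. -/
theorem sum_normSq_of_mul_sq_invariant {F V : Type*} [Field F] [Fintype F] [AddCommGroup V]
    [Module ℂ V] [FiniteDimensional ℂ V] (hF : ringChar F ≠ 2) (hq : 13 ≤ Fintype.card F)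
    (ρ : Representation ℂ (Multiplicative F) V) (hdim : Module.finrank ℂ V + 1 = Fintype.card F)
    (hinv : ∀ a x : F, a ≠ 0 →
      ρ.character (.ofAdd (a ^ 2 * x)) = ρ.character (.ofAdd x))
    (hle : 2 * ((Fintype.card F : ℝ) - 1) ^ 2 +
        2 * ((Fintype.card F : ℝ) + 1) * ∑ x ∈ Finset.univ.erase (0 : F),
          ‖ρ.character (.ofAdd x)‖ ^ 2 ≤
      Fintype.card F * ((Fintype.card F : ℝ) ^ 2 - 1)) :
    ∑ x ∈ Finset.univ.erase (0 : F), ‖ρ.character (.ofAdd x)‖ ^ 2 = (Fintype.card F : ℝ) - 1 ∧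
      ∑ x : F, ρ.character (.ofAdd x) = 0 := by
  obtain ⟨m, hm, hm'⟩ := exists_multiplicity ρ
  obtain ⟨ψ₀, h0⟩ := AddChar.exists_apply_ne_zero.2 (one_ne_zero (α := F))
  have hψ₀ : ψ₀.IsPrimitive := AddChar.IsPrimitive.of_ne_one fun h => h0 (by rw [h]; rfl)
  have hbij : Function.Bijective ψ₀.mulShift := by
    rw [Fintype.bijective_iff_injective_and_card]
    exact ⟨AddChar.to_mulShift_inj_of_isPrimitive hψ₀, by rw [AddChar.card_eq]⟩
  have hc : (Fintype.card F : ℂ) ≠ 0 := Nat.cast_ne_zero.2 Fintype.card_ne_zero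
  have hM : ∀ a y : F, a ≠ 0 → m (ψ₀.mulShift (a ^ 2 * y)) = m (ψ₀.mulShift y) := by
    intro a y ha
    have : (Fintype.card F : ℂ) * m (ψ₀.mulShift (a ^ 2 * y)) =
        Fintype.card F * m (ψ₀.mulShift y) := by
      rw [← hm, ← hm]
      refine Fintype.sum_equiv (Equiv.mulLeft₀ (a ^ 2) (pow_ne_zero 2 ha)) _ _ fun x => ?_
      simp only [Equiv.mulLeft₀_apply, AddChar.mulShift_apply]
      rw [hinv a x ha]
      congr 2
      ring
    exact_mod_cast mul_left_cancel₀ hc this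
  obtain ⟨n, hn⟩ := FiniteField.exists_nonsquare hF
  have hodd : Fintype.card F % 2 = 1 := FiniteField.odd_card_of_char_ne_two hF
  obtain ⟨r, hr⟩ : ∃ r, Fintype.card F = 2 * r + 1 := ⟨Fintype.card F / 2, by omega⟩
  have hdim' : Module.finrank ℂ V = 2 * r := by omega
  have hsum : Module.finrank ℂ V = ∑ ψ, m ψ := by
    have : (Module.finrank ℂ V : ℂ) = ∑ ψ, (m ψ : ℂ) := by
      rw [← ρ.char_one, ← ofAdd_zero, hm' 0]
      simp
    exact_mod_cast this
  have hsumF : ∀ g : ℕ → ℕ, ∑ ψ, g (m ψ) = ∑ y, g (m (ψ₀.mulShift y)) := fun g =>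
    (Fintype.sum_bijective _ hbij _ _ fun y => rfl).symm
  set a := m (ψ₀.mulShift 0) with ha
  set b := m (ψ₀.mulShift 1) with hb
  set c := m (ψ₀.mulShift n) with hc'
  have h1 : a + r * (b + c) = 2 * r := by
    have := sum_of_mul_sq_invariant hF n hn (fun y => (m (ψ₀.mulShift y) : ℤ))
      (fun a y h => by rw [hM a y h])
    have hs := hsumF id
    simp only [id] at hs
    rw [← Nat.cast_sum, ← hs, ← hsum, hdim', hr] at this
    push_cast at this
    rw [← ha, ← hb, ← hc'] at this
    zify
    linarith
  have h2 : ∑ ψ, m ψ ^ 2 = a ^ 2 + r * (b ^ 2 + c ^ 2) := by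
    have := sum_of_mul_sq_invariant hF n hn (fun y => ((m (ψ₀.mulShift y) ^ 2 : ℕ) : ℤ))
      (fun a y h => by rw [hM a y h])
    rw [← Nat.cast_sum, ← hsumF (· ^ 2), hr] at this
    push_cast at this
    rw [← ha, ← hb, ← hc'] at this
    zify
    linarith
  have hsq := sum_normSq_eq m (fun x => ρ.character (.ofAdd x)) hm'
  have hf0 : ρ.character (.ofAdd (0 : F)) = ((2 * r : ℕ) : ℂ) := by
    rw [ofAdd_zero, ρ.char_one, hdim']
  rw [← Finset.add_sum_erase _ _ (Finset.mem_univ (0 : F)), hf0, hr] at hsq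
  rw [hr] at hle
  set P := ∑ x ∈ Finset.univ.erase (0 : F), ‖ρ.character (.ofAdd x)‖ ^ 2
  have hsqM : ∑ ψ, (m ψ : ℝ) ^ 2 = ((∑ ψ, m ψ ^ 2 : ℕ) : ℝ) := by push_cast; rfl
  rw [hsqM] at hsq
  set M := ∑ ψ, m ψ ^ 2
  rw [Complex.norm_natCast] at hsq
  push_cast at hsq hle
  have h3 : (r + 1) * M ≤ r * (3 * r + 1) := by
    have hr0 : (0 : ℝ) < 2 * r + 1 := by positivity
    have : ((r : ℝ) + 1) * M ≤ r * (3 * r + 1) := by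
      refine le_of_mul_le_mul_left ?_ hr0
      nlinarith
    exact_mod_cast this
  obtain ⟨ha0, hb1, hc1⟩ := multiplicities_of_quadratic_bound a b c r M (by omega) h1 h2 h3
  constructor
  · rw [h2, ha0, hb1, hc1] at hsq
    rw [hr]
    push_cast at hsq ⊢
    linarith
  · have := hm (ψ₀.mulShift 0)
    rw [← ha, ha0] at this
    simpa using this

theorem sum_conj_le {G : Type*} [Group G] [Fintype G] (f : G → ℝ) (hf0 : ∀ g, 0 ≤ f g)
    (hf : ∀ x g, f (x * g * x⁻¹) = f g) (A C : Finset G) (N : ℕ)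
    (hAC : ∀ a ∈ A, ∀ x, x * a * x⁻¹ ∈ C)
    (hN : ∀ g ∈ C, ((Finset.univ ×ˢ A).filter fun p : G × G => p.1 * p.2 * p.1⁻¹ = g).card ≤ N) :
    Fintype.card G * ∑ a ∈ A, f a ≤ N * ∑ g ∈ C, f g := by
  have h1 : Fintype.card G * ∑ a ∈ A, f a =
      ∑ p ∈ (Finset.univ : Finset G) ×ˢ A, f (p.1 * p.2 * p.1⁻¹) := by
    rw [Finset.sum_product]
    simp [hf]
  rw [h1, ← Finset.sum_fiberwise_of_maps_to (t := C) (g := fun p : G × G => p.1 * p.2 * p.1⁻¹)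
    (fun p hp => hAC _ (Finset.mem_product.1 hp).2 _), Finset.mul_sum]
  refine Finset.sum_le_sum fun g hg => ?_
  rw [Finset.sum_congr rfl fun p hp => by rw [(Finset.mem_filter.1 hp).2], Finset.sum_const,
    nsmul_eq_mul]
  exact mul_le_mul_of_nonneg_right (Nat.cast_le.2 (hN g hg)) (hf0 g)

namespace SL2

open Matrix

variable {F : Type*} [Field F]

local notation "S" => SpecialLinearGroup (Fin 2) F

theorem ext_entries {g h : S} (h00 : g 0 0 = h 0 0) (h01 : g 0 1 = h 0 1) (h10 : g 1 0 = h 1 0)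
    (h11 : g 1 1 = h 1 1) : g = h := by
  ext i j
  fin_cases i <;> fin_cases j <;> assumption

theorem mul_entries (g h : S) :
    (g * h) 0 0 = g 0 0 * h 0 0 + g 0 1 * h 1 0 ∧ (g * h) 0 1 = g 0 0 * h 0 1 + g 0 1 * h 1 1 ∧
    (g * h) 1 0 = g 1 0 * h 0 0 + g 1 1 * h 1 0 ∧ (g * h) 1 1 = g 1 0 * h 0 1 + g 1 1 * h 1 1 := by
  simp [Matrix.mul_apply, Fin.sum_univ_two]

theorem one_entries :
    (1 : S) 0 0 = 1 ∧ (1 : S) 0 1 = 0 ∧ (1 : S) 1 0 = 0 ∧ (1 : S) 1 1 = 1 := by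
  simp

theorem neg_entries (g : S) :
    (-g) 0 0 = -g 0 0 ∧ (-g) 0 1 = -g 0 1 ∧ (-g) 1 0 = -g 1 0 ∧ (-g) 1 1 = -g 1 1 := by
  simp

theorem det_entries (g : S) : g 0 0 * g 1 1 - g 0 1 * g 1 0 = 1 := by
  rw [← Matrix.det_fin_two, g.det_coe]

/-- The matrix with the given rows, as an element of the special linear group. -/
def mk (a b c d : F) (h : a * d - b * c = 1) : S :=
  ⟨!![a, b; c, d], by rw [Matrix.det_fin_two_of, h]⟩

theorem mk_entries (a b c d : F) (h : a * d - b * c = 1) :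
    mk a b c d h 0 0 = a ∧ mk a b c d h 0 1 = b ∧ mk a b c d h 1 0 = c ∧ mk a b c d h 1 1 = d := by
  simp [mk]

theorem mk_entry (a b c d : F) (h : a * d - b * c = 1) (i j : Fin 2) :
    mk a b c d h i j = !![a, b; c, d] i j := rfl

theorem mk_mul_mk (a b c d a' b' c' d' : F) (h : a * d - b * c = 1) (h' : a' * d' - b' * c' = 1) :
    mk a b c d h * mk a' b' c' d' h' = mk (a * a' + b * c') (a * b' + b * d') (c * a' + d * c')
      (c * b' + d * d') (by linear_combination (a' * d' - b' * c') * h + h') := by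
  ext i j
  fin_cases i <;> fin_cases j <;> simp [Matrix.mul_apply, Fin.sum_univ_two, mk_entry]

theorem mk_inv (a b c d : F) (h : a * d - b * c = 1) :
    (mk a b c d h)⁻¹ = mk d (-b) (-c) a (by linear_combination h) := by
  ext i j
  rw [SpecialLinearGroup.SL2_inv_expl]
  fin_cases i <;> fin_cases j <;> simp [mk_entry]

theorem eq_mk (g : S) : g = mk (g 0 0) (g 0 1) (g 1 0) (g 1 1) (det_entries g) := by
  apply ext_entries <;> simp [mk]

/-- The trace of an element of the special linear group. -/
def tr (g : S) : F := g 0 0 + g 1 1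

theorem exists_eq_mk (g : S) : ∃ a b c d : F, ∃ h, g = mk a b c d h :=
  ⟨_, _, _, _, _, eq_mk g⟩

theorem tr_mk (a b c d : F) (h : a * d - b * c = 1) : tr (mk a b c d h) = a + d := rfl

theorem tr_mul_comm (g h : S) : tr (g * h) = tr (h * g) := by
  obtain ⟨h1, -, -, h2⟩ := mul_entries g h
  obtain ⟨h3, -, -, h4⟩ := mul_entries h g
  rw [tr, tr, h1, h2, h3, h4]
  ring

theorem tr_conj (x g : S) : tr (x * g * x⁻¹) = tr g := by
  rw [tr_mul_comm, inv_mul_cancel_left]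

theorem tr_neg (g : S) : tr (-g) = -tr g := by
  obtain ⟨h1, -, -, h2⟩ := neg_entries g
  rw [tr, tr, h1, h2]
  ring

theorem tr_one : tr (1 : S) = 2 := by
  simp [tr]
  norm_num

theorem card_eq [Fintype F] :
    Fintype.card S = Fintype.card F * (Fintype.card F ^ 2 - 1) := by
  let e : S ≃ (Fˣ × F × F) ⊕ (Fˣ × F) :=
    { toFun := fun g => if h : g 1 0 = 0 then
        .inr (⟨g 0 0, g 1 1, by linear_combination det_entries g + g 0 1 * h,
          by linear_combination det_entries g + g 0 1 * h⟩, g 0 1)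
        else .inl (Units.mk0 _ h, g 0 0, g 1 1)
      invFun := fun p => match p with
        | .inl (c, a, d) => mk a ((a * d - 1) * c⁻¹) c d (by simp)
        | .inr (a, b) => mk a b 0 a⁻¹ (by simp)
      left_inv := by
        intro g
        have hd := det_entries g
        by_cases h : g 1 0 = 0
        · simp only [dif_pos h]
          have h2 : g 1 1 = (g 0 0)⁻¹ := eq_inv_of_mul_eq_one_right
            (by linear_combination hd + g 0 1 * h)
          apply ext_entries <;> simp [mk, h, h2]
        · simp only [dif_neg h]
          apply ext_entries <;> simp [mk]
          field_simp
          linear_combination hd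
      right_inv := by
        rintro (⟨c, a, d⟩ | ⟨a, b⟩)
        · simp [mk]
        · simp [mk] }
  rw [Fintype.card_congr e]
  simp only [Fintype.card_sum, Fintype.card_prod, Fintype.card_units]
  have := Fintype.one_lt_card (α := F)
  obtain ⟨k, hk⟩ : ∃ k, Fintype.card F = k + 1 := ⟨_, (Nat.succ_pred_eq_of_pos (by omega)).symm⟩
  rw [hk, show (k + 1) ^ 2 - 1 = k * (k + 2) by
    rw [show (k + 1) ^ 2 = k * (k + 2) + 1 by ring]
    rfl]
  simp
  ring

theorem mem_center {g : S} (h : g ∈ Subgroup.center S) : g = 1 ∨ g = -1 := by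
  rw [Matrix.SpecialLinearGroup.mem_center_iff] at h
  obtain ⟨r, hr, h⟩ := h
  have h00 := congrFun (congrFun h 0) 0
  have h01 := congrFun (congrFun h 0) 1
  have h10 := congrFun (congrFun h 1) 0
  have h11 := congrFun (congrFun h 1) 1
  simp only [scalar_apply, diagonal_apply_eq, ne_eq, zero_ne_one, one_ne_zero, not_false_eq_true,
    diagonal_apply_ne] at h00 h01 h10 h11
  rcases mul_self_eq_one_iff.1 (by simpa [sq] using hr) with rfl | rfl
  · left
    apply ext_entries <;> simp [← h00, ← h01, ← h10, ← h11]
  · right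
    apply ext_entries <;> simp [← h00, ← h01, ← h10, ← h11]

theorem neg_one_mem_center : (-1 : S) ∈ Subgroup.center S := by
  rw [Subgroup.mem_center_iff]
  intro g
  simp

theorem one_ne_neg_one (h2 : (2 : F) ≠ 0) : (1 : S) ≠ -1 := by
  intro h
  have := congrArg tr h
  rw [tr_neg, tr_one] at this
  apply h2
  have h4 : (2 : F) * 2 = 0 := by linear_combination this
  simpa using h4

end SL2

namespace SL2

variable {F : Type*} [Field F]

local notation "S" => Matrix.SpecialLinearGroup (Fin 2) F

/-- The upper unitriangular matrix with off-diagonal entry `x`. -/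
def unip (x : F) : S := mk 1 x 0 1 (by simp)

/-- The upper unitriangular matrices as a homomorphism from the additive group of the field. -/
def unipHom (F : Type*) [Field F] : Multiplicative F →* Matrix.SpecialLinearGroup (Fin 2) F where
  toFun x := unip x.toAdd
  map_one' := by
    apply ext_entries <;> simp [unip, mk]
  map_mul' x y := by
    simp only [unip, mk_mul_mk]
    apply ext_entries <;> simp [mk, add_comm]

theorem unip_injective : Function.Injective (unip : F → S) := by
  intro x y h
  have := congrArg (fun g : S => g 0 1) h
  simpa [unip, mk] using this

theorem unip_zero : unip (0 : F) = 1 := (unipHom F).map_one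

theorem tr_unip (x : F) : tr (unip x) = 2 := by
  simp [unip, mk, tr]
  norm_num

variable [Fintype F]

/-- Nontrivial unipotent elements. -/
noncomputable def unipotents (F : Type*) [Field F] [Fintype F] :
    Finset (Matrix.SpecialLinearGroup (Fin 2) F) :=
  (Finset.univ.filter fun g => tr g = 2).erase 1

theorem sum_eq_add_sum_regular (h2 : (2 : F) ≠ 0) (f : S → ℝ) (hf : ∀ g, f (-g) = f g) :
    ∑ g, f g = 2 * f 1 + 2 * ∑ g ∈ unipotents F, f g +
      ∑ g ∈ Finset.univ.filter (fun g : S => tr g ^ 2 ≠ 4), f g := by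
  have h1 : ∑ g ∈ Finset.univ.filter (fun g : S => tr g = 2), f g =
      f 1 + ∑ g ∈ unipotents F, f g := by
    rw [unipotents, Finset.add_sum_erase]
    simp [tr_one]
  have h3 : ∑ g ∈ Finset.univ.filter (fun g : S => tr g = -2), f g =
      ∑ g ∈ Finset.univ.filter (fun g : S => tr g = 2), f g := by
    refine Finset.sum_equiv (Equiv.neg _) (fun g => ?_) fun g _ => (hf g).symm
    simp [tr_neg, neg_eq_iff_eq_neg]
  have h4 : ∑ g ∈ Finset.univ.filter (fun g : S => tr g ^ 2 = 4), f g =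
      ∑ g ∈ Finset.univ.filter (fun g : S => tr g = 2), f g +
        ∑ g ∈ Finset.univ.filter (fun g : S => tr g = -2), f g := by
    rw [← Finset.sum_union]
    · refine Finset.sum_congr ?_ fun _ _ => rfl
      ext g
      simp only [Finset.mem_filter, Finset.mem_univ, true_and, Finset.mem_union]
      rw [show (4 : F) = 2 ^ 2 by norm_num, sq_eq_sq_iff_eq_or_eq_neg]
    · rw [Finset.disjoint_filter]
      intro g _ hg hg'
      rw [hg] at hg'
      apply h2
      have : (2 : F) * 2 = 0 := by linear_combination hg'
      simpa using this
  rw [← Finset.sum_filter_add_sum_filter_not Finset.univ (fun g : S => tr g ^ 2 = 4), h4, h3, h1]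
  ring

theorem card_unip_fiber_le (g : S) :
    ((Finset.univ ×ˢ (Finset.univ.erase (0 : F)).image unip).filter
      fun p : S × S => p.1 * p.2 * p.1⁻¹ = g).card ≤
      (Fintype.card F - 1) * Fintype.card F := by
  set T := (Finset.univ ×ˢ (Finset.univ.erase (0 : F)).image unip).filter
      fun p : S × S => p.1 * p.2 * p.1⁻¹ = g with hT
  rcases T.eq_empty_or_nonempty with he | ⟨⟨y₀, a₀⟩, h₀⟩
  · simp [he]
  have hmem : ∀ p ∈ T, ∃ x ≠ 0, p.2 = unip x ∧ p.1 * p.2 * p.1⁻¹ = g := by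
    intro p hp
    simp only [hT, Finset.mem_filter, Finset.mem_product, Finset.mem_univ, Finset.mem_image,
      Finset.mem_erase, true_and, and_true] at hp
    obtain ⟨⟨x, hx, h⟩, h'⟩ := hp
    exact ⟨x, hx, h.symm, h'⟩
  have htri : ∀ p ∈ T, (y₀⁻¹ * p.1) 1 0 = 0 := by
    intro p hp
    obtain ⟨x, hx, hpx, hpg⟩ := hmem p hp
    obtain ⟨x₀, hx₀, hpx₀, hpg₀⟩ := hmem _ h₀
    simp only at hpx₀ hpg₀
    have hz : (y₀⁻¹ * p.1) * unip x = unip x₀ * (y₀⁻¹ * p.1) := by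
      rw [← hpx, ← hpx₀]
      have : a₀ = y₀⁻¹ * g * y₀ := by rw [← hpg₀]; group
      rw [this, ← hpg]
      group
    generalize y₀⁻¹ * p.1 = z at hz
    have h11 := congrArg (fun g : S => g 1 1) hz
    simp only [(mul_entries z _).2.2.2, (mul_entries _ z).2.2.2] at h11
    simp [unip, mk] at h11
    tauto
  have hcard : (Fintype.card F - 1) * Fintype.card F =
      ((Finset.univ.erase (0 : F)) ×ˢ (Finset.univ : Finset F)).card := by
    rw [Finset.card_product, Finset.card_erase_of_mem (Finset.mem_univ _), Finset.card_univ]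
  rw [hcard]
  refine Finset.card_le_card_of_injOn (fun p => ((y₀⁻¹ * p.1) 0 0, (y₀⁻¹ * p.1) 0 1)) ?_ ?_
  · intro p hp
    have h1 := htri p hp
    have h3 := det_entries (y₀⁻¹ * p.1)
    rw [h1] at h3
    simp only [Finset.coe_product, Set.mem_prod, Finset.mem_coe, Finset.mem_erase,
      Finset.mem_univ, and_true]
    intro h
    rw [h] at h3
    simp at h3
  · intro p hp p' hp' h
    have h1 := htri p hp
    have h1' := htri p' hp'
    have h3 := det_entries (y₀⁻¹ * p.1)
    have h3' := det_entries (y₀⁻¹ * p'.1)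
    obtain ⟨-, -, -, hg⟩ := hmem p hp
    obtain ⟨-, -, -, hg'⟩ := hmem p' hp'
    simp only [Prod.mk.injEq] at h
    obtain ⟨h00, h01⟩ := h
    have hne : (y₀⁻¹ * p'.1) 0 0 ≠ 0 := by
      intro h
      rw [h1', h] at h3'
      simp at h3'
    have hy : y₀⁻¹ * p.1 = y₀⁻¹ * p'.1 := by
      refine ext_entries h00 h01 (h1.trans h1'.symm) ?_
      apply mul_left_cancel₀ hne
      rw [h1, h00] at h3
      rw [h1'] at h3'
      linear_combination h3 - h3'
    have hy' : p.1 = p'.1 := mul_left_cancel hy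
    refine Prod.ext hy' ?_
    rw [← hg', hy'] at hg
    exact mul_left_cancel (mul_right_cancel hg)

theorem card_real (F : Type*) [Field F] [Fintype F] :
    (Fintype.card (Matrix.SpecialLinearGroup (Fin 2) F) : ℝ) =
      Fintype.card F * ((Fintype.card F : ℝ) ^ 2 - 1) := by
  have : 1 ≤ Fintype.card F ^ 2 := Nat.one_le_pow _ _ Fintype.card_pos
  rw [card_eq]
  push_cast [Nat.cast_sub this]
  ring

theorem mul_sum_unip_le (f : S → ℝ) (hf0 : ∀ g, 0 ≤ f g) (hf : ∀ x g, f (x * g * x⁻¹) = f g) :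
    ((Fintype.card F : ℝ) + 1) * ∑ x ∈ Finset.univ.erase (0 : F), f (unip x) ≤
      ∑ g ∈ unipotents F, f g := by
  have h := sum_conj_le f hf0 hf ((Finset.univ.erase (0 : F)).image unip) (unipotents F)
    ((Fintype.card F - 1) * Fintype.card F) ?_ fun g _ => by
    convert card_unip_fiber_le g
  · rw [Finset.sum_image unip_injective.injOn, card_real] at h
    have h1 : 1 < Fintype.card F := Fintype.one_lt_card
    have h1' : (1 : ℝ) < Fintype.card F := by exact_mod_cast h1
    push_cast [Nat.cast_sub h1.le] at h
    have hpos : (0 : ℝ) < ((Fintype.card F : ℝ) - 1) * Fintype.card F := by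
      apply mul_pos <;> linarith
    refine le_of_mul_le_mul_left ?_ hpos
    linarith
  · intro a ha x
    simp only [Finset.mem_image, Finset.mem_erase, Finset.mem_univ, and_true] at ha
    obtain ⟨y, hy, rfl⟩ := ha
    simp only [unipotents, Finset.mem_erase, Finset.mem_filter, Finset.mem_univ, tr_conj, tr_unip, and_true,
       ne_eq, conj_eq_one_iff]
    rwa [← unip_zero, unip_injective.eq_iff]

variable {V : Type*} [AddCommGroup V] [Module ℂ V] [FiniteDimensional ℂ V]

theorem sum_unip (h2 : (2 : F) ≠ 0) (hq : 13 ≤ Fintype.card F) (ρ : Representation ℂ S V)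
    (hdim : Module.finrank ℂ V + 1 = Fintype.card F) (hneg : ∀ g, ρ (-g) = ρ g)
    (hnorm : ∑ g, ‖ρ.character g‖ ^ 2 = Fintype.card S) :
    ∑ x ∈ Finset.univ.erase (0 : F), ‖ρ.character (unip x)‖ ^ 2 = (Fintype.card F : ℝ) - 1 ∧
      ∑ x : F, ρ (unip x) = 0 := by
  have hchar : ringChar F ≠ 2 := fun h => h2 (by
    have := ringChar.Nat.cast_ringChar (R := F)
    rwa [h] at this)
  have h1 : ‖ρ.character 1‖ = (Fintype.card F : ℝ) - 1 := by
    rw [Representation.char_one, ← hdim]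
    simp
  have hu := mul_sum_unip_le (F := F) (fun g => ‖ρ.character g‖ ^ 2) (fun _ => by positivity)
    (fun x g => by rw [Representation.char_conj])
  have hs := sum_eq_add_sum_regular h2 (fun g => ‖ρ.character g‖ ^ 2)
    (fun g => by simp [Representation.character, hneg])
  have hnn : 0 ≤ ∑ g ∈ Finset.univ.filter (fun g : S => tr g ^ 2 ≠ 4), ‖ρ.character g‖ ^ 2 :=
    Finset.sum_nonneg fun _ _ => by positivity
  rw [hnorm, card_real, h1] at hs
  let σ : Representation ℂ (Multiplicative F) V := ρ.comp (unipHom F)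
  have hinv : ∀ a x : F, a ≠ 0 → σ.character (.ofAdd (a ^ 2 * x)) = σ.character (.ofAdd x) := by
    intro a x ha
    have : unip (a ^ 2 * x) = mk a 0 0 a⁻¹ (by simp [ha]) * unip x *
        (mk a 0 0 a⁻¹ (by simp [ha]))⁻¹ := by
      rw [mk_inv, unip, unip, mk_mul_mk, mk_mul_mk]
      apply ext_entries <;> simp [mk, ha]
      ring
    change ρ.character (unip (a ^ 2 * x)) = ρ.character (unip x)
    rw [this, Representation.char_conj]
  obtain ⟨h3, h4⟩ := sum_normSq_of_mul_sq_invariant hchar hq σ hdim hinv (by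
    change _ + _ * ∑ x ∈ Finset.univ.erase (0 : F), ‖ρ.character (unip x)‖ ^ 2 ≤ _
    linarith)
  refine ⟨h3, ?_⟩
  have h5 := sum_eq_zero_of_sum_character_eq_zero σ
    ((Fintype.sum_equiv Multiplicative.ofAdd _ _ fun _ => rfl).symm.trans h4)
  exact (Fintype.sum_equiv Multiplicative.ofAdd _ _ fun _ => rfl).trans h5

end SL2

namespace SL2

variable {F : Type*} [Field F]

local notation "S" => Matrix.SpecialLinearGroup (Fin 2) F

theorem sq_ne_one_of_upper {g : S} (hg : g 1 0 = 0) (ht : tr g ^ 2 ≠ 4) : g 0 0 ^ 2 ≠ 1 := by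
  intro h
  apply ht
  have hd := det_entries g
  rw [hg] at hd
  have h0 : g 1 1 = g 0 0 := by linear_combination g 0 0 * hd - g 1 1 * h
  rw [tr, h0]
  linear_combination 4 * h

theorem character_upper_eq_zero [Fintype F] {V : Type*} [AddCommGroup V] [Module ℂ V]
    (ρ : Representation ℂ S V) (hsum : ∑ x : F, ρ (unip x) = 0) {g : S}
    (hg : g 1 0 = 0) (ht : tr g ^ 2 ≠ 4) : ρ.character g = 0 := by
  have h1 := sq_ne_one_of_upper hg ht
  have hd := det_entries g
  rw [hg] at hd
  have h2 : g 1 1 - g 0 0 ≠ 0 := by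
    intro h
    apply h1
    linear_combination hd - g 0 0 * h
  have key : ∀ x : F, ρ.character (g * unip x) = ρ.character g := by
    intro x
    obtain ⟨y, hy⟩ : ∃ y, y * (g 1 1 - g 0 0) = g 0 0 * x := ⟨_, div_mul_cancel₀ _ h2⟩
    have : g * unip x = unip y * g * (unip y)⁻¹ := by
      obtain ⟨a, b, c, d, h, rfl⟩ := exists_eq_mk g
      simp only [mk_entries] at hg hy
      rw [unip, unip, mk_inv, mk_mul_mk, mk_mul_mk, mk_mul_mk]
      apply ext_entries <;> simp [mk, hg]
      linear_combination -hy
    rw [this, Representation.char_conj]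
  have h3 : ∑ x : F, ρ.character (g * unip x) = 0 := by
    simp only [Representation.character, map_mul]
    rw [← map_sum, ← Finset.mul_sum, hsum, mul_zero, map_zero]
  simp only [key, Finset.sum_const, Finset.card_univ, nsmul_eq_mul, mul_eq_zero, Nat.cast_eq_zero,
    Fintype.card_ne_zero, false_or] at h3
  exact h3

theorem exists_conj_upper (g : S) {s : F} (hs : s ^ 2 - tr g * s + 1 = 0) :
    ∃ x : S, (x * g * x⁻¹) 1 0 = 0 := by
  by_cases hc : g 1 0 = 0
  · exact ⟨1, by simpa using hc⟩
  · refine ⟨mk 0 1 (-1) ((s - g 1 1) / g 1 0) (by simp), ?_⟩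
    obtain ⟨a, b, c, d, hd, rfl⟩ := exists_eq_mk g
    rw [tr_mk] at hs
    simp only [mk_inv, mk_mul_mk, mk_entries] at hc ⊢
    field_simp
    linear_combination hs + hd

theorem upper_pow {g : S} (hg : g 1 0 = 0) (n : ℕ) :
    (g ^ n) 1 0 = 0 ∧ (g ^ n) 0 0 = g 0 0 ^ n := by
  induction n with
  | zero => simp
  | succ n ih =>
    rw [pow_succ, (mul_entries _ _).1, (mul_entries _ _).2.2.1, hg, ih.1, ih.2, pow_succ]
    simp

theorem two_mul_dvd_of_upper [Fintype F] (h2 : (2 : F) ≠ 0) {g : S} (hg : g 1 0 = 0)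
    (ht : tr g ^ 2 ≠ 4) {l : ℕ} (hl : l.Prime) (hgl : g ^ l = 1 ∨ g ^ l = -1) :
    2 * l ∣ Fintype.card F - 1 := by
  have h1 := sq_ne_one_of_upper hg ht
  have hodd : Fintype.card F % 2 = 1 := by
    apply FiniteField.odd_card_of_char_ne_two
    intro h
    apply h2
    have := ringChar.Nat.cast_ringChar (R := F)
    rwa [h] at this
  have h3 : (g 0 0 ^ 2) ^ l = 1 := by
    rw [← pow_mul, mul_comm, pow_mul, ← (upper_pow hg l).2]
    rcases hgl with h | h <;> simp [h]
  have h0 : g 0 0 ≠ 0 := by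
    intro h
    rw [h, zero_pow two_ne_zero, zero_pow hl.ne_zero] at h3
    exact zero_ne_one h3
  have : Fact l.Prime := ⟨hl⟩
  have h4 : orderOf (g 0 0 ^ 2) = l := orderOf_eq_prime_iff.2 ⟨h3, h1⟩
  obtain ⟨k, hk⟩ : ∃ k, Fintype.card F - 1 = 2 * k := ⟨Fintype.card F / 2, by omega⟩
  have h5 : (g 0 0 ^ 2) ^ k = 1 := by
    rw [← pow_mul, ← hk, FiniteField.pow_card_sub_one_eq_one _ h0]
  rw [hk]
  exact mul_dvd_mul_left 2 (h4 ▸ orderOf_dvd_of_pow_eq_one h5)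

/-- An element of trace two whose power is central has to be trivial, unless the exponent vanishes
in the field. -/
theorem eq_one_of_tr_eq_two (h2 : (2 : F) ≠ 0) {g : S} (ht : tr g = 2) {l : ℕ}
    (hl : (l : F) ≠ 0) (hgl : g ^ l = 1 ∨ g ^ l = -1) : g = 1 := by
  have key : ∀ n : ℕ, (g ^ n) 0 0 = 1 + n * (g 0 0 - 1) ∧ (g ^ n) 0 1 = n * g 0 1 ∧
      (g ^ n) 1 0 = n * g 1 0 ∧ (g ^ n) 1 1 = 1 + n * (g 1 1 - 1) := by
    have hd := det_entries g
    rw [tr] at ht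
    intro n
    induction n with
    | zero => simp
    | succ n ih =>
      obtain ⟨h1, h2, h3, h4⟩ := ih
      obtain ⟨e1, e2, e3, e4⟩ := mul_entries (g ^ n) g
      rw [pow_succ, e1, e2, e3, e4, h1, h2, h3, h4]
      push_cast
      refine ⟨?_, ?_, ?_, ?_⟩
      · linear_combination -n * hd + n * g 0 0 * ht
      · linear_combination n * g 0 1 * ht
      · linear_combination n * g 1 0 * ht
      · linear_combination -n * hd + n * g 1 1 * ht
  obtain ⟨k1, k2, k3, k4⟩ := key l
  have h1 : g ^ l = 1 := by
    rcases hgl with h | h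
    · exact h
    · exfalso
      have : tr (g ^ l) = 2 := by
        rw [tr, k1, k4]
        rw [tr] at ht
        linear_combination (l : F) * ht
      rw [h, tr_neg, tr_one] at this
      apply h2
      have h4 : (2 : F) * 2 = 0 := by linear_combination -this
      simpa using h4
  obtain ⟨o1, o2, o3, o4⟩ := one_entries (F := F)
  rw [h1] at k1 k2 k3 k4
  rw [o1] at k1
  rw [o2] at k2
  rw [o3] at k3
  rw [o4] at k4
  apply ext_entries
  · rw [o1]
    apply mul_left_cancel₀ hl
    linear_combination -k1
  · rw [o2]
    apply mul_left_cancel₀ hl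
    linear_combination -k2
  · rw [o3]
    apply mul_left_cancel₀ hl
    linear_combination -k3
  · rw [o4]
    apply mul_left_cancel₀ hl
    linear_combination -k4

theorem tr_sq_ne_four (h2 : (2 : F) ≠ 0) {g : S} (h1 : g ≠ 1) (h1' : g ≠ -1) {l : ℕ}
    (hl : (l : F) ≠ 0) (hgl : g ^ l = 1 ∨ g ^ l = -1) : tr g ^ 2 ≠ 4 := by
  intro h
  rw [show (4 : F) = 2 ^ 2 by norm_num, sq_eq_sq_iff_eq_or_eq_neg] at h
  rcases h with h | h
  · exact h1 (eq_one_of_tr_eq_two h2 h hl hgl)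
  · apply h1'
    rw [← neg_eq_iff_eq_neg]
    refine eq_one_of_tr_eq_two h2 (by rw [tr_neg, h, neg_neg]) hl ?_
    rw [neg_pow]
    rcases neg_one_pow_eq_or S l with h' | h' <;> rcases hgl with h | h <;> simp [h', h]

end SL2

namespace SL2

variable {F : Type*} [Field F]

local notation "S" => Matrix.SpecialLinearGroup (Fin 2) F

/-- An element of the special linear group without eigenvalues in the field. -/
def IsElliptic (g : S) : Prop := ∀ s : F, s ^ 2 - tr g * s + 1 ≠ 0

theorem IsElliptic.entry_ne_zero {g : S} (hg : IsElliptic g) : g 1 0 ≠ 0 := by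
  intro h
  have hd := det_entries g
  apply hg (g 0 0)
  rw [tr]
  linear_combination -hd - g 0 1 * h

theorem IsElliptic.tr_sq_ne_four {g : S} (hg : IsElliptic g) : tr g ^ 2 ≠ 4 := by
  intro h
  rw [show (4 : F) = 2 ^ 2 by norm_num, sq_eq_sq_iff_eq_or_eq_neg] at h
  rcases h with h | h
  · apply hg 1
    rw [h]
    ring
  · apply hg (-1)
    rw [h]
    ring

theorem mem_centralizer_singleton {g m : S} (hc : g 1 0 ≠ 0) :
    m ∈ Subgroup.centralizer {g} ↔ m 0 1 = m 1 0 / g 1 0 * g 0 1 ∧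
      m 0 0 = m 1 1 + m 1 0 / g 1 0 * (g 0 0 - g 1 1) := by
  rw [Subgroup.mem_centralizer_singleton_iff]
  obtain ⟨a, b, c, d, hd, rfl⟩ := exists_eq_mk g
  obtain ⟨a', b', c', d', hd', rfl⟩ := exists_eq_mk m
  simp only [mk_entries] at hc ⊢
  constructor
  · intro h
    have h00 := congrArg (fun g : S => g 0 0) h
    have h10 := congrArg (fun g : S => g 1 0) h
    simp only [mk_mul_mk, mk_entries] at h00 h10
    constructor
    · field_simp
      linear_combination h00
    · field_simp
      linear_combination -h10
  · rintro ⟨h1, h2⟩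
    rw [mk_mul_mk, mk_mul_mk]
    subst h1
    subst h2
    apply ext_entries <;> simp only [mk_entries] <;> field_simp <;> ring

theorem commute_of_mem_centralizer {g m m' : S} (hc : g 1 0 ≠ 0)
    (h : m ∈ Subgroup.centralizer {g}) (h' : m' ∈ Subgroup.centralizer {g}) :
    m * m' = m' * m := by
  rw [mem_centralizer_singleton hc] at h h'
  obtain ⟨a, b, c, d, hd, rfl⟩ := exists_eq_mk g
  obtain ⟨a', b', c', d', hd', rfl⟩ := exists_eq_mk m
  obtain ⟨a'', b'', c'', d'', hd'', rfl⟩ := exists_eq_mk m'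
  simp only [mk_entries] at hc h h'
  obtain ⟨rfl, rfl⟩ := h
  obtain ⟨rfl, rfl⟩ := h'
  rw [mk_mul_mk, mk_mul_mk]
  apply ext_entries <;> simp only [mk_entries] <;> field_simp <;> ring

theorem eq_one_or_neg_one_of_mem_centralizer {g m : S} (hc : g 1 0 ≠ 0)
    (h : m ∈ Subgroup.centralizer {g}) (h0 : m 1 0 = 0) : m = 1 ∨ m = -1 := by
  rw [mem_centralizer_singleton hc, h0] at h
  obtain ⟨h1, h2⟩ := h
  have hd := det_entries m
  simp only [zero_div, zero_mul, add_zero] at h1 h2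
  rw [h1, h2] at hd
  have h3 : m 1 1 * m 1 1 = 1 := by linear_combination hd
  rcases mul_self_eq_one_iff.1 h3 with h3 | h3
  · left
    apply ext_entries <;> simp [h0, h1, h2, h3]
  · right
    apply ext_entries <;> simp [h0, h1, h2, h3]

theorem centralizer_le_of_mem {g m : S} (hc : g 1 0 ≠ 0)
    (h : m ∈ Subgroup.centralizer {g}) (h0 : m 1 0 ≠ 0) :
    Subgroup.centralizer {m} ≤ Subgroup.centralizer {g} := by
  intro x hx
  rw [mem_centralizer_singleton hc] at h ⊢
  rw [mem_centralizer_singleton h0, h.1, h.2] at hx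
  rw [hx.1, hx.2]
  constructor
  · field_simp
  · field_simp
    ring

theorem card_centralizer [Fintype F] (h2 : (2 : F) ≠ 0) {g : S} (hg : IsElliptic g) :
    Nat.card (Subgroup.centralizer {g}) = Fintype.card F + 1 := by
  have hc := hg.entry_ne_zero
  set t := tr g with ht
  have hN : ∀ s : F, s ^ 2 + t * s + 1 ≠ 0 := fun s h => hg (-s) (by linear_combination h)
  have hdet : ∀ x y : F, x ^ 2 + t * x * y + y ^ 2 = 1 →
      (x + y * g 0 0) * (x + y * g 1 1) - y * g 0 1 * (y * g 1 0) = 1 := by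
    intro x y h
    rw [ht, tr] at h
    linear_combination h + y ^ 2 * det_entries g
  have hmem : ∀ (x y : F) (h : x ^ 2 + t * x * y + y ^ 2 = 1),
      mk (x + y * g 0 0) (y * g 0 1) (y * g 1 0) (x + y * g 1 1) (hdet x y h) ∈
        Subgroup.centralizer {g} := by
    intro x y h
    rw [mem_centralizer_singleton hc]
    simp only [mk_entries]
    constructor
    · field_simp
    · field_simp
      ring
  obtain ⟨y, hy⟩ : ∃ y : F → F, ∀ s, y s * (s ^ 2 + t * s + 1) = -(2 * s + t) :=
    ⟨fun s => -(2 * s + t) / (s ^ 2 + t * s + 1), fun s => div_mul_cancel₀ _ (hN s)⟩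
  have hxy : ∀ s, (1 + s * y s) ^ 2 + t * (1 + s * y s) * y s + y s ^ 2 = 1 := by
    intro s
    linear_combination y s * hy s
  let φ : Option F → Subgroup.centralizer {g} := fun o => match o with
    | none => ⟨mk _ _ _ _ (hdet (-1) 0 (by ring)), hmem (-1) 0 (by ring)⟩
    | some s => ⟨mk _ _ _ _ (hdet _ _ (hxy s)), hmem _ _ (hxy s)⟩
  have hφ : Function.Bijective φ := by
    constructor
    · have hsome : ∀ s s', φ (some s) = φ (some s') → y s = y s' ∧ s * y s = s' * y s' := by
        intro s s' h
        have h10 := congrArg (fun m : Subgroup.centralizer {g} => (m : S) 1 0) h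
        have h00 := congrArg (fun m : Subgroup.centralizer {g} => (m : S) 0 0) h
        simp only [φ, mk_entries] at h10 h00
        have h1 := mul_right_cancel₀ hc h10
        refine ⟨h1, ?_⟩
        rw [h1] at h00 ⊢
        linear_combination h00
      have hnone : ∀ s, φ none ≠ φ (some s) := by
        intro s h
        have h10 := congrArg (fun m : Subgroup.centralizer {g} => (m : S) 1 0) h
        have h00 := congrArg (fun m : Subgroup.centralizer {g} => (m : S) 0 0) h
        simp only [φ, mk_entries] at h10 h00
        have h1 := mul_right_cancel₀ hc h10
        rw [← h1] at h00
        apply h2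
        linear_combination -h00
      rintro (_ | s) (_ | s') h
      · rfl
      · exact absurd h (hnone _)
      · exact absurd h.symm (hnone _)
      · obtain ⟨h1, h3⟩ := hsome s s' h
        congr 1
        by_cases h0 : y s = 0
        · have e1 := hy s
          have e2 := hy s'
          rw [← h1] at e2
          rw [h0] at e1 e2
          apply mul_left_cancel₀ h2
          linear_combination e1 - e2
        · rw [← h1] at h3
          exact mul_right_cancel₀ h0 h3
    · rintro ⟨m, hm⟩
      have hm' := (mem_centralizer_singleton hc).1 hm
      obtain ⟨y₀, hy₀⟩ : ∃ y₀, m 1 0 = y₀ * g 1 0 := ⟨m 1 0 / g 1 0, by field_simp⟩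
      obtain ⟨x₀, hx₀⟩ : ∃ x₀, m 1 1 = x₀ + y₀ * g 1 1 := ⟨m 1 1 - y₀ * g 1 1, by ring⟩
      rw [hy₀, hx₀, mul_div_cancel_right₀ _ hc] at hm'
      obtain ⟨hm1, hm2⟩ := hm'
      have hd := det_entries m
      rw [hm1, hm2, hy₀, hx₀] at hd
      have hn : x₀ ^ 2 + t * x₀ * y₀ + y₀ ^ 2 = 1 := by
        rw [ht, tr]
        linear_combination hd - y₀ ^ 2 * det_entries g
      by_cases h0 : y₀ = 0
      · subst h0
        have h3 : x₀ * x₀ = 1 := by linear_combination hn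
        rcases mul_self_eq_one_iff.1 h3 with rfl | rfl
        · refine ⟨some (-t / 2), Subtype.ext ?_⟩
          have : y (-t / 2) = 0 := by
            apply mul_right_cancel₀ (hN (-t / 2))
            rw [hy]
            field_simp
            ring
          simp only [φ, this]
          apply ext_entries <;> simp only [mk_entries, hm1, hm2, hy₀, hx₀] <;> ring
        · refine ⟨none, Subtype.ext ?_⟩
          simp only [φ]
          apply ext_entries <;> simp only [mk_entries, hm1, hm2, hy₀, hx₀] <;> ring
      · obtain ⟨s, hs⟩ : ∃ s, x₀ = 1 + s * y₀ := ⟨(x₀ - 1) / y₀, by field_simp; ring⟩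
        have : y s = y₀ := by
          apply mul_right_cancel₀ (hN s)
          rw [hy]
          apply mul_left_cancel₀ h0
          rw [hs] at hn
          linear_combination -hn
        refine ⟨some s, Subtype.ext ?_⟩
        simp only [φ, this]
        apply ext_entries <;> simp only [mk_entries, hm1, hm2, hy₀, hx₀, hs] <;> ring
  rw [← Nat.card_congr (Equiv.ofBijective φ hφ), Nat.card_eq_fintype_card, Fintype.card_option]

end SL2

namespace SL2

variable {F : Type*} [Field F]

local notation "S" => Matrix.SpecialLinearGroup (Fin 2) F

theorem tr_sq_eq_of_mem_centralizer {g m : S} (hc : g 1 0 ≠ 0)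
    (h : m ∈ Subgroup.centralizer {g}) :
    (m 1 0 / g 1 0) ^ 2 * (tr g ^ 2 - 4) = tr m ^ 2 - 4 := by
  obtain ⟨h1, h2⟩ := (mem_centralizer_singleton hc).1 h
  have hd := det_entries m
  have hd' := det_entries g
  rw [h1, h2] at hd
  rw [tr, tr, h2]
  field_simp at hd ⊢
  linear_combination (-4) * g 1 0 * hd + 4 * m 1 0 ^ 2 * hd'

variable [Fintype F]

/-- The noncentral elements of the centralizer of `g`. -/
noncomputable def noncentral (g : S) : Finset S :=
  Finset.univ.filter fun m => m ∈ Subgroup.centralizer {g} ∧ m 1 0 ≠ 0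

theorem card_noncentral_tr_le (h2 : (2 : F) ≠ 0) {g : S} (hc : g 1 0 ≠ 0) (ht : tr g ^ 2 ≠ 4)
    (τ : F) : ((noncentral g).filter fun m => tr m = τ).card ≤ 2 := by
  set B := (noncentral g).filter fun m => tr m = τ with hB
  rcases B.eq_empty_or_nonempty with he | ⟨a₀, h₀⟩
  · simp [he]
  have hmem : ∀ m ∈ B, m ∈ Subgroup.centralizer {g} ∧ tr m = τ := by
    intro m hm
    simp only [hB, noncentral, Finset.mem_filter, Finset.mem_univ, true_and] at hm
    exact ⟨hm.1.1, hm.2⟩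
  have ht' : tr g ^ 2 - 4 ≠ 0 := sub_ne_zero.2 ht
  refine (Finset.card_le_card_of_injOn (t := {a₀ 1 0 / g 1 0, -(a₀ 1 0 / g 1 0)})
    (fun m => m 1 0 / g 1 0) ?_ ?_).trans Finset.card_le_two
  · intro m hm
    simp only [Finset.coe_insert, Finset.coe_singleton, Set.mem_insert_iff, Set.mem_singleton_iff]
    apply sq_eq_sq_iff_eq_or_eq_neg.1
    apply mul_right_cancel₀ ht'
    rw [tr_sq_eq_of_mem_centralizer hc (hmem m hm).1, tr_sq_eq_of_mem_centralizer hc (hmem _ h₀).1,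
      (hmem m hm).2, (hmem _ h₀).2]
  · intro m hm m' hm' h
    simp only at h
    have e0 := div_left_inj' hc |>.1 h
    obtain ⟨e1, e2⟩ := (mem_centralizer_singleton hc).1 (hmem m hm).1
    obtain ⟨e1', e2'⟩ := (mem_centralizer_singleton hc).1 (hmem m' hm').1
    have e3 := (hmem m hm).2.trans (hmem m' hm').2.symm
    rw [tr, tr, e2, e2', h] at e3
    have e4 : m 1 1 = m' 1 1 := by
      apply mul_left_cancel₀ h2
      linear_combination e3
    apply ext_entries
    · rw [e2, e2', h, e4]
    · rw [e1, e1', h]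
    · exact e0
    · exact e4

theorem card_noncentral_fiber_le (h2 : (2 : F) ≠ 0) {g : S} (hg : IsElliptic g) (x : S) :
    ((Finset.univ ×ˢ noncentral g).filter fun p : S × S => p.1 * p.2 * p.1⁻¹ = x).card ≤
      (Fintype.card F + 1) * 2 := by
  have hc := hg.entry_ne_zero
  set T := (Finset.univ ×ˢ noncentral g).filter fun p : S × S => p.1 * p.2 * p.1⁻¹ = x with hT
  have hmem : ∀ p ∈ T, p.2 ∈ noncentral g ∧ p.1 * p.2 * p.1⁻¹ = x := by
    intro p hp
    simpa [hT] using hp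
  have himg : (T.image Prod.snd).card ≤ 2 := by
    refine (Finset.card_le_card ?_).trans (card_noncentral_tr_le h2 hc hg.tr_sq_ne_four (tr x))
    intro a ha
    obtain ⟨p, hp, rfl⟩ := Finset.mem_image.1 ha
    obtain ⟨h1, h3⟩ := hmem p hp
    exact Finset.mem_filter.2 ⟨h1, by rw [← h3, tr_conj]⟩
  refine (Finset.card_le_mul_card_image T (Fintype.card F + 1) (f := Prod.snd) ?_).trans
    (Nat.mul_le_mul_left _ himg)
  intro a ha
  set U := T.filter fun p => p.2 = a with hU
  have hmemU : ∀ p ∈ U, p.2 = a ∧ p.1 * a * p.1⁻¹ = x ∧ a ∈ noncentral g := by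
    intro p hp
    obtain ⟨h1, rfl⟩ := Finset.mem_filter.1 hp
    exact ⟨rfl, (hmem p h1).2, (hmem p h1).1⟩
  rcases U.eq_empty_or_nonempty with he | ⟨p₀, h₀⟩
  · simp [he]
  obtain ⟨-, h4, h5⟩ := hmemU p₀ h₀
  simp only [noncentral, Finset.mem_filter, Finset.mem_univ, true_and] at h5
  have hcard : Fintype.card F + 1 =
      (Finset.univ.filter fun m => m ∈ Subgroup.centralizer {g}).card := by
    rw [← card_centralizer h2 hg, Nat.card_eq_fintype_card, Fintype.card_subtype]
  rw [hcard]
  refine Finset.card_le_card_of_injOn (fun p => p₀.1⁻¹ * p.1) ?_ ?_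
  · intro p hp
    obtain ⟨-, h6, -⟩ := hmemU p hp
    simp only [Finset.coe_filter, Finset.mem_univ, true_and, Set.mem_ofPred_eq]
    apply centralizer_le_of_mem hc h5.1 h5.2
    rw [Subgroup.mem_centralizer_singleton_iff]
    rw [← h4] at h6
    have : p.1 * a = p₀.1 * a * p₀.1⁻¹ * p.1 := by
      rw [← h6]
      group
    rw [mul_assoc, this]
    group
  · intro p hp p' hp' h
    exact Prod.ext (mul_left_cancel h) ((hmemU p hp).1.trans (hmemU p' hp').1.symm)

theorem sum_centralizer_eq (h2 : (2 : F) ≠ 0) {g : S} (hc : g 1 0 ≠ 0) (f : S → ℝ)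
    (hf : f (-1) = f 1) :
    ∑ m : Subgroup.centralizer {g}, f m = 2 * f 1 + ∑ m ∈ noncentral g, f m := by
  rw [← Finset.sum_subtype (Finset.univ.filter fun m => m ∈ Subgroup.centralizer {g}) (by simp) f]
  have : (Finset.univ.filter fun m => m ∈ Subgroup.centralizer {g}) = {1, -1} ∪ noncentral g := by
    ext m
    simp only [noncentral, Finset.mem_filter, Finset.mem_univ, true_and, Finset.mem_union,
      Finset.mem_insert, Finset.mem_singleton]
    constructor
    · intro h
      by_cases h0 : m 1 0 = 0
      · exact .inl (eq_one_or_neg_one_of_mem_centralizer hc h h0)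
      · exact .inr ⟨h, h0⟩
    · rintro ((rfl | rfl) | h)
      · exact one_mem _
      · rw [Subgroup.mem_centralizer_singleton_iff]
        simp
      · exact h.1
  rw [this, Finset.sum_union, Finset.sum_pair (one_ne_neg_one h2), hf]
  · ring
  · rw [Finset.disjoint_left]
    intro m hm hm'
    simp only [noncentral, Finset.mem_filter, Finset.mem_univ, true_and] at hm'
    apply hm'.2
    simp only [Finset.mem_insert, Finset.mem_singleton] at hm
    rcases hm with rfl | rfl <;> simp

theorem mul_sum_noncentral_le (h2 : (2 : F) ≠ 0) {g : S} (hg : IsElliptic g) (f : S → ℝ)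
    (hf0 : ∀ g, 0 ≤ f g) (hf : ∀ x g, f (x * g * x⁻¹) = f g) :
    Fintype.card F * ((Fintype.card F : ℝ) - 1) * ∑ m ∈ noncentral g, f m ≤
      2 * ∑ g ∈ Finset.univ.filter (fun g : S => tr g ^ 2 ≠ 4), f g := by
  have hc := hg.entry_ne_zero
  have h := sum_conj_le f hf0 hf (noncentral g) (Finset.univ.filter fun g : S => tr g ^ 2 ≠ 4)
    ((Fintype.card F + 1) * 2) ?_ fun x _ => by
    convert card_noncentral_fiber_le h2 hg x
  · rw [card_real] at h
    push_cast at h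
    have hpos : (0 : ℝ) < (Fintype.card F : ℝ) + 1 := by positivity
    refine le_of_mul_le_mul_left ?_ hpos
    linarith
  · intro a ha x
    simp only [noncentral, Finset.mem_filter, Finset.mem_univ, true_and] at ha ⊢
    rw [tr_conj, ← sub_ne_zero, ← tr_sq_eq_of_mem_centralizer hc ha.1]
    exact mul_ne_zero (pow_ne_zero _ (div_ne_zero ha.2 hc)) (sub_ne_zero.2 hg.tr_sq_ne_four)

variable {V : Type*} [AddCommGroup V] [Module ℂ V] [FiniteDimensional ℂ V]

theorem sum_normSq_centralizer_le (h2 : (2 : F) ≠ 0) (hq : 13 ≤ Fintype.card F)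
    (ρ : Representation ℂ S V)
    (hdim : Module.finrank ℂ V + 1 = Fintype.card F) (hneg : ∀ g, ρ (-g) = ρ g)
    (hnorm : ∑ g, ‖ρ.character g‖ ^ 2 = Fintype.card S) {g : S} (hg : IsElliptic g) :
    ∑ m : Subgroup.centralizer {g}, ‖ρ.character (m : S)‖ ^ 2 ≤
      2 * ((Fintype.card F : ℝ) - 1) ^ 2 + 2 * ((Fintype.card F : ℝ) - 3) := by
  have h1 : ‖ρ.character 1‖ = (Fintype.card F : ℝ) - 1 := by
    rw [Representation.char_one, ← hdim]
    simp
  have hconj : ∀ x g : S, ‖ρ.character (x * g * x⁻¹)‖ ^ 2 = ‖ρ.character g‖ ^ 2 := fun x g => by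
    rw [Representation.char_conj]
  have hneg' : ∀ g : S, ‖ρ.character (-g)‖ ^ 2 = ‖ρ.character g‖ ^ 2 := fun g => by
    simp [Representation.character, hneg]
  have hu := mul_sum_unip_le (F := F) (fun g => ‖ρ.character g‖ ^ 2) (fun _ => by positivity) hconj
  have hs := sum_eq_add_sum_regular h2 (fun g => ‖ρ.character g‖ ^ 2) hneg'
  have he := mul_sum_noncentral_le h2 hg (fun g => ‖ρ.character g‖ ^ 2) (fun _ => by positivity)
    hconj
  rw [hnorm, card_real, h1] at hs
  rw [(sum_unip h2 hq ρ hdim hneg hnorm).1] at hu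
  rw [sum_centralizer_eq h2 hg.entry_ne_zero (fun g => ‖ρ.character g‖ ^ 2) (hneg' 1), h1]
  have hq' : (13 : ℝ) ≤ Fintype.card F := by exact_mod_cast hq
  have hpos : (0 : ℝ) < Fintype.card F * ((Fintype.card F : ℝ) - 1) := by
    apply mul_pos <;> linarith
  gcongr
  refine le_of_mul_le_mul_left ?_ hpos
  linarith

end SL2

namespace SL2

variable {F : Type*} [Field F]

local notation "S" => Matrix.SpecialLinearGroup (Fin 2) F

theorem exists_conj_eq_inv [Finite F] (h2 : (2 : F) ≠ 0) {g : S} (hc : g 1 0 ≠ 0)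
    (ht : tr g ^ 2 ≠ 4) : ∃ x : S, x * g * x⁻¹ = g⁻¹ := by
  have := Fintype.ofFinite F
  have hodd : Fintype.card F % 2 = 1 := by
    apply FiniteField.odd_card_of_char_ne_two
    intro h
    apply h2
    have := ringChar.Nat.cast_ringChar (R := F)
    rwa [h] at this
  obtain ⟨a, b, c, d, hd, rfl⟩ := exists_eq_mk g
  simp only [mk_entries, tr_mk] at hc ht
  have h4 : (4 : F) ≠ 0 := by
    rw [show (4 : F) = 2 ^ 2 by norm_num]
    exact pow_ne_zero 2 h2
  have hD : ((a + d) ^ 2 - 4) / (4 * c) ≠ 0 :=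
    div_ne_zero (sub_ne_zero.2 ht) (mul_ne_zero h4 hc)
  obtain ⟨u, z, huz⟩ := FiniteField.exists_root_sum_quadratic
    (f := .C (-c) * .X ^ 2 + .C 0 * .X + .C (-c))
    (g := .C (((a + d) ^ 2 - 4) / (4 * c)) * .X ^ 2 + .C 0 * .X + .C 0)
    (Polynomial.degree_quadratic (neg_ne_zero.2 hc)) (Polynomial.degree_quadratic hD) hodd
  simp only [Polynomial.eval_add, Polynomial.eval_mul, Polynomial.eval_C, Polynomial.eval_pow,
    Polynomial.eval_X, zero_mul, add_zero] at huz
  obtain ⟨x, hx⟩ : ∃ x, u = x - (a - d) * z / (2 * c) := ⟨u + (a - d) * z / (2 * c), by ring⟩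
  obtain ⟨y, hy⟩ : ∃ y, y * c = -(x * (a - d) + z * b) :=
    ⟨-(x * (a - d) + z * b) / c, div_mul_cancel₀ _ hc⟩
  have hw : x * (-x) - y * z = 1 := by
    apply mul_right_cancel₀ hc
    have : y * c * z = -(x * (a - d) + z * b) * z := by rw [hy]
    rw [hx] at huz
    field_simp at huz
    have h16 : (4 : F) * (4 * c) ≠ 0 := mul_ne_zero h4 (mul_ne_zero h4 hc)
    apply mul_left_cancel₀ h16
    linear_combination huz - 16 * c * this - 16 * z ^ 2 * hd
  refine ⟨mk x y z (-x) hw, ?_⟩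
  simp only [mk_inv, mk_mul_mk]
  apply ext_entries <;> simp only [mk_entries]
  · linear_combination -x * hy + d * hw
  · linear_combination -y * hy - b * hw
  · linear_combination -z * hy - c * hw
  · linear_combination x * hy + a * hw

theorem det_eq_one (h2 : (2 : F) ≠ 0) (h3 : (3 : F) ≠ 0) {V : Type*} [AddCommGroup V] [Module ℂ V]
    (ρ : Representation ℂ S V) {g : S} (hc : g 1 0 ≠ 0) : LinearMap.det (ρ g) = 1 := by
  let l : S →* ℂ := LinearMap.det.comp ρ
  have hne : ∀ g, l g ≠ 0 := fun g => ((Group.isUnit g).map l).ne_zero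
  have hconj : ∀ x g, l (x * g * x⁻¹) = l g := by
    intro x g
    rw [map_mul, map_mul, mul_right_comm, ← map_mul, mul_inv_cancel, map_one, one_mul]
  have hunip : ∀ x, l (unip x) = 1 := by
    intro x
    have h4 : l (unip (4 * (x / 3))) = l (unip (x / 3)) := by
      rw [← hconj (mk 2 0 0 2⁻¹ (by simp [h2])) (unip (x / 3))]
      congr 1
      rw [mk_inv, unip, unip, mk_mul_mk, mk_mul_mk]
      apply ext_entries <;> simp [mk, h2]
      ring
    have h5 : unip (4 * (x / 3)) = unip x * unip (x / 3) := by
      simp only [unip, mk_mul_mk]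
      apply ext_entries <;> simp [mk]
      field_simp
      ring
    rw [h5, map_mul] at h4
    exact mul_right_cancel₀ (hne _) (h4.trans (one_mul _).symm)
  have hlow : ∀ x, l (mk 1 0 x 1 (by simp)) = 1 := by
    intro x
    rw [← hunip (-x), ← hconj (mk 0 (-1) 1 0 (by simp)) (unip (-x))]
    congr 1
    rw [mk_inv, unip, mk_mul_mk, mk_mul_mk]
    apply ext_entries <;> simp [mk]
  change l g = 1
  have : g = unip ((g 0 0 - 1) / g 1 0) * mk 1 0 (g 1 0) 1 (by simp) *
      unip ((g 1 1 - 1) / g 1 0) := by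
    obtain ⟨a, b, c, d, hd, rfl⟩ := exists_eq_mk g
    simp only [mk_entries] at hc ⊢
    simp only [unip, mk_mul_mk]
    apply ext_entries <;> simp only [mk_entries] <;> field_simp
    · ring
    · linear_combination -hd
    · ring
    · ring
  rw [this, map_mul, map_mul, hunip, hunip, hlow, one_mul, one_mul]

end SL2

theorem sum_comp_monoidHom {T A : Type*} [Group T] [Group A] [Fintype T] [Fintype A] (φ : T →* A)
    (hφ : Function.Surjective φ) {M : Type*} [AddCommMonoid M] (f : A → M) :
    ∑ t, f (φ t) = Nat.card φ.ker • ∑ a, f a := by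
  rw [← Finset.sum_fiberwise' Finset.univ φ f, Finset.smul_sum]
  refine Finset.sum_congr rfl fun a _ => ?_
  rw [Finset.sum_const]
  congr 1
  rw [MonoidHom.card_fiber_eq_of_mem_range φ (hφ a) (hφ 1), Nat.card_eq_fintype_card,
    Fintype.card_subtype]
  simp [MonoidHom.mem_ker]

namespace SL2

variable {F : Type} [Field F]

local notation "S" => Matrix.SpecialLinearGroup (Fin 2) F
local notation "π" => QuotientGroup.mk' (Subgroup.center (Matrix.SpecialLinearGroup (Fin 2) F))

theorem mk_neg (g : S) : π (-g) = π g := by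
  have : π (-1) = 1 := (QuotientGroup.eq_one_iff _).2 neg_one_mem_center
  rw [← neg_one_mul, map_mul, this, one_mul]

theorem mk_eq_one {g : S} (h : π g = 1) : g = 1 ∨ g = -1 :=
  mem_center ((QuotientGroup.eq_one_iff _).1 h)

theorem card_ker (h2 : (2 : F) ≠ 0) (T : Subgroup S) (hT : -1 ∈ T) :
    Nat.card ((π).subgroupMap T).ker = 2 := by
  rw [Nat.card_eq_two_iff]
  refine ⟨1, ⟨⟨-1, hT⟩, ?_⟩, ?_, ?_⟩
  · rw [MonoidHom.mem_ker]
    apply Subtype.ext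
    exact (QuotientGroup.eq_one_iff _).2 neg_one_mem_center
  · intro h
    exact one_ne_neg_one h2 (congrArg Subtype.val (congrArg Subtype.val h))
  · ext ⟨⟨x, hx⟩, hx'⟩
    simp only [Set.mem_insert_iff, Set.mem_singleton_iff, Set.mem_univ, iff_true]
    rcases mk_eq_one (congrArg Subtype.val (MonoidHom.mem_ker.1 hx')) with rfl | rfl
    · exact .inl rfl
    · exact .inr rfl

theorem sum_map_mk [Finite F] (h2 : (2 : F) ≠ 0) (T : Subgroup S) [Fintype T] [Fintype (T.map π)]
    (hT : -1 ∈ T) {M : Type*} [AddCommMonoid M] (f : PSL2 F → M) :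
    ∑ t : T, f (π t) = 2 • ∑ a : T.map π, f a := by
  have h := sum_comp_monoidHom ((π).subgroupMap T) ((π).subgroupMap_surjective T) fun a => f a
  rwa [card_ker h2 T hT] at h

theorem card_map_mk [Finite F] (h2 : (2 : F) ≠ 0) (T : Subgroup S) (hT : -1 ∈ T) :
    Nat.card T = 2 * Nat.card (T.map π) := by
  have := Fintype.ofFinite T
  have := Fintype.ofFinite (T.map π)
  have h := sum_map_mk h2 T hT fun _ => 1
  rw [Nat.card_eq_fintype_card, Nat.card_eq_fintype_card]
  simpa only [Finset.sum_const, Finset.card_univ, smul_eq_mul, mul_one] using h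

theorem sum_mk [Fintype F] (h2 : (2 : F) ≠ 0) {M : Type*} [AddCommMonoid M] (f : PSL2 F → M) :
    ∑ g : S, f (π g) = 2 • ∑ a, f a := by
  have h : Nat.card (π).ker = 2 := by
    rw [QuotientGroup.ker_mk', Nat.card_eq_two_iff]
    refine ⟨1, ⟨-1, neg_one_mem_center⟩, fun h => one_ne_neg_one h2 (congrArg Subtype.val h), ?_⟩
    ext ⟨x, hx⟩
    simp only [Set.mem_insert_iff, Set.mem_singleton_iff, Set.mem_univ, iff_true]
    rcases mem_center hx with rfl | rfl
    · exact .inl rfl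
    · exact .inr rfl
  have h3 := sum_comp_monoidHom π (QuotientGroup.mk'_surjective _) f
  rwa [h] at h3

theorem sum_normSq_comp_mk [Fintype F] (h2 : (2 : F) ≠ 0) {V : Type*} [AddCommGroup V] [Module ℂ V]
    (σ : Representation ℂ (PSL2 F) V) (ρ : Representation ℂ S V) (hρ : ρ = σ.comp π)
    (hσ : ∑ a, ‖σ.character a‖ ^ 2 = Fintype.card (PSL2 F)) :
    ∑ g, ‖ρ.character g‖ ^ 2 = Fintype.card S := by
  have h1 := sum_mk h2 fun a => ‖σ.character a‖ ^ 2
  have h3 := sum_mk h2 fun _ : PSL2 F => (1 : ℝ)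
  rw [hσ] at h1
  simp only [Finset.sum_const, Finset.card_univ, nsmul_eq_mul, mul_one] at h1 h3
  rw [h3, ← h1, hρ]
  rfl

end SL2

namespace SL2

variable {F : Type} [Field F] [Fintype F]

local notation "S" => Matrix.SpecialLinearGroup (Fin 2) F
local notation "π" => QuotientGroup.mk' (Subgroup.center (Matrix.SpecialLinearGroup (Fin 2) F))

theorem character_inv_of_elliptic {V : Type*} [AddCommGroup V] [Module ℂ V] (h2 : (2 : F) ≠ 0)
    (σ : Representation ℂ (PSL2 F) V) {g : S} (hg : IsElliptic g) {h : PSL2 F}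
    (hh : h ∈ Subgroup.zpowers (π g)) :
    σ.character h⁻¹ = σ.character h := by
  obtain ⟨k, rfl⟩ := Subgroup.mem_zpowers_iff.1 hh
  obtain ⟨x, hx⟩ := exists_conj_eq_inv h2 hg.entry_ne_zero hg.tr_sq_ne_four
  have h1 : π x * π g * (π x)⁻¹ = (π g)⁻¹ := by
    rw [← map_inv, ← map_mul, ← map_inv, ← map_mul, hx]
  rw [← inv_zpow, ← h1, conj_zpow, Representation.char_conj]

variable {V : Type*} [AddCommGroup V] [Module ℂ V] [FiniteDimensional ℂ V]

theorem exists_sum_character_of_elliptic (h2 : (2 : F) ≠ 0) (hq : 13 ≤ Fintype.card F)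
    (σ : Representation ℂ (PSL2 F) V) (hdim : Module.finrank ℂ V + 1 = Fintype.card F)
    (hσ : ∑ a, ‖σ.character a‖ ^ 2 = Fintype.card (PSL2 F)) {g : S} (hg : IsElliptic g)
    (H : Subgroup (PSL2 F)) [Fintype H] (hH : H ≤ (Subgroup.centralizer {g}).map π) :
    2 * Nat.card H ∣ Fintype.card F + 1 ∧
      ∃ j : ℕ, j ≤ 2 ∧ ∑ h : H, σ.character (h : PSL2 F) + Nat.card H * j = Fintype.card F + 1 := by
  set A := (Subgroup.centralizer {g}).map π with hA
  have := Fintype.ofFinite A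
  have hcomm : IsMulCommutative (Subgroup.centralizer {g}) :=
    ⟨⟨fun a b => Subtype.ext (commute_of_mem_centralizer hg.entry_ne_zero a.2 b.2)⟩⟩
  have hcommA : IsMulCommutative A := Subgroup.map_isMulCommutative _ _
  have hmem : -1 ∈ Subgroup.centralizer {g} := by
    rw [Subgroup.mem_centralizer_singleton_iff]
    simp
  have hn : 2 * Fintype.card A = Fintype.card F + 1 := by
    rw [← card_centralizer h2 hg, card_map_mk h2 _ hmem, Nat.card_eq_fintype_card]
  have hcardH : Nat.card (H.subgroupOf A) = Nat.card H :=
    Nat.card_congr (Subgroup.subgroupOfEquivOfLe hH).toEquiv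
  refine ⟨?_, ?_⟩
  · rw [← hn, ← hcardH, ← Nat.card_eq_fintype_card]
    exact mul_dvd_mul_left 2 (Subgroup.card_subgroup_dvd_card _)
  · let ρ : Representation ℂ S V := σ.comp π
    have hnorm := sum_normSq_comp_mk h2 σ ρ rfl hσ
    have hneg : ∀ g, ρ (-g) = ρ g := fun g => congrArg σ (mk_neg g)
    have hle := sum_normSq_centralizer_le h2 hq ρ hdim hneg hnorm hg
    have hsum := sum_map_mk h2 _ hmem fun a => ‖σ.character a‖ ^ 2
    rw [nsmul_eq_mul] at hsum
    let τ : Representation ℂ A V := σ.comp A.subtype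
    have hn' : 2 * (Fintype.card A : ℝ) = Fintype.card F + 1 := by exact_mod_cast hn
    obtain ⟨j, hj, h⟩ := exists_sum_restrict_of_normSq_le τ (by omega) (by
      change ∑ a : A, ‖σ.character (a : PSL2 F)‖ ^ 2 ≤ _
      have : ∑ t : Subgroup.centralizer {g}, ‖σ.character (π t)‖ ^ 2 ≤
        2 * ((Fintype.card F : ℝ) - 1) ^ 2 + 2 * ((Fintype.card F : ℝ) - 3) := hle
      rw [hsum] at this
      have hF : (Fintype.card F : ℝ) = 2 * Fintype.card A - 1 := by linarith
      rw [hF] at this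
      push_cast at this
      nlinarith) (H.subgroupOf A)
    refine ⟨j, hj, ?_⟩
    rw [hcardH] at h
    have e : ∑ h : H.subgroupOf A, τ.character (h : A) = ∑ h : H, σ.character (h : PSL2 F) :=
      Fintype.sum_equiv (Subgroup.subgroupOfEquivOfLe hH).toEquiv _ _ fun _ => rfl
    rw [← e, h]
    exact_mod_cast hn

theorem even_of_sum_character (h2 : (2 : F) ≠ 0) (h3 : (3 : F) ≠ 0)
    (σ : Representation ℂ (PSL2 F) V) (hdim : Module.finrank ℂ V + 1 = Fintype.card F)
    (H : Subgroup (PSL2 F)) [Fintype H] (hH : (Nat.card H).Prime) {g : S} (hg : IsElliptic g)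
    (hgH : π g ∈ H) (hg1 : π g ≠ 1) :
    ∃ e : ℕ, Even e ∧ ∑ h : H, σ.character (h : PSL2 F) = Nat.card H * e := by
  have : Fact (Nat.card H).Prime := ⟨hH⟩
  have hodd : Fintype.card F % 2 = 1 := by
    apply FiniteField.odd_card_of_char_ne_two
    intro h
    apply h2
    have := ringChar.Nat.cast_ringChar (R := F)
    rwa [h] at this
  let τ : Representation ℂ H V := σ.comp H.subtype
  have hne : (⟨π g, hgH⟩ : H) ≠ 1 := fun h => hg1 (congrArg Subtype.val h)
  have hcomm : IsMulCommutative H := by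
    have := isCyclic_of_prime_card (α := H) rfl
    exact IsCyclic.isMulCommutative
  have hz : ∀ h : H, (h : PSL2 F) ∈ Subgroup.zpowers (π g) := by
    intro h
    obtain ⟨k, hk⟩ := mem_zpowers_of_prime_card (g' := h) rfl hne
    exact ⟨k, congrArg Subtype.val hk⟩
  rcases hH.eq_two_or_odd' with htwo | ho
  · have hsq : π g * π g = 1 := by
      have := pow_card_eq_one' (x := (⟨π g, hgH⟩ : H))
      rw [htwo, sq] at this
      exact congrArg Subtype.val this
    obtain ⟨k, hk⟩ := exists_trace_eq_of_sq_eq_one (σ (π g))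
      (by rw [← map_mul, hsq, map_one])
      (det_eq_one h2 h3 (σ.comp π) hg.entry_ne_zero)
    have hu : (Finset.univ : Finset H) = {1, ⟨π g, hgH⟩} := by
      symm
      rw [← Finset.card_eq_iff_eq_univ, Finset.card_pair hne.symm, ← Nat.card_eq_fintype_card,
        htwo]
    obtain ⟨e, he⟩ := exists_nat_sum_character τ
    refine ⟨e, ?_, he⟩
    rw [hu, Finset.sum_pair hne.symm, Representation.char_one, htwo] at he
    change _ + LinearMap.trace ℂ V (σ (π g)) = _ at he
    have h4 : 2 * e + 4 * k = 2 * Module.finrank ℂ V := by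
      have : (2 : ℂ) * e + 4 * k = 2 * Module.finrank ℂ V := by
        push_cast at he
        linear_combination hk - he
      exact_mod_cast this
    rw [Nat.even_iff]
    omega
  · obtain ⟨e, k, h1, h4⟩ := exists_sum_character_eq_of_odd τ ho fun h =>
      character_inv_of_elliptic h2 σ hg (hz h)
    exact ⟨e, Nat.even_iff.2 (by omega), h1⟩

end SL2

namespace SL2

variable {F : Type} [Field F] [Fintype F]

local notation "S" => Matrix.SpecialLinearGroup (Fin 2) F
local notation "π" => QuotientGroup.mk' (Subgroup.center (Matrix.SpecialLinearGroup (Fin 2) F))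

variable {V : Type*} [AddCommGroup V] [Module ℂ V] [FiniteDimensional ℂ V]

theorem character_prime_subgroup (h2 : (2 : F) ≠ 0) (h3 : (3 : F) ≠ 0) (hq : 13 ≤ Fintype.card F)
    (σ : Representation ℂ (PSL2 F) V) (hdim : Module.finrank ℂ V + 1 = Fintype.card F)
    (hσ : ∑ a, ‖σ.character a‖ ^ 2 = Fintype.card (PSL2 F))
    (H : Subgroup (PSL2 F)) [Fintype H] (hH : (Nat.card H).Prime) (hHF : (Nat.card H : F) ≠ 0) :
    (2 * Nat.card H ∣ Fintype.card F - 1 ∧ ∀ h ∈ H, h ≠ 1 → σ.character h = 0) ∨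
    (2 * Nat.card H ∣ Fintype.card F + 1 ∧ (∀ h ∈ H, σ.character h⁻¹ = σ.character h) ∧
      ∃ j : ℕ, (j = 0 ∨ j = 2) ∧
        ∑ h : H, σ.character (h : PSL2 F) + Nat.card H * j = Fintype.card F + 1) := by
  have : Fact (Nat.card H).Prime := ⟨hH⟩
  by_cases hex : ∃ g : S, π g ∈ H ∧ π g ≠ 1 ∧ IsElliptic g
  · right
    obtain ⟨g, hgH, hg1, hg⟩ := hex
    have hne : (⟨π g, hgH⟩ : H) ≠ 1 := fun h => hg1 (congrArg Subtype.val h)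
    have hz : H ≤ Subgroup.zpowers (π g) := by
      intro h hh
      obtain ⟨k, hk⟩ := mem_zpowers_of_prime_card (g' := (⟨h, hh⟩ : H)) rfl hne
      exact ⟨k, congrArg Subtype.val hk⟩
    have hle : H ≤ (Subgroup.centralizer {g}).map π := by
      refine hz.trans ((Subgroup.zpowers_le).2 (Subgroup.mem_map_of_mem _ ?_))
      rw [Subgroup.mem_centralizer_singleton_iff]
    obtain ⟨hdvd, j, hj, hsum⟩ := exists_sum_character_of_elliptic h2 hq σ hdim hσ hg H hle
    obtain ⟨e, heven, he⟩ := even_of_sum_character h2 h3 σ hdim H hH hg hgH hg1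
    refine ⟨hdvd, fun h hh => character_inv_of_elliptic h2 σ hg (hz hh), j, ?_, hsum⟩
    obtain ⟨k, hk⟩ := hdvd
    rw [he] at hsum
    have h4 : Nat.card H * (e + j) = Nat.card H * (2 * k) := by
      have : (Nat.card H : ℂ) * e + Nat.card H * j = 2 * Nat.card H * k := by
        rw [hsum]
        exact_mod_cast hk
      rw [mul_add]
      rw [show Nat.card H * (2 * k) = 2 * Nat.card H * k by ring]
      exact_mod_cast this
    have h5 := Nat.eq_of_mul_eq_mul_left hH.pos h4
    obtain ⟨i, rfl⟩ := heven
    omega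
  · left
    have key : ∀ g : S, π g ∈ H → π g ≠ 1 → 2 * Nat.card H ∣ Fintype.card F - 1 ∧
        σ.character (π g) = 0 := by
      intro g hgH hg1
      have hpow : g ^ Nat.card H = 1 ∨ g ^ Nat.card H = -1 := by
        apply mk_eq_one
        have := pow_card_eq_one' (x := (⟨π g, hgH⟩ : H))
        rw [map_pow]
        exact congrArg Subtype.val this
      have ht : tr g ^ 2 ≠ 4 := by
        refine tr_sq_ne_four h2 ?_ ?_ hHF hpow
        · rintro rfl
          exact hg1 (map_one _)
        · rintro rfl
          rw [mk_neg] at hg1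
          exact hg1 (map_one _)
      have hroot : ¬IsElliptic g := fun h => hex ⟨g, hgH, hg1, h⟩
      simp only [IsElliptic, not_forall, not_not] at hroot
      obtain ⟨s, hs⟩ := hroot
      obtain ⟨x, hx⟩ := exists_conj_upper g hs
      have ht' : tr (x * g * x⁻¹) ^ 2 ≠ 4 := by rwa [tr_conj]
      refine ⟨two_mul_dvd_of_upper h2 hx ht' hH ?_, ?_⟩
      · rw [conj_pow]
        rcases hpow with h | h <;> rw [h]
        · left
          simp
        · right
          simp
      · let ρ : Representation ℂ S V := σ.comp π
        have h := character_upper_eq_zero ρ (sum_unip h2 hq ρ hdim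
          (fun g => congrArg σ (mk_neg g)) (sum_normSq_comp_mk h2 σ ρ rfl hσ)).2 hx ht'
        rw [Representation.char_conj] at h
        exact h
    refine ⟨?_, fun h hh h1 => ?_⟩
    · have : Nontrivial H := Finite.one_lt_card_iff_nontrivial.1 hH.one_lt
      obtain ⟨⟨h, hh⟩, hne⟩ := exists_ne (1 : H)
      obtain ⟨g, rfl⟩ := QuotientGroup.mk'_surjective _ h
      exact (key g hh fun h => hne (Subtype.ext h)).1
    · obtain ⟨g, rfl⟩ := QuotientGroup.mk'_surjective _ h
      exact (key g hh h1).2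

end SL2

theorem two_mul_sum_mul_restMult {G : Type} [Group G] [Finite G] (H : Subgroup G)
    (θ : H →* ℂˣ) (hθ : Function.Injective θ) (χ : G → ℂ) (hχ : ∀ h ∈ H, χ h⁻¹ = χ h) :
    2 * ∑ k ∈ Finset.range (Nat.card H), (k : ℂ) * restMult H (θ ^ k) χ =
      Nat.card H * (χ 1 - dimFixed H χ) := by
  have := Fintype.ofFinite H
  have hc : (Nat.card H : ℂ) ≠ 0 := Nat.cast_ne_zero.2 Nat.card_pos.ne'
  have hrest : ∀ φ : H →* ℂˣ, restMult H φ χ =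
      (Nat.card H : ℂ)⁻¹ * ∑ h : H, χ h * ((φ h : ℂ))⁻¹ := by
    intro φ
    unfold restMult
    congr!
  have hdim : dimFixed H χ = restMult H (θ ^ 0) χ := by
    unfold dimFixed restMult
    simp
  have hsymm : ∀ φ : H →* ℂˣ, restMult H φ⁻¹ χ = restMult H φ χ := by
    intro φ
    rw [hrest, hrest]
    congr 1
    refine Fintype.sum_equiv (Equiv.inv H) _ _ fun h => ?_
    simp [hχ h h.2]
  have hone : θ ^ Nat.card H = 1 := by
    ext h
    rw [MonoidHom.pow_apply, ← map_pow, pow_card_eq_one', map_one, MonoidHom.one_apply]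
  have hsum : ∑ k ∈ Finset.range (Nat.card H), restMult H (θ ^ k) χ = χ 1 := by
    simp_rw [hrest]
    rw [← Finset.mul_sum, Finset.sum_comm, Finset.sum_eq_single 1]
    · simp
    · intro h _ h1
      rw [← Finset.mul_sum]
      have hne : ((θ h : ℂ))⁻¹ ≠ 1 := by
        rw [inv_ne_one, ne_eq, Units.val_eq_one, ← map_one θ, hθ.eq_iff]
        exact h1
      have hp : (((θ h : ℂ))⁻¹) ^ Nat.card H = 1 := by
        rw [inv_pow, ← Units.val_pow_eq_pow_val, ← MonoidHom.pow_apply, hone]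
        simp
      have hg := geom_sum_eq hne (Nat.card H)
      rw [hp, sub_self, zero_div] at hg
      simp only [MonoidHom.pow_apply, Units.val_pow_eq_pow_val, ← inv_pow]
      rw [hg, mul_zero]
    · simp
  obtain ⟨n, hn⟩ : ∃ n, Nat.card H = n + 1 := ⟨_, (Nat.succ_pred_eq_of_pos Nat.card_pos).symm⟩
  have hrefl : ∑ k ∈ Finset.range n, ((k + 1 : ℕ) : ℂ) * restMult H (θ ^ (k + 1)) χ =
      ∑ k ∈ Finset.range n, ((n - k : ℕ) : ℂ) * restMult H (θ ^ (k + 1)) χ := by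
    rw [← Finset.sum_range_reflect]
    refine Finset.sum_congr rfl fun k hk => ?_
    have hk' := Finset.mem_range.1 hk
    have hinv : θ ^ (n - k) = (θ ^ (k + 1))⁻¹ := by
      refine MonoidHom.ext fun h => ?_
      rw [MonoidHom.inv_apply]
      refine eq_inv_of_mul_eq_one_left ?_
      rw [← MonoidHom.mul_apply, ← pow_add, show n - k + (k + 1) = Nat.card H by omega, hone,
        MonoidHom.one_apply]
    rw [show n - 1 - k + 1 = n - k by omega, hinv, hsymm]
  rw [hn, Finset.sum_range_succ'] at hsum
  rw [hn, Finset.sum_range_succ', hdim, ← hsum, two_mul]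
  nth_rewrite 2 [hrefl]
  simp only [Nat.cast_zero, zero_mul, add_zero, add_sub_cancel_right]
  rw [← Finset.sum_add_distrib, Finset.mul_sum]
  refine Finset.sum_congr rfl fun k hk => ?_
  rw [← add_mul, ← Nat.cast_add]
  congr 2
  have hk' := Finset.mem_range.1 hk
  omega

theorem exists_sub_dimFixed_eq {F : Type} [Field F] [Fintype F] (h2 : (2 : F) ≠ 0)
    (h3 : (3 : F) ≠ 0) (hq : 13 ≤ Fintype.card F) (χ : PSL2 F → ℂ)
    (hχ : IsIrrCharacter (PSL2 F) χ) (hdeg : χ 1 = Fintype.card F - 1) (H : Subgroup (PSL2 F))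
    (hH : (Nat.card H).Prime) (hHF : (Nat.card H : F) ≠ 0) :
    (∀ h ∈ H, χ h⁻¹ = χ h) ∧ ∃ ε r : ℤ, (ε = 1 ∨ ε = -1) ∧
      (Fintype.card F : ℤ) - ε = 2 * Nat.card H * r ∧
      χ 1 - dimFixed H χ = 2 * (r * (Nat.card H - 1) -
        if (Nat.card H : ℂ) * dimFixed H χ = Fintype.card F + 1 then 1 else 0) := by
  have := Fintype.ofFinite H
  obtain ⟨V, hV, rfl⟩ := hχ
  have hdim : Module.finrank ℂ V + 1 = Fintype.card F := by
    rw [FDRep.char_one] at hdeg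
    have : ((Module.finrank ℂ V + 1 : ℕ) : ℂ) = (Fintype.card F : ℂ) := by
      push_cast
      rw [hdeg]
      ring
    exact_mod_cast this
  have hσ : ∑ a, ‖Representation.character V.ρ a‖ ^ 2 = Fintype.card (PSL2 F) := by
    have hc : (Nat.card (PSL2 F) : ℂ) ≠ 0 := Nat.cast_ne_zero.2 Nat.card_pos.ne'
    have : Invertible (Nat.card (PSL2 F) : ℂ) := invertibleOfNonzero hc
    have h := FDRep.char_orthonormal V V
    rw [if_pos ⟨CategoryTheory.Iso.refl V⟩, inv_mul_eq_one₀ hc,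
      Nat.card_eq_fintype_card] at h
    have h' : ∀ g : PSL2 F, V.character g * V.character g⁻¹ =
        ((‖Representation.character V.ρ g‖ ^ 2 : ℝ) : ℂ) := by
      intro g
      have hi : V.character g⁻¹ = starRingEnd ℂ (V.character g) := character_inv_eq_conj V.ρ g
      rw [hi, Complex.mul_conj, Complex.normSq_eq_norm_sq]
      rfl
    simp_rw [h'] at h
    exact_mod_cast h.symm
  have hc : (Nat.card H : ℂ) ≠ 0 := Nat.cast_ne_zero.2 Nat.card_pos.ne'
  have hfix : (Nat.card H : ℂ) * dimFixed H V.character =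
      ∑ h : H, Representation.character V.ρ (h : PSL2 F) := by
    unfold dimFixed
    rw [mul_inv_cancel_left₀ hc]
    congr!
  have hF1 : 1 ≤ Fintype.card F := by omega
  rcases SL2.character_prime_subgroup h2 h3 hq V.ρ hdim hσ H hH hHF with
    ⟨⟨r, hr⟩, hz⟩ | ⟨⟨r, hr⟩, hinv, j, hj, hsum⟩
  · refine ⟨fun h hh => ?_, 1, r, .inl rfl, ?_, ?_⟩
    · by_cases h1 : h = 1
      · rw [h1, inv_one]
      · exact (hz _ (inv_mem hh) (inv_ne_one.2 h1)).trans (hz _ hh h1).symm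
    · rw [← Nat.cast_one, ← Nat.cast_sub hF1, hr]
      push_cast
      ring
    · have hr' : (Fintype.card F : ℂ) - 1 = 2 * Nat.card H * r := by
        rw [← Nat.cast_one, ← Nat.cast_sub hF1, hr]
        push_cast
        ring
      have hs : ∑ h : H, Representation.character V.ρ (h : PSL2 F) = Fintype.card F - 1 := by
        rw [Finset.sum_eq_single 1, ← hdeg]
        · rfl
        · exact fun h _ h1 => hz _ h.2 fun h' => h1 (Subtype.ext h')
        · simp
      rw [hs] at hfix
      have hd : dimFixed H V.character = 2 * r := by
        apply mul_left_cancel₀ hc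
        rw [hfix, hr']
        ring
      rw [if_neg, hd, hdeg, hr']
      · push_cast
        ring
      · rw [hfix]
        intro h
        have : (2 : ℂ) = 0 := by linear_combination -h
        norm_num at this
  · refine ⟨hinv, -1, r, .inr rfl, ?_, ?_⟩
    · rw [sub_neg_eq_add]
      exact_mod_cast hr
    · have hr' : (Fintype.card F : ℂ) + 1 = 2 * Nat.card H * r := by exact_mod_cast hr
      rw [← hfix, hr'] at hsum
      have hd : dimFixed H V.character = 2 * r - j := by
        apply mul_left_cancel₀ hc
        linear_combination hsum
      have hdeg' : V.character 1 = 2 * Nat.card H * r - 2 := by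
        rw [hdeg, ← hr']
        ring
      rcases hj with rfl | rfl
      · rw [if_pos, hd, hdeg']
        · push_cast
          ring
        · rw [hr', ← hsum]
          simp
      · rw [if_neg, hd, hdeg']
        · push_cast
          ring
        · rw [hr', ← hsum]
          simp

theorem natCast_ne_zero_of_coprime_card {F : Type*} [Field F] [Fintype F] {n : ℕ}
    (h : Nat.Coprime (Fintype.card F) n) : (n : F) ≠ 0 := by
  intro hn
  have hp := CharP.char_is_prime F (ringChar F)
  have h1 := Nat.dvd_gcd ((CharP.cast_eq_zero_iff F (ringChar F) _).1 (Nat.cast_card_eq_zero F))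
    ((CharP.cast_eq_zero_iff F (ringChar F) n).1 hn)
  rw [h] at h1
  exact hp.one_lt.ne' (Nat.dvd_one.1 h1)

theorem thirteen_le_of_coprime {q : ℕ} (h1 : 1 < q) (h42 : Nat.Coprime q 42)
    (h7 : q % 7 = 1 ∨ q % 7 = 6) : 13 ≤ q := by
  by_contra! h
  interval_cases q <;> simp at h7 <;> norm_num at h42

theorem baseMult_eq {q : ℕ} {ε₂ ε₃ ε₇ r₂ r₃ r₇ : ℤ} (hε₂ : ε₂ = 1 ∨ ε₂ = -1)
    (hε₃ : ε₃ = 1 ∨ ε₃ = -1) (hε₇ : ε₇ = 1 ∨ ε₇ = -1) (h₂ : q - ε₂ = 4 * r₂)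
    (h₃ : q - ε₃ = 6 * r₃) (h₇ : q - ε₇ = 14 * r₇) :
    baseMult q = r₂ + 2 * r₃ + 6 * r₇ := by
  have e₂ : (if q % 4 = 1 then 1 else -1) = ε₂ := by
    clear h₃ h₇
    rcases hε₂ with rfl | rfl
    · exact if_pos (by omega)
    · exact if_neg (by omega)
  have e₃ : (if q % 3 = 1 then 1 else -1) = ε₃ := by
    clear h₂ h₇
    rcases hε₃ with rfl | rfl
    · exact if_pos (by omega)
    · exact if_neg (by omega)
  have e₇ : (if q % 7 = 1 then 1 else -1) = ε₇ := by
    clear h₂ h₃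
    rcases hε₇ with rfl | rfl
    · exact if_pos (by omega)
    · exact if_neg (by omega)
  rw [baseMult, e₂, e₃, e₇, h₂, h₃, h₇]
  omega

theorem ramification_module_discrete_series
    (q : ℕ) (hq : IsPrimePow q) (hgcd : Nat.Coprime q 42)
    (hq7 : q % 7 = 1 ∨ q % 7 = 6)
    (F : Type) [Field F] [Fintype F] (hF : Fintype.card F = q)
    (H2 H3 H7 : Subgroup (PSL2 F))
    (hH2 : Nat.card H2 = 2) (hH3 : Nat.card H3 = 3) (hH7 : Nat.card H7 = 7)
    (θ2 : H2 →* ℂˣ) (θ3 : H3 →* ℂˣ) (θ7 : H7 →* ℂˣ)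
    (hθ2 : Function.Injective θ2) (hθ3 : Function.Injective θ3)
    (hθ7 : Function.Injective θ7)
    (χ : PSL2 F → ℂ) (hχ : IsIrrCharacter (PSL2 F) χ) (hdeg : χ 1 = (q : ℂ) - 1)
    :
    ramMult H2 H3 H7 θ2 θ3 θ7 χ = (baseMult q : ℂ) -
      ((if (2 : ℂ) * dimFixed H2 χ = (q : ℂ) + 1 then 1 else 0)
        + (if (3 : ℂ) * dimFixed H3 χ = (q : ℂ) + 1 then 1 else 0)
        + (if (7 : ℂ) * dimFixed H7 χ = (q : ℂ) + 1 then 1 else 0)) := by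
  subst hF
  have h42 : ∀ ℓ, ℓ ∣ 42 → ((ℓ : ℕ) : F) ≠ 0 := fun ℓ hℓ =>
    natCast_ne_zero_of_coprime_card (hgcd.coprime_dvd_right hℓ)
  have h2 : (2 : F) ≠ 0 := by exact_mod_cast h42 2 (by norm_num)
  have h3 : (3 : F) ≠ 0 := by exact_mod_cast h42 3 (by norm_num)
  have hq13 : 13 ≤ Fintype.card F := thirteen_le_of_coprime hq.one_lt hgcd hq7
  obtain ⟨hi2, ε₂, r₂, hε₂, hr₂, hd₂⟩ := exists_sub_dimFixed_eq h2 h3 hq13 χ hχ hdeg H2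
    (by rw [hH2]; norm_num) (by rw [hH2]; exact h42 2 (by norm_num))
  obtain ⟨hi3, ε₃, r₃, hε₃, hr₃, hd₃⟩ := exists_sub_dimFixed_eq h2 h3 hq13 χ hχ hdeg H3
    (by rw [hH3]; norm_num) (by rw [hH3]; exact h42 3 (by norm_num))
  obtain ⟨hi7, ε₇, r₇, hε₇, hr₇, hd₇⟩ := exists_sub_dimFixed_eq h2 h3 hq13 χ hχ hdeg H7
    (by rw [hH7]; norm_num) (by rw [hH7]; exact h42 7 (by norm_num))
  have hs₂ := two_mul_sum_mul_restMult H2 θ2 hθ2 χ hi2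
  have hs₃ := two_mul_sum_mul_restMult H3 θ3 hθ3 χ hi3
  have hs₇ := two_mul_sum_mul_restMult H7 θ7 hθ7 χ hi7
  rw [hd₂, hH2] at hs₂
  rw [hd₃, hH3] at hs₃
  rw [hd₇, hH7] at hs₇
  rw [hH2] at hr₂
  rw [hH3] at hr₃
  rw [hH7] at hr₇
  have hm : baseMult (Fintype.card F) = r₂ + 2 * r₃ + 6 * r₇ :=
    baseMult_eq hε₂ hε₃ hε₇ (by push_cast at hr₂; linarith) (by push_cast at hr₃; linarith)
      (by push_cast at hr₇; linarith)
  simp only [Finset.sum_range_succ, Finset.sum_range_zero] at hs₂ hs₃ hs₇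
  push_cast at hs₂ hs₃ hs₇
  rw [(MonoidHom.ext fun h => pow_one (θ2 h) : θ2 ^ 1 = θ2)] at hs₂
  rw [(MonoidHom.ext fun h => pow_one (θ3 h) : θ3 ^ 1 = θ3)] at hs₃
  have hIcc : Finset.Icc 1 6 = {1, 2, 3, 4, 5, 6} := rfl
  rw [hm, ramMult, hIcc]
  simp only [Finset.sum_insert, Finset.sum_singleton, Finset.mem_insert, Finset.mem_singleton,
    Nat.reduceEqDiff, or_self, not_false_eq_true]
  push_cast
  linear_combination hs₂ / 4 + hs₃ / 6 + hs₇ / 14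
end

section
/- For every automorphism σ of the field ℂ and every irreducible complex character χ of G, the function σ∘χ is again an irreducible character of G and Γ(σ∘χ) = Γ(χ); that is, the ramification module Γ̃_G is invariant under the Galois action on irreducible representations of G. -/
open scoped BigOperators Classical

/-- Applying a field automorphism `σ` to matrix entries twists a representation `V`, and its
character, by `σ`. -/
theorem exists_character_twist {G : Type} [Group G] (V : FDRep ℂ G) (σ : ℂ ≃+* ℂ) :
    ∃ W : FDRep ℂ G, W.character = fun g => σ (V.character g) := by
  let b := Module.finBasis ℂ V
  let n := Module.finrank ℂ V
  let ρ : Representation ℂ G (Fin n → ℂ) :=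
    (Matrix.toLinAlgEquiv' : Matrix (Fin n) (Fin n) ℂ ≃ₐ[ℂ] _).toMonoidHom.comp
      ((σ : ℂ →+* ℂ).mapMatrix.toMonoidHom.comp
        ((LinearMap.toMatrixAlgEquiv b).toMonoidHom.comp V.ρ))
  refine ⟨FDRep.of ρ, ?_⟩
  funext g
  change LinearMap.trace ℂ (Fin n → ℂ)
    (Matrix.toLin' ((σ : ℂ →+* ℂ).mapMatrix (LinearMap.toMatrix b b (V.ρ g)))) =
      σ (LinearMap.trace ℂ V (V.ρ g))
  rw [Matrix.trace_toLin'_eq, LinearMap.trace_eq_matrix_trace ℂ b]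
  exact (AddMonoidHom.map_trace (σ : ℂ →+* ℂ) _).symm

theorem IsIrrCharacter.map_ringEquiv {G : Type} [Group G] [Finite G] {χ : G → ℂ}
    (hχ : IsIrrCharacter G χ) (σ : ℂ ≃+* ℂ) : IsIrrCharacter G (fun g => σ (χ g)) := by
  let _ : Fintype G := Fintype.ofFinite G
  obtain ⟨V, hV, rfl⟩ := hχ
  obtain ⟨W, hW⟩ := exists_character_twist V σ
  refine ⟨W, ?_, hW⟩
  rw [FDRep.simple_iff_char_is_norm_one] at hV ⊢
  simpa [hW] using congrArg σ hV

theorem exists_dimFixed_eq_natCast {G : Type} [Group G] [Finite G] (V : FDRep ℂ G)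
    (H : Subgroup G) : ∃ d : ℕ, dimFixed H V.character = d := by
  let _ : Fintype H := Fintype.ofFinite H
  let _ : Invertible (Nat.card H : ℂ) := invertibleOfNonzero (by simp)
  exact ⟨_, Representation.card_inv_mul_sum_char_eq_finrank (V.ρ.comp H.subtype)⟩

theorem dimFixed_map_ringEquiv {G : Type} [Group G] [Finite G] (H : Subgroup G)
    (σ : ℂ ≃+* ℂ) (χ : G → ℂ) :
    dimFixed H (fun g => σ (χ g)) = σ (dimFixed H χ) := by
  simp [dimFixed]

section Multiplicities

variable {G : Type} [Group G] [Finite G] {H : Subgroup G} {χ : G → ℂ}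

theorem restMult_inv (θ : H →* ℂˣ) (hχ : ∀ h : H, χ (h : G)⁻¹ = χ h) :
    restMult H θ⁻¹ χ = restMult H θ χ := by
  let _ : Fintype H := Fintype.ofFinite H
  simp only [restMult]
  congr 1
  refine Fintype.sum_equiv (Equiv.inv H) _ _ fun h => ?_
  simp [hχ]

theorem restMult_one : restMult H 1 χ = dimFixed H χ := by
  simp [restMult, dimFixed]

omit [Finite G] in
theorem monoidHom_pow_card_eq_one {θ : H →* ℂˣ} : θ ^ Nat.card H = 1 := by
  ext h
  simp [← map_pow]

theorem sum_restMult_pow {θ : H →* ℂˣ} (hθ : Function.Injective θ) :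
    ∑ k ∈ Finset.range (Nat.card H), restMult H (θ ^ k) χ = χ 1 := by
  let _ : Fintype H := Fintype.ofFinite H
  have hcard : (Nat.card H : ℂ) ≠ 0 := by simp
  have key (h : H) : ∑ k ∈ Finset.range (Nat.card H), χ h * (((θ ^ k) h : ℂˣ) : ℂ)⁻¹ =
      if h = 1 then Nat.card H * χ 1 else 0 := by
    rw [← Finset.mul_sum]
    split_ifs with hh
    · simp [hh, mul_comm]
    · have h1 : ((θ h : ℂˣ) : ℂ)⁻¹ ≠ 1 := by
        rw [Ne, inv_eq_one, Units.val_eq_one]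
        exact fun e => hh (hθ (e.trans (map_one θ).symm))
      have h2 : (((θ h : ℂˣ) : ℂ)⁻¹) ^ Nat.card H = 1 := by
        rw [inv_pow, ← Units.val_pow_eq_pow_val, ← map_pow, pow_card_eq_one']
        simp
      have h3 : ∑ k ∈ Finset.range (Nat.card H), (((θ h : ℂˣ) : ℂ)⁻¹) ^ k = 0 := by
        rw [geom_sum_eq h1, h2, sub_self, zero_div]
      simp only [MonoidHom.pow_apply, Units.val_pow_eq_pow_val, ← inv_pow, h3, mul_zero]
  simp only [restMult]
  rw [← Finset.mul_sum, Finset.sum_comm]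
  simp only [key]
  simp

/-- If `χ` takes equal values at inverse elements of `H`, the multiplicities of `θ ^ k` and
`θ ^ (|H| - k)` agree, and the weighted sum of multiplicities collapses. -/
theorem sum_mul_restMult_pow {θ : H →* ℂˣ} (hθ : Function.Injective θ)
    (hχ : ∀ h : H, χ (h : G)⁻¹ = χ h) :
    2 * ∑ k ∈ Finset.range (Nat.card H), (k : ℂ) * restMult H (θ ^ k) χ =
      Nat.card H * (χ 1 - dimFixed H χ) := by
  set n := Nat.card H with hn
  have hlast : restMult H (θ ^ n) χ = dimFixed H χ := by rw [hn, monoidHom_pow_card_eq_one, restMult_one]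
  have hsum := sum_restMult_pow (χ := χ) hθ
  have hflip := Finset.sum_flip (n := n) fun k => (k : ℂ) * restMult H (θ ^ k) χ
  have hsymm : ∑ k ∈ Finset.range (n + 1), ((n - k : ℕ) : ℂ) * restMult H (θ ^ (n - k)) χ =
      ∑ k ∈ Finset.range (n + 1), (n * restMult H (θ ^ k) χ - k * restMult H (θ ^ k) χ) := by
    refine Finset.sum_congr rfl fun k hk => ?_
    have hkn : k ≤ n := Nat.lt_succ_iff.mp (Finset.mem_range.mp hk)
    have hpow : θ ^ (n - k) = (θ ^ k)⁻¹ := by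
      have h := pow_add θ (n - k) k
      rw [Nat.sub_add_cancel hkn] at h
      exact eq_inv_of_mul_eq_one_left (a := θ ^ (n - k)) (h.symm.trans monoidHom_pow_card_eq_one)
    rw [hpow, restMult_inv _ hχ, Nat.cast_sub hkn, sub_mul]
  rw [hsymm, Finset.sum_sub_distrib, ← Finset.mul_sum, Finset.sum_range_succ,
    Finset.sum_range_succ, hlast, hsum] at hflip
  linear_combination -hflip

end Multiplicities

theorem ramMult_eq_of_real {G : Type} [Group G] [Finite G] {H2 H3 H7 : Subgroup G}
    (hH2 : Nat.card H2 = 2) (hH3 : Nat.card H3 = 3) (hH7 : Nat.card H7 = 7)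
    {θ2 : H2 →* ℂˣ} {θ3 : H3 →* ℂˣ} {θ7 : H7 →* ℂˣ}
    (hθ2 : Function.Injective θ2) (hθ3 : Function.Injective θ3)
    (hθ7 : Function.Injective θ7) {χ : G → ℂ}
    (hχ : ∀ g : G, g ^ 42 = 1 → χ g⁻¹ = χ g) :
    ramMult H2 H3 H7 θ2 θ3 θ7 χ =
      (3 * χ 1 - dimFixed H2 χ - dimFixed H3 χ - dimFixed H7 χ) / 2 := by
  have hreal (H : Subgroup G) (hH : Nat.card H ∣ 42) (h : H) : χ (h : G)⁻¹ = χ h :=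
    hχ _ (by rw [← H.coe_pow, orderOf_dvd_iff_pow_eq_one.mp ((orderOf_dvd_natCard h).trans hH)]; rfl)
  have h2 := sum_mul_restMult_pow hθ2 (hreal H2 (by simp [hH2]))
  have h3 := sum_mul_restMult_pow hθ3 (hreal H3 (by norm_num [hH3]))
  have h7 := sum_mul_restMult_pow hθ7 (hreal H7 (by norm_num [hH7]))
  have hIcc : Finset.Icc 1 6 = (Finset.range 7).erase 0 := by decide
  rw [hH2] at h2
  rw [hH3] at h3
  rw [hH7, ← Finset.sum_erase (a := 0) _ (by simp), ← hIcc] at h7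
  simp only [Finset.sum_range_succ, Finset.sum_range_zero] at h2 h3
  push_cast at h2 h3 h7
  rw [ramMult]
  rw [show θ2 ^ 1 = θ2 from pow_one θ2] at h2
  rw [show θ3 ^ 1 = θ3 from pow_one θ3] at h3
  linear_combination h2 / 4 + h3 / 6 + h7 / 14

section Real

variable {F : Type} [Field F]

/-- A nondegenerate binary quadratic form `u ^ 2 - D * z ^ 2` over a finite field of odd
characteristic represents every element. -/
theorem exists_sq_sub_mul_sq_eq [Fintype F] (h2 : (2 : F) ≠ 0) {D : F} (hD : D ≠ 0) (e : F) :
    ∃ u z : F, u ^ 2 - D * z ^ 2 = e := by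
  have hodd : Fintype.card F % 2 = 1 :=
    FiniteField.odd_card_of_char_ne_two fun h => h2 (by
      have := CharP.cast_eq_zero F (ringChar F)
      rw [h] at this
      exact_mod_cast this)
  obtain ⟨u, z, h⟩ := FiniteField.exists_root_sum_quadratic
    (f := Polynomial.X ^ 2) (g := Polynomial.C (-D) * Polynomial.X ^ 2 + Polynomial.C 0 *
      Polynomial.X + Polynomial.C (-e)) (Polynomial.degree_X_pow 2)
    (Polynomial.degree_quadratic (neg_ne_zero.mpr hD)) hodd
  refine ⟨u, z, ?_⟩
  simp at h
  linear_combination h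

/-- A traceless matrix `!![x, y; z, -x]` of determinant one that is trace-orthogonal to a given
matrix `!![a, b; c, d]` with distinct eigenvalues. -/
theorem exists_traceless_det_one [Fintype F] (h2 : (2 : F) ≠ 0) {a b c d : F}
    (hD : (a - d) ^ 2 + 4 * b * c ≠ 0) :
    ∃ x y z : F, (a - d) * x + b * z + c * y = 0 ∧ -x ^ 2 - y * z = 1 := by
  have aux {b c : F} (hD : (a - d) ^ 2 + 4 * b * c ≠ 0) (hc : c ≠ 0) :
      ∃ x y z : F, (a - d) * x + b * z + c * y = 0 ∧ -x ^ 2 - y * z = 1 := by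
    obtain ⟨u, z, h⟩ := exists_sq_sub_mul_sq_eq h2 hD (-4 * c ^ 2)
    obtain ⟨x, hx⟩ : ∃ x, 2 * c * x = u + (a - d) * z :=
      ⟨(u + (a - d) * z) / (2 * c), by field_simp⟩
    obtain ⟨y, hy⟩ : ∃ y, c * y = -((a - d) * x + b * z) :=
      ⟨-((a - d) * x + b * z) / c, by field_simp⟩
    refine ⟨x, y, z, by linear_combination hy, ?_⟩
    have h4 : (2 * 2 * c ^ 2 : F) ≠ 0 := by simp [h2, hc]
    apply mul_left_cancel₀ h4
    have hu : u = 2 * c * x - (a - d) * z := by linear_combination -hx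
    rw [hu] at h
    linear_combination -h - 4 * c * z * hy
  by_cases hc : c = 0
  · by_cases hb : b = 0
    · exact ⟨0, 1, -1, by simp [hb, hc], by simp⟩
    · obtain ⟨x, y, z, h, h'⟩ := aux (b := c) (c := b) (by convert hD using 1; ring) hb
      exact ⟨x, z, y, by linear_combination h, by linear_combination h'⟩
  · exact aux hD hc

open Matrix in
/-- An element of `SL(2, F)` with distinct eigenvalues is conjugate to its inverse. -/
theorem exists_conj_eq_inv_of_trace_sq_ne [Fintype F] (h2 : (2 : F) ≠ 0)
    {A : SpecialLinearGroup (Fin 2) F} (hA : (A : Matrix (Fin 2) (Fin 2) F).trace ^ 2 ≠ 4) :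
    ∃ B : SpecialLinearGroup (Fin 2) F, B * A * B⁻¹ = A⁻¹ := by
  have hdet := A.det_coe
  rw [det_fin_two] at hdet
  rw [trace_fin_two] at hA
  obtain ⟨x, y, z, h, h'⟩ := exists_traceless_det_one h2
    (a := A.1 0 0) (b := A.1 0 1) (c := A.1 1 0) (d := A.1 1 1)
    (fun h => hA (by linear_combination h + 4 * hdet))
  have hB : (!![x, y; z, -x]).det = 1 := by rw [det_fin_two_of]; linear_combination h'
  obtain ⟨B, hBe⟩ : ∃ B : SpecialLinearGroup (Fin 2) F, B.1 = !![x, y; z, -x] := ⟨⟨_, hB⟩, rfl⟩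
  refine ⟨B, ?_⟩
  rw [mul_inv_eq_iff_eq_mul]
  apply Subtype.ext
  change B.1 * A.1 = adjugate A.1 * B.1
  rw [adjugate_fin_two, hBe, eta_fin_two A.1]
  ext i j
  fin_cases i <;> fin_cases j <;> simp [mul_apply, Fin.sum_univ_two]
  · linear_combination h
  · ring
  · ring
  · linear_combination h

open Matrix in
/-- An element of `SL(2, F)` with equal eigenvalues whose image in `PSL(2, F)` has order
prime to the characteristic is central. -/
theorem mem_center_of_trace_sq_eq (h2 : (2 : F) ≠ 0) {n : ℕ} (hn : (n : F) ≠ 0)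
    {A : SpecialLinearGroup (Fin 2) F} (hA : (A : Matrix (Fin 2) (Fin 2) F).trace ^ 2 = 4)
    (hpow : A ^ n ∈ Subgroup.center (SpecialLinearGroup (Fin 2) F)) :
    A ∈ Subgroup.center (SpecialLinearGroup (Fin 2) F) := by
  have hdet := A.det_coe
  rw [det_fin_two] at hdet
  rw [trace_fin_two] at hA
  obtain ⟨e, he⟩ : ∃ e, 2 * e = A.1 0 0 + A.1 1 1 :=
    ⟨(A.1 0 0 + A.1 1 1) / 2, by field_simp⟩
  have he2 : e ^ 2 = 1 := by
    apply mul_left_cancel₀ (mul_ne_zero h2 h2)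
    rw [← he] at hA
    linear_combination hA
  have he0 : e ≠ 0 := by rintro rfl; simp at he2
  set N : Matrix (Fin 2) (Fin 2) F := A.1 - scalar (Fin 2) e with hN
  have hNN : N * N = 0 := by
    rw [hN, eta_fin_two A.1]
    ext i j
    fin_cases i <;> fin_cases j <;> simp [mul_apply, Fin.sum_univ_two]
    · linear_combination (-A.1 0 0) * he - hdet + he2
    · linear_combination (-A.1 0 1) * he
    · linear_combination (-A.1 1 0) * he
    · linear_combination (-A.1 1 1) * he - hdet + he2
  have hApow (m : ℕ) : A.1 ^ (m + 1) = scalar (Fin 2) (e ^ (m + 1)) + ((m + 1 : ℕ) * e ^ m) • N := by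
    induction m with
    | zero => simp [hN]
    | succ m ih =>
      have hA' : A.1 = e • (1 : Matrix (Fin 2) (Fin 2) F) + N := by
        rw [hN, smul_one_eq_diagonal]; simp
      rw [pow_succ, ih, hA']
      simp only [scalar_apply, ← smul_one_eq_diagonal, mul_add, add_mul, smul_mul_assoc,
        mul_smul_comm, hNN, one_mul, mul_one, smul_zero, add_zero]
      push_cast
      module
  obtain ⟨m, rfl⟩ : ∃ m, n = m + 1 :=
    Nat.exists_eq_succ_of_ne_zero (by rintro rfl; simp at hn)
  obtain ⟨r, -, hr⟩ := Matrix.SpecialLinearGroup.mem_center_iff.mp hpow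
  replace hr := (hr.trans (Matrix.SpecialLinearGroup.coe_pow A (m + 1))).trans (hApow m)
  have hc : ((m + 1 : ℕ) * e ^ m : F) ≠ 0 := mul_ne_zero hn (pow_ne_zero _ he0)
  have h01 : A.1 0 1 = 0 := by
    have := (congrFun₂ hr 0 1).symm
    simpa [hN, hc, -Nat.cast_add] using this
  have h10 : A.1 1 0 = 0 := by
    have := (congrFun₂ hr 1 0).symm
    simpa [hN, hc, -Nat.cast_add] using this
  have hd : A.1 0 0 = A.1 1 1 := by
    have : (A.1 0 0 - A.1 1 1) ^ 2 = 0 := by linear_combination hA - 4 * hdet - 4 * A.1 0 1 * h10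
    exact sub_eq_zero.mp (pow_eq_zero_iff two_ne_zero |>.mp this)
  refine Matrix.SpecialLinearGroup.mem_center_iff.mpr ⟨A.1 0 0, ?_, ?_⟩
  · rw [Fintype.card_fin]
    linear_combination hdet + A.1 0 0 * hd + A.1 0 1 * h10
  · ext i j
    fin_cases i <;> fin_cases j <;> simp [h01, h10, hd]

/-- An element of `PSL(2, F)` of order prime to the characteristic is conjugate to its
inverse. -/
theorem PSL2.exists_conj_eq_inv [Fintype F] (h2 : (2 : F) ≠ 0) {n : ℕ} (hn : (n : F) ≠ 0)
    {g : PSL2 F} (hg : g ^ n = 1) : ∃ h : PSL2 F, h * g * h⁻¹ = g⁻¹ := by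
  obtain ⟨A, rfl⟩ := QuotientGroup.mk_surjective g
  by_cases hA : (A : Matrix (Fin 2) (Fin 2) F).trace ^ 2 = 4
  · have hpow := (QuotientGroup.eq_one_iff (A ^ n)).mp hg
    exact ⟨1, by simp [(QuotientGroup.eq_one_iff A).mpr (mem_center_of_trace_sq_eq h2 hn hA hpow)]⟩
  · obtain ⟨B, hB⟩ := exists_conj_eq_inv_of_trace_sq_ne h2 hA
    exact ⟨B, congrArg QuotientGroup.mk hB⟩

end Real

theorem ramification_module_galois_invariant
    (q : ℕ) (hq : IsPrimePow q) (hgcd : Nat.Coprime q 42)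
    (hq7 : q % 7 = 1 ∨ q % 7 = 6)
    (F : Type) [Field F] [Fintype F] (hF : Fintype.card F = q)
    (H2 H3 H7 : Subgroup (PSL2 F))
    (hH2 : Nat.card H2 = 2) (hH3 : Nat.card H3 = 3) (hH7 : Nat.card H7 = 7)
    (θ2 : H2 →* ℂˣ) (θ3 : H3 →* ℂˣ) (θ7 : H7 →* ℂˣ)
    (hθ2 : Function.Injective θ2) (hθ3 : Function.Injective θ3)
    (hθ7 : Function.Injective θ7)
    (σ : ℂ ≃+* ℂ) (χ : PSL2 F → ℂ) (hχ : IsIrrCharacter (PSL2 F) χ)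
    :
    IsIrrCharacter (PSL2 F) (fun g => σ (χ g)) ∧
    ramMult H2 H3 H7 θ2 θ3 θ7 (fun g => σ (χ g)) = ramMult H2 H3 H7 θ2 θ3 θ7 χ := by
  have h42 : ((42 : ℕ) : F) ≠ 0 := by
    intro h
    obtain ⟨u, v, huv⟩ := Nat.isCoprime_iff_coprime.mpr hgcd
    have := congrArg (Int.cast : ℤ → F) huv
    push_cast at this h
    rw [h, ← hF, Nat.cast_card_eq_zero] at this
    simp at this
  have h2 : (2 : F) ≠ 0 := fun h => h42 (by linear_combination 21 * h)
  have hreal {ψ : PSL2 F → ℂ} (hψ : IsIrrCharacter (PSL2 F) ψ) (g : PSL2 F) (hg : g ^ 42 = 1) :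
      ψ g⁻¹ = ψ g := by
    obtain ⟨V, -, rfl⟩ := hψ
    obtain ⟨h, hh⟩ := PSL2.exists_conj_eq_inv h2 h42 hg
    rw [← hh, V.char_conj]
  have hσ := hχ.map_ringEquiv σ
  refine ⟨hσ, ?_⟩
  rw [ramMult_eq_of_real hH2 hH3 hH7 hθ2 hθ3 hθ7 (hreal hσ),
    ramMult_eq_of_real hH2 hH3 hH7 hθ2 hθ3 hθ7 (hreal hχ)]
  simp only [dimFixed_map_ringEquiv]
  obtain ⟨V, -, rfl⟩ := hχ
  obtain ⟨d2, e2⟩ := exists_dimFixed_eq_natCast V H2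
  obtain ⟨d3, e3⟩ := exists_dimFixed_eq_natCast V H3
  obtain ⟨d7, e7⟩ := exists_dimFixed_eq_natCast V H7
  simp [e2, e3, e7, V.char_one]
end

section
/- Every element of G of order 3 and every element of G of order 7 is conjugate in G to its inverse. -/
open scoped BigOperators Classical

/-- A root `M` of `(X - s)²` with `s² = 1` has powers that are affine in `M`. -/
theorem pow_succ_eq_of_sq_eq {F : Type*} [Field F] {R : Type*} [Ring R] [Algebra F R]
    {M : R} {s : F} (hs : s ^ 2 = 1) (hM : M * M = (2 * s) • M - 1) (n : ℕ) :
    M ^ (n + 1) = (((n : F) + 1) * s ^ n) • M - ((n : F) * s ^ (n + 1)) • 1 := by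
  induction n with
  | zero => simp
  | succ n ih =>
    rw [pow_succ, ih, sub_mul, smul_mul_assoc, hM, smul_mul_assoc, one_mul]
    have h : s ^ (n + 2) = s ^ n := by rw [pow_add, hs, mul_one]
    push_cast
    rw [show n + 1 + 1 = n + 2 from rfl, h]
    module

/-- A natural number coprime to the order of a finite field is nonzero in it. -/
theorem natCast_ne_zero_of_card_coprime {F : Type*} [Field F] [Fintype F] {n : ℕ}
    (h : (Fintype.card F).Coprime n) : (n : F) ≠ 0 := by
  intro hn
  obtain ⟨u, v, huv⟩ := Nat.isCoprime_iff_coprime.2 h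
  have := congrArg (Int.cast : ℤ → F) huv
  simp [hn] at this

/-- In `SL(2, F)`, `F` finite of odd characteristic, an element whose characteristic polynomial
is separable is conjugate to its inverse. -/
theorem Matrix.SpecialLinearGroup.isConj_inv_of_trace_sq_ne_four {F : Type*} [Field F] [Finite F]
    (h2 : (2 : F) ≠ 0) (A : Matrix.SpecialLinearGroup (Fin 2) F)
    (hA : A.1.trace ^ 2 ≠ 4) : IsConj A A⁻¹ := by
  have := Fintype.ofFinite F
  have hdet : A.1 0 0 * A.1 1 1 - A.1 0 1 * A.1 1 0 = 1 := by
    rw [← Matrix.det_fin_two]; exact A.2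
  rw [Matrix.trace_fin_two] at hA
  -- a traceless `X` of determinant one with `tr (X A) = 0` conjugates `A` to its adjugate
  suffices h : ∃ x y z : F, x * (A.1 0 0 - A.1 1 1) + y * A.1 1 0 + z * A.1 0 1 = 0 ∧
      -x ^ 2 - y * z = 1 by
    obtain ⟨x, y, z, h, hd⟩ := h
    obtain ⟨X, hX⟩ : ∃ X : Matrix.SpecialLinearGroup (Fin 2) F, X.1 = !![x, y; z, -x] :=
      ⟨⟨_, by rw [Matrix.det_fin_two_of]; linear_combination hd⟩, rfl⟩
    refine isConj_iff.2 ⟨X, mul_inv_eq_iff_eq_mul.2 (Subtype.ext ?_)⟩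
    rw [Matrix.SpecialLinearGroup.coe_mul, Matrix.SpecialLinearGroup.coe_mul,
      Matrix.SpecialLinearGroup.coe_inv, Matrix.adjugate_fin_two, hX]
    ext i j
    fin_cases i <;> fin_cases j <;> simp [Matrix.mul_apply, Fin.sum_univ_two]
    · linear_combination h
    · ring
    · ring
    · linear_combination h
  generalize A.1 0 0 = a at *
  generalize A.1 0 1 = b at *
  generalize A.1 1 0 = c at *
  generalize A.1 1 1 = d at *
  have hD : (a - d) ^ 2 + 4 * b * c ≠ 0 := fun h ↦ hA (by linear_combination h + 4 * hdet)
  by_cases hc : c = 0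
  · subst hc
    have had : a - d ≠ 0 := fun h ↦ hD (by rw [h]; ring)
    refine ⟨b, (1 + b ^ 2) / (a - d), d - a, by ring, ?_⟩
    field_simp
    ring
  · have hk : ((a - d) ^ 2 + 4 * b * c) / (4 * c ^ 2) ≠ 0 :=
      div_ne_zero hD (mul_ne_zero (by rw [show (4 : F) = 2 * 2 by norm_num]; exact mul_ne_zero h2 h2)
        (pow_ne_zero _ hc))
    generalize hkd : ((a - d) ^ 2 + 4 * b * c) / (4 * c ^ 2) = k at hk
    obtain ⟨w, z, hwz⟩ : ∃ w z : F, -w ^ 2 + k * z ^ 2 = 1 := by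
      obtain ⟨w, z, h⟩ := FiniteField.exists_root_sum_quadratic
        (f := (-Polynomial.X ^ 2 - 1 : Polynomial F)) (g := Polynomial.C k * Polynomial.X ^ 2)
        (by compute_degree!) (by compute_degree!)
        (FiniteField.odd_card_of_char_ne_two fun h ↦ h2 (by
          simpa [h] using CharP.cast_eq_zero F (ringChar F)))
      exact ⟨w, z, by simp at h; linear_combination h⟩
    refine ⟨w + (a - d) / (2 * c) * z, -((w + (a - d) / (2 * c) * z) * (a - d) + z * b) / c, z,
      by field_simp; ring, ?_⟩
    rw [← hwz, ← hkd]
    have h4 : (4 : F) = 2 * 2 := by norm_num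
    rw [h4]
    field_simp
    ring

/-- A matrix in `SL(2, F)` of trace `±2` is central as soon as some power of it, with exponent
nonzero in `F`, is. -/
theorem Matrix.SpecialLinearGroup.mem_center_of_pow_mem_center {F : Type*} [Field F]
    (h2 : (2 : F) ≠ 0) {A : Matrix.SpecialLinearGroup (Fin 2) F} (hA : A.1.trace ^ 2 = 4) {n : ℕ}
    (hn : (n : F) ≠ 0) (h : A ^ n ∈ Subgroup.center (Matrix.SpecialLinearGroup (Fin 2) F)) :
    A ∈ Subgroup.center (Matrix.SpecialLinearGroup (Fin 2) F) := by
  obtain _ | n := n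
  · simp at hn
  obtain ⟨s, hs⟩ : ∃ s, A.1.trace = 2 * s := ⟨A.1.trace / 2, by field_simp⟩
  have hs2 : s ^ 2 = 1 := by
    rw [hs] at hA
    apply mul_left_cancel₀ (mul_ne_zero h2 h2)
    linear_combination hA
  have hdet : A.1 0 0 * A.1 1 1 - A.1 0 1 * A.1 1 0 = 1 := by
    rw [← Matrix.det_fin_two]; exact A.2
  have hM : A.1 * A.1 = (2 * s) • A.1 - 1 := by
    rw [← hs, Matrix.trace_fin_two]
    ext i j
    fin_cases i <;> fin_cases j <;> simp [Matrix.mul_apply, Fin.sum_univ_two]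
    · linear_combination -hdet
    · ring
    · ring
    · linear_combination -hdet
  have hpow := pow_succ_eq_of_sq_eq hs2 hM n
  have hcoef : ((n : F) + 1) * s ^ n ≠ 0 := by
    refine mul_ne_zero (by exact_mod_cast hn) (pow_ne_zero _ ?_)
    rintro rfl
    simp at hs2
  rw [Subgroup.mem_center_iff] at h ⊢
  intro B
  have hB := congrArg Subtype.val (h B)
  simp only [Matrix.SpecialLinearGroup.coe_mul, Matrix.SpecialLinearGroup.coe_pow, hpow, mul_sub,
    sub_mul, mul_smul_comm, smul_mul_assoc, mul_one, one_mul, sub_left_inj] at hB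
  exact Subtype.ext (smul_right_injective _ hcoef hB)

theorem order_three_seven_real
    (q : ℕ) (hq : IsPrimePow q) (hgcd : Nat.Coprime q 42)
    (hq7 : q % 7 = 1 ∨ q % 7 = 6)
    (F : Type) [Field F] [Fintype F] (hF : Fintype.card F = q)
    (g : PSL2 F) (hg : orderOf g = 3 ∨ orderOf g = 7)
    :
    IsConj g g⁻¹ := by
  subst hF
  have h2 : (2 : F) ≠ 0 := by
    exact_mod_cast natCast_ne_zero_of_card_coprime (F := F) (hgcd.coprime_dvd_right (by norm_num))
  obtain ⟨n, hn, hn1, hgn⟩ : ∃ n : ℕ, (n : F) ≠ 0 ∧ n ≠ 1 ∧ orderOf g = n := by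
    obtain h | h := hg
    exacts [⟨3, natCast_ne_zero_of_card_coprime (hgcd.coprime_dvd_right (by norm_num)),
        by norm_num, h⟩,
      ⟨7, natCast_ne_zero_of_card_coprime (hgcd.coprime_dvd_right (by norm_num)), by norm_num, h⟩]
  obtain ⟨A, rfl⟩ := QuotientGroup.mk_surjective g
  have hconj := Matrix.SpecialLinearGroup.isConj_inv_of_trace_sq_ne_four h2 A fun hA ↦ hn1 <| by
    rw [← hgn, orderOf_eq_one_iff, QuotientGroup.eq_one_iff]
    refine Matrix.SpecialLinearGroup.mem_center_of_pow_mem_center h2 hA hn ?_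
    rw [← QuotientGroup.eq_one_iff, QuotientGroup.mk_pow, ← hgn, pow_orderOf_eq_one]
  exact (QuotientGroup.mk' _).map_isConj hconj
end
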